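/- (Cooper) Let a ≥ 3 be an integer and let I ⊆ A = K[x_1,…,x_n] be a homogeneous ideal containing a homogeneous regular sequence of degree (3,a,a). Then I satisfies EGH_{(3,a,a)}. -/

import Mathlib

open MvPolynomial

section Defs

variable {K : Type*} [Field K]

/-- Total degree of an exponent vector. -/
def expDeg {n : ℕ} (m : Fin n →₀ ℕ) : ℕ := ∑ i, m i

/-- `lexLe m m'` means `m ≤ m'` in the lexicographic order with `x_1 > x_2 > … > x_n`. -/
def lexLe {n : ℕ} (m m' : Fin n →₀ ℕ) : Prop :=
  m = m' ∨ ∃ i : Fin n, (∀ j : Fin n, j < i → m j = m' j) ∧ m i < m' i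

/-- A lex-segment in degree `d`: an upward (w.r.t. lex) closed set of degree-`d`
exponent vectors. -/
def IsLexSegment (n d : ℕ) (S : Set (Fin n →₀ ℕ)) : Prop :=
  (∀ m ∈ S, expDeg m = d) ∧
    ∀ m ∈ S, ∀ m' : Fin n →₀ ℕ, expDeg m' = d → lexLe m m' → m' ∈ S

/-- The pure-powers ideal `(x_1^{a_1}, …, x_r^{a_r})`. -/
noncomputable def purePowers (K : Type*) [Field K] {n r : ℕ} (hrn : r ≤ n)
    (a : Fin r → ℕ) : Ideal (MvPolynomial (Fin n) K) :=
  Ideal.span (Set.range fun i : Fin r => X (Fin.castLE hrn i) ^ a i)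

/-- A homogeneous ideal. -/
def IsHomog {n : ℕ} (I : Ideal (MvPolynomial (Fin n) K)) : Prop :=
  ∀ f ∈ I, ∀ d : ℕ, homogeneousComponent d f ∈ I

/-- The degree-`d` component of an ideal, as a `K`-subspace. -/
noncomputable def component {n : ℕ} (I : Ideal (MvPolynomial (Fin n) K)) (d : ℕ) :
    Submodule K (MvPolynomial (Fin n) K) :=
  Submodule.restrictScalars K I ⊓ homogeneousSubmodule (Fin n) K d

/-- Hilbert function of an ideal: `dim_K I_d`. -/
noncomputable def hilb {n : ℕ} (I : Ideal (MvPolynomial (Fin n) K)) (d : ℕ) : ℕ :=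
  Module.finrank K ↥(component I d)

/-- An `a`-lpp (lex-plus-powers) ideal: a homogeneous (monomial) ideal each of whose graded
components is the span of a lex-segment plus the corresponding component of the
pure-powers ideal. -/
def IsLPP {n r : ℕ} (hrn : r ≤ n) (a : Fin r → ℕ)
    (J : Ideal (MvPolynomial (Fin n) K)) : Prop :=
  IsHomog J ∧
    ∀ d : ℕ, ∃ S : Set (Fin n →₀ ℕ), IsLexSegment n d S ∧
      component J d =
        Submodule.span K ((fun m => (monomial m (1 : K) : MvPolynomial (Fin n) K)) '' S)
          ⊔ component (purePowers K hrn a) d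

/-- `I` satisfies `EGH_a(d)`. -/
def EGHd {n r : ℕ} (hrn : r ≤ n) (a : Fin r → ℕ)
    (I : Ideal (MvPolynomial (Fin n) K)) (d : ℕ) : Prop :=
  ∃ J : Ideal (MvPolynomial (Fin n) K), IsLPP hrn a J ∧
    hilb J d = hilb I d ∧ hilb J (d + 1) ≤ hilb I (d + 1)

/-- `I` satisfies `EGH_a`. -/
def EGH {n r : ℕ} (hrn : r ≤ n) (a : Fin r → ℕ)
    (I : Ideal (MvPolynomial (Fin n) K)) : Prop :=
  ∀ d : ℕ, EGHd hrn a I d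

/-- A monomial ideal. -/
def IsMonomialIdeal {n : ℕ} (I : Ideal (MvPolynomial (Fin n) K)) : Prop :=
  ∃ M : Set (Fin n →₀ ℕ),
    I = Ideal.span ((fun m => (monomial m (1 : K) : MvPolynomial (Fin n) K)) '' M)

/-- A strongly stable (monomial) ideal. -/
def IsStronglyStable {n : ℕ} (S : Ideal (MvPolynomial (Fin n) K)) : Prop :=
  IsMonomialIdeal S ∧
    ∀ (m : Fin n →₀ ℕ) (i j : Fin n), j ≤ i →
      (monomial (m + Finsupp.single i 1) (1 : K) : MvPolynomial (Fin n) K) ∈ S →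
      (monomial (m + Finsupp.single j 1) (1 : K) : MvPolynomial (Fin n) K) ∈ S

/-- An `a`-spp (strongly-stable-plus-powers) ideal. -/
def IsSPP {n r : ℕ} (hrn : r ≤ n) (a : Fin r → ℕ)
    (J : Ideal (MvPolynomial (Fin n) K)) : Prop :=
  ∃ S : Ideal (MvPolynomial (Fin n) K), IsStronglyStable S ∧ J = S ⊔ purePowers K hrn a

/-- A regular sequence: each `f i` is a non-zerodivisor modulo `(f j : j < i)`. -/
def IsRegSeq {n r : ℕ} (f : Fin r → MvPolynomial (Fin n) K) : Prop :=
  ∀ i : Fin r, ∀ g : MvPolynomial (Fin n) K,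
    g * f i ∈ Ideal.span { p | ∃ j : Fin r, j < i ∧ p = f j } →
    g ∈ Ideal.span { p | ∃ j : Fin r, j < i ∧ p = f j }

/-- `I` contains a homogeneous regular sequence of degree `a`. -/
def ContainsRegSeq {n r : ℕ} (a : Fin r → ℕ)
    (I : Ideal (MvPolynomial (Fin n) K)) : Prop :=
  ∃ f : Fin r → MvPolynomial (Fin n) K,
    (∀ i, f i ∈ I) ∧ IsRegSeq f ∧ ∀ i, (f i).IsHomogeneous (a i)

/-- `dim_K (N/P)` for ideals `P ≤ N` (the `K`-dimension of `N/(N ∩ P)`). -/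
noncomputable def quotDim (K : Type*) [Field K] {n : ℕ}
    (N P : Ideal (MvPolynomial (Fin n) K)) : ℕ :=
  Module.finrank K
    (↥(Submodule.restrictScalars K N) ⧸
      Submodule.comap (Submodule.restrictScalars K N).subtype (Submodule.restrictScalars K P))

/-- `dim_K (I/F)_d`. -/
noncomputable def relHilb {n : ℕ} (I F : Ideal (MvPolynomial (Fin n) K)) (d : ℕ) : ℕ :=
  Module.finrank K
    (↥(component I d) ⧸ Submodule.comap (component I d).subtype (Submodule.restrictScalars K F))

/-- `dim_K (A/I)_d`. -/
noncomputable def hilbQ {n : ℕ} (I : Ideal (MvPolynomial (Fin n) K)) (d : ℕ) : ℕ :=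
  Module.finrank K
    (↥(homogeneousSubmodule (Fin n) K d) ⧸
      Submodule.comap (homogeneousSubmodule (Fin n) K d).subtype (Submodule.restrictScalars K I))

end Defs

attribute [local instance] MvPolynomial.gradedAlgebra

/-! ### Graded components and Hilbert functions -/

section Basic

variable {K : Type*} [Field K] {n : ℕ}

lemma mem_component {I : Ideal (MvPolynomial (Fin n) K)} {d : ℕ} {f : MvPolynomial (Fin n) K} :
    f ∈ component I d ↔ f ∈ I ∧ f.IsHomogeneous d := by
  simp [component, Submodule.mem_inf, mem_homogeneousSubmodule]

instance finiteDimensional_homogeneousSubmodule (d : ℕ) :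
    FiniteDimensional K (homogeneousSubmodule (Fin n) K d) :=
  Module.Finite.iff_fg.2 (homogeneousSubmodule_fg (σ := Fin n) (R := K) d)

instance finiteDimensional_component (I : Ideal (MvPolynomial (Fin n) K)) (d : ℕ) :
    FiniteDimensional K (component I d) :=
  Submodule.finiteDimensional_of_le (S₂ := homogeneousSubmodule (Fin n) K d) inf_le_right

lemma component_mono {I J : Ideal (MvPolynomial (Fin n) K)} (h : I ≤ J) (d : ℕ) :
    component I d ≤ component J d := fun f hf => by
  rw [mem_component] at *; exact ⟨h hf.1, hf.2⟩

lemma hilb_le_of_component_le {I J : Ideal (MvPolynomial (Fin n) K)} {d : ℕ}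
    (h : component I d ≤ component J d) : hilb I d ≤ hilb J d :=
  Submodule.finrank_mono h

lemma hilb_mono {I J : Ideal (MvPolynomial (Fin n) K)} (h : I ≤ J) (d : ℕ) :
    hilb I d ≤ hilb J d := hilb_le_of_component_le (component_mono h d)

lemma component_eq_of_hilb_le {I J : Ideal (MvPolynomial (Fin n) K)} {d : ℕ}
    (h : component I d ≤ component J d) (h' : hilb J d ≤ hilb I d) :
    component I d = component J d :=
  Submodule.eq_of_le_of_finrank_le h h'

lemma component_top (d : ℕ) :
    component (⊤ : Ideal (MvPolynomial (Fin n) K)) d = homogeneousSubmodule (Fin n) K d := by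
  ext f; simp [mem_component]

lemma component_bot (d : ℕ) :
    component (⊥ : Ideal (MvPolynomial (Fin n) K)) d = ⊥ := by
  ext f; simp only [mem_component, Ideal.mem_bot, Submodule.mem_bot]
  exact ⟨fun h => h.1, fun h => ⟨h, h ▸ isHomogeneous_zero _ _ d⟩⟩

/-- The Hilbert function of the polynomial ring. -/
noncomputable abbrev hilbTop (K : Type*) [Field K] (n d : ℕ) : ℕ :=
  hilb (⊤ : Ideal (MvPolynomial (Fin n) K)) d

lemma hilb_bot (d : ℕ) : hilb (⊥ : Ideal (MvPolynomial (Fin n) K)) d = 0 := by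
  rw [hilb, component_bot]; exact finrank_bot K _

lemma isHomog_iff {I : Ideal (MvPolynomial (Fin n) K)} :
    IsHomog I ↔ I.IsHomogeneous (homogeneousSubmodule (Fin n) K) := by
  constructor
  · intro h i f hf
    have := h f hf i
    rwa [← decomposition.decompose'_apply] at this
  · intro h f hf d
    exact homogeneousComponent_mem_of_mem h hf d

lemma isHomog_bot : IsHomog (⊥ : Ideal (MvPolynomial (Fin n) K)) := by
  intro f hf d
  rw [Ideal.mem_bot] at hf
  subst hf
  simp

lemma isHomog_top : IsHomog (⊤ : Ideal (MvPolynomial (Fin n) K)) := fun _ _ _ => trivial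

lemma IsHomog.sup {I J : Ideal (MvPolynomial (Fin n) K)} (hI : IsHomog I) (hJ : IsHomog J) :
    IsHomog (I ⊔ J) :=
  isHomog_iff.2 (Ideal.IsHomogeneous.sup (isHomog_iff.1 hI) (isHomog_iff.1 hJ))

lemma isHomog_span {S : Set (MvPolynomial (Fin n) K)} {d : MvPolynomial (Fin n) K → ℕ}
    (h : ∀ f ∈ S, f.IsHomogeneous (d f)) : IsHomog (Ideal.span S) :=
  isHomog_iff.2 (Ideal.homogeneous_span _ _ fun f hf => ⟨d f, h f hf⟩)

lemma isHomog_span_singleton {g : MvPolynomial (Fin n) K} {e : ℕ} (h : g.IsHomogeneous e) :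
    IsHomog (Ideal.span {g}) :=
  isHomog_span (d := fun _ => e) fun f hf => by rw [Set.mem_singleton_iff.1 hf]; exact h

lemma homogeneousComponent_mul_of_right {g : MvPolynomial (Fin n) K} {e : ℕ}
    (h : g.IsHomogeneous e) (u : MvPolynomial (Fin n) K) (d : ℕ) :
    homogeneousComponent (d + e) (u * g) = homogeneousComponent d u * g := by
  have := DirectSum.coe_decompose_mul_add_of_right_mem (homogeneousSubmodule (Fin n) K)
    (i := d) (j := e) (a := u) (b := g) h
  have h1 := decomposition.decompose'_apply (u * g) (d + e)
  have h2 := decomposition.decompose'_apply u d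
  rw [← h1, ← h2]; exact this

lemma homogeneousComponent_mul_of_right_of_lt {g : MvPolynomial (Fin n) K} {e : ℕ}
    (h : g.IsHomogeneous e) (u : MvPolynomial (Fin n) K) {d : ℕ} (hd : d < e) :
    homogeneousComponent d (u * g) = 0 := by
  have := DirectSum.coe_decompose_mul_of_right_mem_of_not_le (homogeneousSubmodule (Fin n) K)
    (n := d) (i := e) (a := u) (b := g) h (by omega)
  have h1 := decomposition.decompose'_apply (u * g) d
  rw [← h1]; exact this

/-- Membership in a homogeneous ideal can be tested on components. -/
lemma IsHomog.mem_iff {I : Ideal (MvPolynomial (Fin n) K)} (hI : IsHomog I)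
    {f : MvPolynomial (Fin n) K} : f ∈ I ↔ ∀ d, homogeneousComponent d f ∈ I :=
  mem_iff_homogeneousComponent_mem (isHomog_iff.1 hI) f

/-- The ideal quotient by an element. -/
def quo {R : Type*} [CommRing R] (I : Ideal R) (g : R) : Ideal R :=
  Submodule.comap (LinearMap.mulRight R g) I

lemma mem_quo {R : Type*} [CommRing R] {I : Ideal R} {g u : R} : u ∈ quo I g ↔ u * g ∈ I :=
  Iff.rfl

lemma le_quo {R : Type*} [CommRing R] (I : Ideal R) (g : R) : I ≤ quo I g := fun _ hu =>
  mem_quo.2 (I.mul_mem_right _ hu)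

lemma IsHomog.quo {I : Ideal (MvPolynomial (Fin n) K)} (hI : IsHomog I)
    {g : MvPolynomial (Fin n) K} {e : ℕ} (h : g.IsHomogeneous e) : IsHomog (quo I g) := by
  intro f hf d
  rw [mem_quo, ← homogeneousComponent_mul_of_right h]
  exact hI _ hf _

lemma component_sup {I J : Ideal (MvPolynomial (Fin n) K)} (hI : IsHomog I) (hJ : IsHomog J)
    (d : ℕ) : component (I ⊔ J) d = component I d ⊔ component J d := by
  apply le_antisymm
  · intro f hf
    obtain ⟨hf, hd⟩ := mem_component.1 hf
    obtain ⟨a, ha, b, hb, rfl⟩ := Submodule.mem_sup.1 hf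
    rw [← homogeneousComponent_eq_self hd, map_add]
    exact Submodule.add_mem_sup
      (mem_component.2 ⟨hI _ ha _, homogeneousComponent_isHomogeneous _ _⟩)
      (mem_component.2 ⟨hJ _ hb _, homogeneousComponent_isHomogeneous _ _⟩)
  · exact sup_le (component_mono le_sup_left _) (component_mono le_sup_right _)

lemma component_inf (I J : Ideal (MvPolynomial (Fin n) K)) (d : ℕ) :
    component (I ⊓ J) d = component I d ⊓ component J d := by
  ext f; simp only [mem_component, Submodule.mem_inf]; tauto

lemma hilb_sup_add_hilb_inf {I J : Ideal (MvPolynomial (Fin n) K)} (hI : IsHomog I)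
    (hJ : IsHomog J) (d : ℕ) :
    hilb (I ⊔ J) d + hilb (I ⊓ J) d = hilb I d + hilb J d := by
  rw [hilb, hilb, component_sup hI hJ, component_inf]
  exact Submodule.finrank_sup_add_finrank_inf_eq _ _

lemma mem_span_singleton_component {g : MvPolynomial (Fin n) K} {e : ℕ} (h : g.IsHomogeneous e)
    {d : ℕ} {f : MvPolynomial (Fin n) K} :
    f ∈ component (Ideal.span {g}) (d + e) ↔ ∃ u, u.IsHomogeneous d ∧ u * g = f := by
  rw [mem_component, Ideal.mem_span_singleton']
  constructor
  · rintro ⟨⟨u, rfl⟩, hu⟩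
    refine ⟨homogeneousComponent d u, homogeneousComponent_isHomogeneous _ _, ?_⟩
    rw [← homogeneousComponent_mul_of_right h, homogeneousComponent_eq_self hu]
  · rintro ⟨u, hu, rfl⟩
    exact ⟨⟨u, rfl⟩, hu.mul h⟩

lemma component_span_singleton_of_lt {g : MvPolynomial (Fin n) K} {e : ℕ} (h : g.IsHomogeneous e)
    {d : ℕ} (hd : d < e) : component (Ideal.span {g}) d = ⊥ := by
  rw [eq_bot_iff]
  intro f hf
  rw [mem_component, Ideal.mem_span_singleton'] at hf
  obtain ⟨⟨u, rfl⟩, hu⟩ := hf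
  rw [Submodule.mem_bot, ← homogeneousComponent_eq_self hu,
    homogeneousComponent_mul_of_right_of_lt h _ hd]

lemma component_sup_span_of_lt {J : Ideal (MvPolynomial (Fin n) K)} (hJ : IsHomog J)
    {g : MvPolynomial (Fin n) K} {e : ℕ} (h : g.IsHomogeneous e) {d : ℕ} (hd : d < e) :
    component (J ⊔ Ideal.span {g}) d = component J d := by
  rw [component_sup hJ (isHomog_span_singleton h), component_span_singleton_of_lt h hd,
    sup_bot_eq]

lemma exists_of_mem_sup_span {J : Ideal (MvPolynomial (Fin n) K)} (hJ : IsHomog J)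
    {g : MvPolynomial (Fin n) K} {e : ℕ} (h : g.IsHomogeneous e) {d : ℕ}
    {f : MvPolynomial (Fin n) K} (hf : f ∈ component (J ⊔ Ideal.span {g}) (d + e)) :
    ∃ u, u.IsHomogeneous d ∧ f - u * g ∈ component J (d + e) := by
  rw [component_sup hJ (isHomog_span_singleton h)] at hf
  obtain ⟨a, ha, b, hb, rfl⟩ := Submodule.mem_sup.1 hf
  obtain ⟨u, hu, rfl⟩ := (mem_span_singleton_component h).1 hb
  exact ⟨u, hu, by simpa using ha⟩

lemma finrank_map_mulRight (g : MvPolynomial (Fin n) K) (hg : g ≠ 0)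
    (V : Submodule K (MvPolynomial (Fin n) K)) :
    Module.finrank K (V.map (LinearMap.mulRight K g)) = Module.finrank K V :=
  (Submodule.equivMapOfInjective (LinearMap.mulRight K g)
    (fun _ _ hab => mul_right_cancel₀ hg hab) V).finrank_eq.symm

/-- Dimension count for adding one homogeneous generator to a homogeneous ideal. -/
lemma hilb_sup_span_add_hilb_quo {J : Ideal (MvPolynomial (Fin n) K)} (hJ : IsHomog J)
    {g : MvPolynomial (Fin n) K} {e : ℕ} (h : g.IsHomogeneous e) (hg : g ≠ 0) (d : ℕ) :
    hilb (J ⊔ Ideal.span {g}) (d + e) + hilb (quo J g) d = hilb J (d + e) + hilbTop K n d := by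
  have h1 : component (Ideal.span {g}) (d + e)
      = (component ⊤ d).map (LinearMap.mulRight K g) := by
    ext f
    simp [mem_span_singleton_component h, mem_component]
  have h2 : component (J ⊓ Ideal.span {g}) (d + e)
      = (component (quo J g) d).map (LinearMap.mulRight K g) := by
    ext f
    rw [component_inf, Submodule.mem_inf, mem_span_singleton_component h]
    simp only [mem_component, Submodule.mem_map, LinearMap.mulRight_apply, mem_quo]
    constructor
    · rintro ⟨⟨h1, h2⟩, u, hu, rfl⟩
      exact ⟨u, ⟨h1, hu⟩, rfl⟩
    · rintro ⟨u, ⟨h1, hu⟩, rfl⟩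
      exact ⟨⟨h1, hu.mul h⟩, u, hu, rfl⟩
  have := hilb_sup_add_hilb_inf hJ (isHomog_span_singleton h) (d + e)
  have h3 : hilb (J ⊓ Ideal.span {g}) (d + e) = hilb (quo J g) d := by
    rw [hilb, h2, finrank_map_mulRight g hg, hilb]
  have h4 : hilb (Ideal.span {g}) (d + e) = hilbTop K n d := by
    rw [hilb, h1, finrank_map_mulRight g hg, hilbTop, hilb]
  omega

lemma hilb_sup_span_of_lt {J : Ideal (MvPolynomial (Fin n) K)} (hJ : IsHomog J)
    {g : MvPolynomial (Fin n) K} {e : ℕ} (h : g.IsHomogeneous e) {d : ℕ} (hd : d < e) :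
    hilb (J ⊔ Ideal.span {g}) d = hilb J d := by
  rw [hilb, hilb, component_sup_span_of_lt hJ h hd]

end Basic

/-! ### Complete intersections and linear sections -/

/-- `g` is a non-zerodivisor modulo `J`. -/
def Nzd {R : Type*} [CommRing R] (J : Ideal R) (g : R) : Prop := ∀ u, u * g ∈ J → u ∈ J

section CI

variable {K : Type*} [Field K] {n : ℕ}

/-- `IsCI as J` says that `J` is generated by a homogeneous regular sequence whose degrees,
listed from last to first, are `as`. -/
inductive IsCI : List ℕ → Ideal (MvPolynomial (Fin n) K) → Prop
  | nil : IsCI [] ⊥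
  | cons {e : ℕ} {as : List ℕ} {J : Ideal (MvPolynomial (Fin n) K)}
      (g : MvPolynomial (Fin n) K) (hJ : IsCI as J) (hg : g.IsHomogeneous e) (he : 0 < e)
      (hnzd : Nzd J g) : IsCI (e :: as) (J ⊔ Ideal.span {g})

lemma IsCI.isHomog {as : List ℕ} {J : Ideal (MvPolynomial (Fin n) K)} (h : IsCI as J) :
    IsHomog J := by
  induction h with
  | nil => exact isHomog_bot
  | cons g _ hg _ _ ih => exact ih.sup (isHomog_span_singleton hg)

lemma IsCI.one_notMem {as : List ℕ} {J : Ideal (MvPolynomial (Fin n) K)} (h : IsCI as J) :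
    (1 : MvPolynomial (Fin n) K) ∉ J := by
  induction h with
  | nil => simp
  | cons g hJ hg he _ ih =>
    intro h
    have : (1 : MvPolynomial (Fin n) K) ∈ component (_ ⊔ Ideal.span {g}) 0 :=
      mem_component.2 ⟨h, isHomogeneous_one _ _⟩
    rw [component_sup_span_of_lt hJ.isHomog hg he] at this
    exact ih (mem_component.1 this).1

lemma Nzd.quo_eq {R : Type*} [CommRing R] {J : Ideal R} {g : R} (h : Nzd J g) : quo J g = J :=
  le_antisymm (fun u hu => h u hu) (le_quo J g)

lemma Nzd.ne_zero {R : Type*} [CommRing R] {J : Ideal R} {g : R} (h : Nzd J g)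
    (h1 : (1 : R) ∉ J) : g ≠ 0 := by
  rintro rfl
  exact h1 (h 1 (by simp))

lemma Nzd.mul {R : Type*} [CommRing R] {J : Ideal R} {g g' : R} (h : Nzd J g) (h' : Nzd J g') :
    Nzd J (g * g') := fun u hu => h u (h' _ (by rwa [mul_assoc]))

lemma Nzd.pow {R : Type*} [CommRing R] {J : Ideal R} {g : R} (h : Nzd J g) (k : ℕ) :
    Nzd J (g ^ k) := by
  induction k with
  | zero => intro u hu; simpa using hu
  | succ k ih => rw [pow_succ]; exact ih.mul h

lemma hilb_sup_span_of_nzd {as : List ℕ} {J : Ideal (MvPolynomial (Fin n) K)} (h : IsCI as J)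
    {g : MvPolynomial (Fin n) K} {e : ℕ} (hg : g.IsHomogeneous e) (hn : Nzd J g) (d : ℕ) :
    hilb (J ⊔ Ideal.span {g}) (d + e) + hilb J d = hilb J (d + e) + hilbTop K n d := by
  have := hilb_sup_span_add_hilb_quo h.isHomog hg (hn.ne_zero h.one_notMem) d
  rwa [hn.quo_eq] at this

/-- The Hilbert function of a complete intersection depends on the degrees only. -/
lemma IsCI.hilb_eq {as : List ℕ} {J J' : Ideal (MvPolynomial (Fin n) K)} (h : IsCI as J)
    (h' : IsCI as J') (d : ℕ) : hilb J d = hilb J' d := by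
  induction h generalizing J' d with
  | nil => cases h'; rfl
  | @cons e as J g hJ hg he hn ih =>
    cases h' with
    | @cons _ _ J' g' hJ' hg' he' hn' =>
      by_cases hd : d < e
      · rw [hilb_sup_span_of_lt hJ.isHomog hg hd, hilb_sup_span_of_lt hJ'.isHomog hg' hd, ih hJ']
      · obtain ⟨d, rfl⟩ := Nat.exists_eq_add_of_le' (not_lt.1 hd)
        have h1 := hilb_sup_span_of_nzd hJ hg hn d
        have h2 := hilb_sup_span_of_nzd hJ' hg' hn' d
        rw [ih hJ', ih hJ'] at h1
        omega

lemma nzd_of_homogeneous {J : Ideal (MvPolynomial (Fin n) K)} (hJ : IsHomog J)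
    {g : MvPolynomial (Fin n) K} {e : ℕ} (hg : g.IsHomogeneous e)
    (h : ∀ d u, u.IsHomogeneous d → u * g ∈ J → u ∈ J) : Nzd J g := fun u hu =>
  hJ.mem_iff.2 fun d => h d _ (homogeneousComponent_isHomogeneous _ _) (by
    rw [← homogeneousComponent_mul_of_right hg]; exact hJ _ hu _)

lemma nzd_of_nzd_sup {J : Ideal (MvPolynomial (Fin n) K)} (hJ : IsHomog J)
    {g l : MvPolynomial (Fin n) K} {e t : ℕ} (hg : g.IsHomogeneous e) (he : 0 < e)
    (hl : l.IsHomogeneous t) (hn : Nzd J g) (hnl : Nzd (J ⊔ Ideal.span {g}) l) : Nzd J l := by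
  refine nzd_of_homogeneous hJ hl fun d => ?_
  induction d using Nat.strong_induction_on with
  | _ d ih =>
    intro u hu hul
    have h1 : u ∈ component (J ⊔ Ideal.span {g}) d :=
      mem_component.2 ⟨hnl u ((le_sup_left : J ≤ J ⊔ Ideal.span {g}) hul), hu⟩
    by_cases hd : d < e
    · rw [component_sup_span_of_lt hJ hg hd] at h1
      exact (mem_component.1 h1).1
    · obtain ⟨d, rfl⟩ := Nat.exists_eq_add_of_le' (not_lt.1 hd)
      obtain ⟨v, hv, hvu⟩ := exists_of_mem_sup_span hJ hg h1
      have h2 := (mem_component.1 hvu).1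
      have h3 : v * l * g ∈ J := by
        have : v * l * g = u * l - l * (u - v * g) := by ring
        rw [this]
        exact sub_mem hul (J.mul_mem_left _ h2)
      have h4 := ih d (by omega) v hv (hn _ h3)
      have : u = (u - v * g) + g * v := by ring
      rw [this]
      exact add_mem h2 (J.mul_mem_left _ h4)

lemma nzd_sup_of_nzd_sup {R : Type*} [CommRing R] {J : Ideal R} {g l : R} (hn : Nzd J g)
    (hnl : Nzd (J ⊔ Ideal.span {g}) l) : Nzd (J ⊔ Ideal.span {l}) g := by
  intro u hu
  obtain ⟨j, hj, w, hw, hjw⟩ := Submodule.mem_sup.1 hu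
  obtain ⟨w, rfl⟩ := Ideal.mem_span_singleton'.1 hw
  have h1 : w * l ∈ J ⊔ Ideal.span {g} := by
    have : w * l = -j + u * g := by rw [← hjw]; ring
    rw [this]
    exact Submodule.add_mem_sup (neg_mem hj) (Ideal.mem_span_singleton'.2 ⟨u, rfl⟩)
  obtain ⟨j', hj', v, hv, hjv⟩ := Submodule.mem_sup.1 (hnl w h1)
  obtain ⟨v, rfl⟩ := Ideal.mem_span_singleton'.1 hv
  have h2 : u - v * l ∈ J := by
    apply hn
    have : (u - v * l) * g = j + l * j' := by
      have h3 : u * g = j + (j' + v * g) * l := by rw [← hjw, ← hjv]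
      linear_combination h3
    rw [this]
    exact add_mem hj (J.mul_mem_left _ hj')
  have : u = (u - v * l) + v * l := by ring
  rw [this]
  exact Submodule.add_mem_sup h2 (Ideal.mem_span_singleton'.2 ⟨v, rfl⟩)

/-- `π` is (up to a graded isomorphism) the quotient map by the nonzero linear form `l`. -/
structure IsProj (π : MvPolynomial (Fin (n + 1)) K →ₐ[K] MvPolynomial (Fin n) K)
    (l : MvPolynomial (Fin (n + 1)) K) : Prop where
  surj : Function.Surjective π
  ker : ∀ f, π f = 0 ↔ f ∈ Ideal.span {l}
  hom : ∀ f d, f.IsHomogeneous d → (π f).IsHomogeneous d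
  linear : l.IsHomogeneous 1
  ne_zero : l ≠ 0

/-- The substitution of a linear form for the variable `k`. -/
noncomputable def projHom (k : Fin (n + 1)) (c : Fin n → K) :
    MvPolynomial (Fin (n + 1)) K →ₐ[K] MvPolynomial (Fin n) K :=
  aeval (k.insertNth (∑ j, C (c j) * X j) (fun j => (X j : MvPolynomial (Fin n) K)))

lemma projHom_X_self (k : Fin (n + 1)) (c : Fin n → K) :
    projHom k c (X k) = ∑ j, C (c j) * X j := by simp [projHom]

lemma projHom_X_succAbove (k : Fin (n + 1)) (c : Fin n → K) (j : Fin n) :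
    projHom k c (X (k.succAbove j)) = X j := by simp [projHom]

lemma isProj_projHom (k : Fin (n + 1)) (c : Fin n → K) :
    IsProj (projHom k c) (X k - ∑ j, C (c j) * X (k.succAbove j)) := by
  set l : MvPolynomial (Fin (n + 1)) K := X k - ∑ j, C (c j) * X (k.succAbove j) with hl
  have hpl : projHom k c l = 0 := by
    rw [hl, map_sub, projHom_X_self, map_sum, sub_eq_zero]
    refine Finset.sum_congr rfl fun j _ => ?_
    rw [map_mul, projHom_X_succAbove]
    congr 1
    exact ((projHom k c).commutes (c j)).symm
  let ι : MvPolynomial (Fin n) K →ₐ[K] MvPolynomial (Fin (n + 1)) K := rename k.succAbove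
  have hs : ∀ f, projHom k c (ι f) = f := by
    have : (projHom k c).comp ι = AlgHom.id K _ := by
      apply algHom_ext
      intro j
      simp [ι, projHom_X_succAbove]
    exact fun f => DFunLike.congr_fun this f
  have hk : ∀ f, f - ι (projHom k c f) ∈ Ideal.span {l} := by
    have : ((Ideal.Quotient.mkₐ K (Ideal.span {l})).comp (ι.comp (projHom k c)))
        = Ideal.Quotient.mkₐ K (Ideal.span {l}) := by
      apply algHom_ext
      intro i
      rcases Fin.eq_self_or_eq_succAbove k i with rfl | ⟨j, rfl⟩
      · simp only [AlgHom.comp_apply, projHom_X_self, Ideal.Quotient.mkₐ_eq_mk]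
        rw [eq_comm, Ideal.Quotient.eq]
        apply Ideal.subset_span
        simp [hl, ι]
      · simp [AlgHom.comp_apply, projHom_X_succAbove, ι]
    intro f
    have := DFunLike.congr_fun this f
    rw [← Ideal.Quotient.eq]
    exact this.symm
  refine ⟨fun f => ⟨ι f, hs f⟩, fun f => ⟨fun hf => ?_, fun hf => ?_⟩, fun f d hf => ?_, ?_, ?_⟩
  · simpa [hf] using hk f
  · obtain ⟨u, rfl⟩ := Ideal.mem_span_singleton'.1 hf
    rw [map_mul, hpl, mul_zero]
  · have := hf.aeval (k.insertNth (∑ j, C (c j) * X j) (fun j => (X j : MvPolynomial (Fin n) K)))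
      (n := 1) (fun i => by
        rcases Fin.eq_self_or_eq_succAbove k i with rfl | ⟨j, rfl⟩
        · rw [Fin.insertNth_apply_same]
          exact IsHomogeneous.sum _ _ _ fun j _ => isHomogeneous_C_mul_X _ _
        · rw [Fin.insertNth_apply_succAbove]
          exact isHomogeneous_X _ _)
    simpa [projHom] using this
  · exact (isHomogeneous_X _ _).sub
      (IsHomogeneous.sum _ _ _ fun j _ => isHomogeneous_C_mul_X _ _)
  · intro h0
    have := congrArg (coeff (Finsupp.single k 1)) h0
    rw [hl, coeff_sub, coeff_sum] at this
    simp [coeff_C_mul, coeff_X, Finsupp.single_left_inj] at this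

lemma exists_isProj {l : MvPolynomial (Fin (n + 1)) K} (hl : l.IsHomogeneous 1) (h0 : l ≠ 0) :
    ∃ π, IsProj π l := by
  have h1 : l ∈ Submodule.span K (Set.range (X : Fin (n + 1) → MvPolynomial (Fin (n + 1)) K)) := by
    rw [← homogeneousSubmodule_one_eq_span_X]; exact hl
  obtain ⟨c, hc⟩ := (Submodule.mem_span_range_iff_exists_fun K).1 h1
  have : ∃ k, c k ≠ 0 := by
    by_contra! h
    apply h0
    rw [← hc]
    exact Finset.sum_eq_zero fun i _ => by rw [h, zero_smul]
  obtain ⟨k, hk⟩ := this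
  have h2 := isProj_projHom k (fun j => - (c (k.succAbove j) / c k))
  have h3 : l = C (c k) * (X k - ∑ j, C (- (c (k.succAbove j) / c k)) * X (k.succAbove j)) := by
    rw [← hc, Fin.sum_univ_succAbove _ k, mul_sub, Finset.mul_sum, sub_eq_add_neg,
      ← Finset.sum_neg_distrib, smul_eq_C_mul]
    congr 1
    refine Finset.sum_congr rfl fun j _ => ?_
    rw [← mul_assoc, ← C_mul, smul_eq_C_mul, ← neg_mul, ← C_neg]
    congr 2
    field_simp
    try ring
  refine ⟨_, h2.surj, fun f => ?_, h2.hom, hl, h0⟩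
  have hu : IsUnit (C (c k) : MvPolynomial (Fin (n + 1)) K) := (isUnit_iff_ne_zero.2 hk).map C
  rw [h2.ker, h3, Ideal.span_singleton_mul_left_unit hu]

variable {π : MvPolynomial (Fin (n + 1)) K →ₐ[K] MvPolynomial (Fin n) K}
  {l : MvPolynomial (Fin (n + 1)) K}

lemma IsProj.homogeneousComponent (h : IsProj π l) (f : MvPolynomial (Fin (n + 1)) K) (d : ℕ) :
    MvPolynomial.homogeneousComponent d (π f) = π (MvPolynomial.homogeneousComponent d f) := by
  conv_lhs => rw [← sum_homogeneousComponent f, map_sum, map_sum]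
  by_cases hd : d ∈ Finset.range (f.totalDegree + 1)
  · rw [Finset.sum_eq_single_of_mem d hd]
    · exact homogeneousComponent_eq_self (h.hom _ _ (homogeneousComponent_isHomogeneous _ _))
    · intro i _ hi
      rw [homogeneousComponent_of_mem (h.hom _ _ (homogeneousComponent_isHomogeneous i _)),
        if_neg (Ne.symm hi)]
  · rw [homogeneousComponent_eq_zero d f (by simpa using hd), map_zero]
    refine Finset.sum_eq_zero fun i hi => ?_
    rw [homogeneousComponent_of_mem (h.hom _ _ (homogeneousComponent_isHomogeneous i _)),
      if_neg (by rintro rfl; exact hd hi)]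

lemma IsProj.mem_map (h : IsProj π l) {I : Ideal (MvPolynomial (Fin (n + 1)) K)}
    {y : MvPolynomial (Fin n) K} : y ∈ I.map π ↔ ∃ x ∈ I, π x = y :=
  Ideal.mem_map_iff_of_surjective π h.surj

lemma IsProj.apply_mem_map (h : IsProj π l) {I : Ideal (MvPolynomial (Fin (n + 1)) K)}
    {u : MvPolynomial (Fin (n + 1)) K} : π u ∈ I.map π ↔ u ∈ I ⊔ Ideal.span {l} := by
  rw [h.mem_map]
  constructor
  · rintro ⟨x, hx, hxu⟩
    have : u = x + (u - x) := by ring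
    rw [this]
    exact Submodule.add_mem_sup hx ((h.ker _).1 (by rw [map_sub, hxu, sub_self]))
  · intro hu
    obtain ⟨x, hx, y, hy, rfl⟩ := Submodule.mem_sup.1 hu
    exact ⟨x, hx, by rw [map_add, (h.ker y).2 hy, add_zero]⟩

lemma IsProj.isHomog_map (h : IsProj π l) {I : Ideal (MvPolynomial (Fin (n + 1)) K)}
    (hI : IsHomog I) : IsHomog (I.map π) := by
  intro f hf d
  obtain ⟨x, hx, rfl⟩ := h.mem_map.1 hf
  rw [h.homogeneousComponent]
  exact Ideal.mem_map_of_mem π (hI x hx d)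

lemma IsProj.component_map (h : IsProj π l) {I : Ideal (MvPolynomial (Fin (n + 1)) K)}
    (hI : IsHomog I) (d : ℕ) : component (I.map π) d = (component I d).map π.toLinearMap := by
  ext f
  simp only [Submodule.mem_map, mem_component, h.mem_map]
  constructor
  · rintro ⟨⟨x, hx, rfl⟩, hd⟩
    refine ⟨_, ⟨hI x hx d, homogeneousComponent_isHomogeneous _ _⟩, ?_⟩
    rw [AlgHom.toLinearMap_apply, ← h.homogeneousComponent, homogeneousComponent_eq_self hd]
  · rintro ⟨x, ⟨hx, hd⟩, rfl⟩
    exact ⟨⟨x, hx, rfl⟩, h.hom _ _ hd⟩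

lemma finrank_eq_finrank_map_add {V W : Type*} [AddCommGroup V] [Module K V] [AddCommGroup W]
    [Module K W] (f : V →ₗ[K] W) (S : Submodule K V) [FiniteDimensional K S] :
    Module.finrank K S = Module.finrank K (S.map f)
      + Module.finrank K (S ⊓ LinearMap.ker f : Submodule K V) := by
  have h1 := LinearMap.finrank_range_add_finrank_ker (f.domRestrict S)
  have h2 : Module.finrank K (LinearMap.ker (f.domRestrict S))
      = Module.finrank K (S ⊓ LinearMap.ker f : Submodule K V) := by
    have h3 : (LinearMap.ker (f.domRestrict S)).map S.subtype = S ⊓ LinearMap.ker f := by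
      rw [LinearMap.ker_domRestrict, Submodule.map_comap_subtype]
    rw [← h3]
    exact (Submodule.equivMapOfInjective S.subtype S.injective_subtype _).finrank_eq
  rw [LinearMap.range_domRestrict] at h1
  omega

lemma IsProj.hilb_succ (h : IsProj π l) {I : Ideal (MvPolynomial (Fin (n + 1)) K)}
    (hI : IsHomog I) (d : ℕ) : hilb I (d + 1) = hilb (quo I l) d + hilb (I.map π) (d + 1) := by
  have h1 := finrank_eq_finrank_map_add π.toLinearMap (component I (d + 1))
  have h2 : component I (d + 1) ⊓ LinearMap.ker π.toLinearMap
      = (component (quo I l) d).map (LinearMap.mulRight K l) := by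
    ext f
    simp only [Submodule.mem_inf, LinearMap.mem_ker, AlgHom.toLinearMap_apply, h.ker,
      Submodule.mem_map, LinearMap.mulRight_apply]
    constructor
    · rintro ⟨hf, hfl⟩
      obtain ⟨u, hu, rfl⟩ := (mem_span_singleton_component h.linear).1
        (mem_component.2 ⟨hfl, (mem_component.1 hf).2⟩)
      exact ⟨u, mem_component.2 ⟨(mem_component.1 hf).1, hu⟩, rfl⟩
    · rintro ⟨u, hu, rfl⟩
      obtain ⟨hu, hd⟩ := mem_component.1 hu
      exact ⟨mem_component.2 ⟨hu, hd.mul h.linear⟩, Ideal.mem_span_singleton'.2 ⟨u, rfl⟩⟩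
  rw [h2, finrank_map_mulRight l h.ne_zero, ← h.component_map hI] at h1
  rw [hilb, h1, hilb, hilb, add_comm]

lemma IsProj.hilb_zero (h : IsProj π l) {I : Ideal (MvPolynomial (Fin (n + 1)) K)}
    (hI : IsHomog I) : hilb I 0 = hilb (I.map π) 0 := by
  have h1 := finrank_eq_finrank_map_add π.toLinearMap (component I 0)
  have h2 : component I 0 ⊓ LinearMap.ker π.toLinearMap = ⊥ := by
    rw [eq_bot_iff]
    intro f hf
    obtain ⟨hf, hfl⟩ := Submodule.mem_inf.1 hf
    rw [LinearMap.mem_ker, AlgHom.toLinearMap_apply, h.ker] at hfl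
    rw [← component_span_singleton_of_lt h.linear zero_lt_one]
    exact mem_component.2 ⟨hfl, (mem_component.1 hf).2⟩
  rw [h2, finrank_bot, ← h.component_map hI] at h1
  exact h1

lemma IsCI.map {as : List ℕ} {J : Ideal (MvPolynomial (Fin (n + 1)) K)} (hJ : IsCI as J)
    (h : IsProj π l) (hn : Nzd J l) : IsCI as (J.map π) := by
  induction hJ with
  | nil => rw [Ideal.map_bot]; exact IsCI.nil
  | @cons e as J g hJ hg he hng ih =>
    rw [Ideal.map_sup, Ideal.map_span, Set.image_singleton]
    refine IsCI.cons _ (ih (nzd_of_nzd_sup hJ.isHomog hg he h.linear hng hn)) (h.hom _ _ hg) he ?_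
    intro u hu
    obtain ⟨u, rfl⟩ := h.surj u
    rw [← map_mul, h.apply_mem_map] at hu
    exact h.apply_mem_map.2 (nzd_sup_of_nzd_sup hng hn u hu)

end CI

section Dimensions

variable (K : Type*) [Field K]

lemma hilbTop_zero (n : ℕ) : hilbTop K n 0 = 1 := by
  have : component (⊤ : Ideal (MvPolynomial (Fin n) K)) 0 = K ∙ 1 := by
    rw [component_top, homogeneousSubmodule_zero]
    ext; simp [Submodule.mem_one, Submodule.mem_span_singleton, Algebra.smul_def]
  rw [hilbTop, hilb, this, finrank_span_singleton one_ne_zero]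

lemma hilbTop_succ_succ (n d : ℕ) :
    hilbTop K (n + 1) (d + 1) = hilbTop K (n + 1) d + hilbTop K n (d + 1) := by
  have h := isProj_projHom (n := n) (K := K) 0 0
  have := h.hilb_succ isHomog_top d
  rwa [Ideal.map_top, show quo ⊤ _ = ⊤ from by ext; simp [mem_quo]] at this

lemma hilbTop_fin_zero (d : ℕ) : hilbTop K 0 (d + 1) = 0 := by
  have : component (⊤ : Ideal (MvPolynomial (Fin 0) K)) (d + 1) = ⊥ := by
    rw [eq_bot_iff]
    intro f hf
    rw [Submodule.mem_bot]
    by_contra h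
    have := (mem_component.1 hf).2.inj_right (isHomogeneous_of_isEmpty _ _ f) h
    omega
  rw [hilbTop, hilb, this, finrank_bot]

lemma hilbTop_one (d : ℕ) : hilbTop K 1 d = 1 := by
  induction d with
  | zero => exact hilbTop_zero K 1
  | succ d ih => rw [hilbTop_succ_succ, ih, hilbTop_fin_zero]

lemma hilbTop_two (d : ℕ) : hilbTop K 2 d = d + 1 := by
  induction d with
  | zero => exact hilbTop_zero K 2
  | succ d ih => rw [hilbTop_succ_succ, ih, hilbTop_one]

lemma hilbTop_three (d : ℕ) : hilbTop K 3 (d + 1) = hilbTop K 3 d + d + 2 := by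
  rw [hilbTop_succ_succ, hilbTop_two]; ring

end Dimensions

/-! ### General linear forms and socles -/

section Socle

variable {K : Type*} [Field K] {n : ℕ}

lemma exists_nzd [Infinite K] (J : Ideal (MvPolynomial (Fin n) K))
    (V : Submodule K (MvPolynomial (Fin n) K)) (h : ∀ u, u ∉ J → ∃ v ∈ V, u * v ∉ J) :
    ∃ v ∈ V, Nzd J v := by
  classical
  set R := MvPolynomial (Fin n) K
  have hfin : (associatedPrimes R (R ⧸ J)).Finite := associatedPrimes.finite _ _
  let F : Ideal R → Subspace K V := fun P => (P.restrictScalars K).comap V.subtype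
  have htop : ⊤ ∉ hfin.toFinset.image F := by
    intro hmem
    obtain ⟨P, hP, hPt⟩ := Finset.mem_image.1 hmem
    obtain ⟨hPp, x, hx⟩ := isAssociatedPrime_iff.1 (hfin.mem_toFinset.1 hP)
    obtain ⟨u, rfl⟩ := Ideal.Quotient.mk_surjective x
    have hmemP : ∀ r, r ∈ P ↔ u * r ∈ J := by
      intro r
      rw [hx, Submodule.mem_colon_singleton, Submodule.mem_bot, ← Ideal.Quotient.eq_zero_iff_mem,
        mul_comm u r, map_mul]
      rfl
    have hu : u ∉ J := by
      intro hu
      apply hPp.ne_top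
      rw [Ideal.eq_top_iff_one, hmemP, mul_one]
      exact hu
    obtain ⟨v, hv, hvu⟩ := h u hu
    apply hvu
    rw [← hmemP]
    have : (⟨v, hv⟩ : V) ∈ F P := by rw [hPt]; trivial
    exact this
  have hne := Subspace.biUnion_ne_univ_of_top_notMem htop
  obtain ⟨⟨v, hv⟩, hvn⟩ := (Set.ne_univ_iff_exists_notMem _).1 hne
  refine ⟨v, hv, fun u hu => ?_⟩
  by_contra huJ
  apply hvn
  have hz : v ∈ ⋃ p ∈ associatedPrimes R (R ⧸ J), (p : Set R) := by
    rw [biUnion_associatedPrimes_eq_zero_divisors]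
    refine ⟨Ideal.Quotient.mk J u, fun h0 => huJ (Ideal.Quotient.eq_zero_iff_mem.1 h0), ?_⟩
    change Ideal.Quotient.mk J (v * u) = 0
    rw [Ideal.Quotient.eq_zero_iff_mem, mul_comm]
    exact hu
  obtain ⟨P, hP, hvP⟩ := Set.mem_iUnion₂.1 hz
  exact Set.mem_iUnion₂.2 ⟨F P, Finset.mem_image_of_mem _ (hfin.mem_toFinset.2 hP), hvP⟩

lemma mul_mem_of_forall_mul_X_mem {J : Ideal (MvPolynomial (Fin n) K)}
    {u : MvPolynomial (Fin n) K} (h : ∀ i, u * X i ∈ J) {x : MvPolynomial (Fin n) K}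
    (hx : x.IsHomogeneous 1) : u * x ∈ J := by
  have h1 : x ∈ Submodule.span K (Set.range (X : Fin n → MvPolynomial (Fin n) K)) := by
    rw [← homogeneousSubmodule_one_eq_span_X]; exact hx
  clear hx
  induction h1 using Submodule.span_induction with
  | mem x hx => obtain ⟨i, rfl⟩ := hx; exact h i
  | zero => simp
  | add x y _ _ h1 h2 => rw [mul_add]; exact add_mem h1 h2
  | smul c x _ h1 => rw [mul_smul_comm, smul_eq_C_mul]; exact J.mul_mem_left _ h1

lemma isHomogeneous_mem_of_lift {π : MvPolynomial (Fin (n + 1)) K →ₐ[K] MvPolynomial (Fin n) K}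
    {l : MvPolynomial (Fin (n + 1)) K} (h : IsProj π l) {y : MvPolynomial (Fin n) K} {d : ℕ}
    (hy : y.IsHomogeneous d) : ∃ x, x.IsHomogeneous d ∧ π x = y := by
  obtain ⟨x, rfl⟩ := h.surj y
  exact ⟨homogeneousComponent d x, homogeneousComponent_isHomogeneous _ _, by
    rw [← h.homogeneousComponent, homogeneousComponent_eq_self hy]⟩

/-- `J` has no socle in degree `d`. -/
def NoSocle (J : Ideal (MvPolynomial (Fin n) K)) (d : ℕ) : Prop :=
  ∀ u : MvPolynomial (Fin n) K, u.IsHomogeneous d → (∀ i, u * X i ∈ J) → u ∈ J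

lemma exists_linear_nzd_of_noSocle [Infinite K] {J : Ideal (MvPolynomial (Fin n) K)}
    (hJ : IsHomog J) (h : ∀ d, NoSocle J d) :
    ∃ l : MvPolynomial (Fin n) K, l.IsHomogeneous 1 ∧ Nzd J l := by
  refine exists_nzd J (homogeneousSubmodule (Fin n) K 1) fun u hu => ?_
  by_contra! hc
  apply hu
  rw [hJ.mem_iff]
  intro d
  refine h d _ (homogeneousComponent_isHomogeneous _ _) fun i => ?_
  rw [← homogeneousComponent_mul_of_right (isHomogeneous_X K i)]
  exact hJ _ (hc _ (isHomogeneous_X K i)) _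

/-- The socle of a complete intersection. -/
lemma IsCI.socle [Infinite K] {as : List ℕ} (hlen : as.length ≤ n)
    {J : Ideal (MvPolynomial (Fin n) K)} (hJ : IsCI as J) {d : ℕ}
    {u : MvPolynomial (Fin n) K} (hu : u.IsHomogeneous d) (hX : ∀ i, u * X i ∈ J)
    (huJ : u ∉ J) : as.length = n ∧ d + n = as.sum := by
  induction n generalizing as d with
  | zero =>
    cases hJ with
    | nil =>
      refine ⟨rfl, ?_⟩
      have := hu.inj_right (isHomogeneous_of_isEmpty _ _ u) (by simpa using huJ)
      simp [this]
    | cons => simp at hlen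
  | succ n IH =>
    induction hJ generalizing d u with
    | nil =>
      exfalso
      have := hX 0
      simp only [Ideal.mem_bot, mul_eq_zero, X_ne_zero, or_false] at this
      exact huJ (by simpa using this)
    | @cons e as J g hJ hg he hng ih =>
      rw [List.length_cons] at hlen
      obtain ⟨l, hl, hnl⟩ := exists_linear_nzd_of_noSocle hJ.isHomog fun d v hv hvX => by
        by_contra hvJ
        have := (ih (by omega) hv hvX hvJ).1
        omega
      have h1 := mul_mem_of_forall_mul_X_mem hX hl
      have h1 : u * l ∈ component (J ⊔ Ideal.span {g}) (d + 1) :=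
        mem_component.2 ⟨h1, hu.mul hl⟩
      by_cases hd : d + 1 < e
      · rw [component_sup_span_of_lt hJ.isHomog hg hd] at h1
        exact absurd ((le_sup_left : J ≤ J ⊔ Ideal.span {g}) (hnl _ (mem_component.1 h1).1)) huJ
      obtain ⟨d', hd'⟩ := Nat.exists_eq_add_of_le' (not_lt.1 hd)
      rw [hd'] at h1
      obtain ⟨v, hv, hvu⟩ := exists_of_mem_sup_span hJ.isHomog hg h1
      have hvu := (mem_component.1 hvu).1
      obtain ⟨π, hπ⟩ := exists_isProj hl (hnl.ne_zero hJ.one_notMem)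
      have hv1 : π v ∉ J.map π := by
        rw [hπ.apply_mem_map]
        intro hvm
        obtain ⟨j, hj, w, hw, hjw⟩ := Submodule.mem_sup.1 hvm
        obtain ⟨w, rfl⟩ := Ideal.mem_span_singleton'.1 hw
        apply huJ
        have h2 : u - w * g ∈ J := by
          apply hnl
          have : (u - w * g) * l = (u * l - v * g) + g * j := by
            linear_combination (-g) * hjw
          rw [this]
          exact add_mem hvu (J.mul_mem_left _ hj)
        have : u = (u - w * g) + w * g := by ring
        rw [this]
        exact Submodule.add_mem_sup h2 (Ideal.mem_span_singleton'.2 ⟨w, rfl⟩)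
      have hv2 : ∀ i, π v * X i ∈ J.map π := by
        intro i
        obtain ⟨x, hx, hxi⟩ := isHomogeneous_mem_of_lift hπ (isHomogeneous_X K i)
        rw [← hxi, ← map_mul, hπ.apply_mem_map]
        obtain ⟨j, hj, w, hw, hjw⟩ := Submodule.mem_sup.1 (mul_mem_of_forall_mul_X_mem hX hx)
        obtain ⟨w, rfl⟩ := Ideal.mem_span_singleton'.1 hw
        have h2 : v * x - w * l ∈ J := by
          apply hng
          have : (v * x - w * l) * g = l * j - x * (u * l - v * g) := by
            linear_combination (-l) * hjw
          rw [this]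
          exact sub_mem (J.mul_mem_left _ hj) (J.mul_mem_left _ hvu)
        have : v * x = (v * x - w * l) + w * l := by ring
        rw [this]
        exact Submodule.add_mem_sup h2 (Ideal.mem_span_singleton'.2 ⟨w, rfl⟩)
      obtain ⟨h3, h4⟩ := IH (by omega) (hJ.map hπ hnl) (hπ.hom _ _ hv) hv2 hv1
      simp only [List.length_cons, List.sum_cons]
      omega

lemma IsCI.noSocle [Infinite K] {as : List ℕ} (hlen : as.length < n)
    {J : Ideal (MvPolynomial (Fin n) K)} (hJ : IsCI as J) (d : ℕ) : NoSocle J d := by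
  intro u hu hX
  by_contra h
  have := (hJ.socle hlen.le hu hX h).1
  omega

lemma IsCI.noSocle_of_ne [Infinite K] {as : List ℕ} (hlen : as.length ≤ n)
    {J : Ideal (MvPolynomial (Fin n) K)} (hJ : IsCI as J) {d : ℕ} (hd : d + n ≠ as.sum) :
    NoSocle J d := by
  intro u hu hX
  by_contra h
  exact hd (hJ.socle hlen hu hX h).2

lemma IsCI.exists_linear_nzd [Infinite K] {as : List ℕ} (hlen : as.length < n)
    {J : Ideal (MvPolynomial (Fin n) K)} (hJ : IsCI as J) :
    ∃ l : MvPolynomial (Fin n) K, l.IsHomogeneous 1 ∧ Nzd J l :=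
  exists_linear_nzd_of_noSocle hJ.isHomog (hJ.noSocle hlen)

lemma hilb_lt_of_mem {I J : Ideal (MvPolynomial (Fin n) K)} (hJI : J ≤ I) {d : ℕ}
    {u : MvPolynomial (Fin n) K} (hu : u.IsHomogeneous d) (hI : u ∈ I) (hJ : u ∉ J) :
    hilb J d < hilb I d := by
  apply Submodule.finrank_lt_finrank_of_lt
  refine lt_of_le_of_ne (component_mono hJI d) fun h => hJ ?_
  have : u ∈ component J d := by rw [h]; exact mem_component.2 ⟨hI, hu⟩
  exact (mem_component.1 this).1

lemma exists_of_hilb_lt {I J : Ideal (MvPolynomial (Fin n) K)} {d : ℕ}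
    (h : hilb J d < hilb I d) : ∃ u, u.IsHomogeneous d ∧ u ∈ I ∧ u ∉ J := by
  by_contra! hc
  exact absurd (hilb_le_of_component_le (I := I) (J := J) (d := d) fun f hf =>
    mem_component.2 ⟨hc f (mem_component.1 hf).2 (mem_component.1 hf).1, (mem_component.1 hf).2⟩)
    (not_le.2 h)

/-- An ideal strictly containing `J` grows faster than `J` as long as the linear section of `J`
has no socle. -/
lemma hilb_growth {π : MvPolynomial (Fin (n + 1)) K →ₐ[K] MvPolynomial (Fin n) K}
    {l : MvPolynomial (Fin (n + 1)) K} (hπ : IsProj π l)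
    {J : Ideal (MvPolynomial (Fin (n + 1)) K)} (hJ : IsHomog J) (hn : Nzd J l) {d : ℕ}
    (hs : ∀ e ≤ d, NoSocle (J.map π) e) {I : Ideal (MvPolynomial (Fin (n + 1)) K)}
    (hI : IsHomog I) (hJI : J ≤ I) (h : hilb J d < hilb I d) :
    hilb J (d + 1) + hilb I d + 1 ≤ hilb I (d + 1) + hilb J d := by
  induction d generalizing I with
  | zero =>
    have h1 := hπ.hilb_succ hI 0
    have h2 := hπ.hilb_succ hJ 0
    rw [hn.quo_eq] at h2
    have h3 := hilb_mono (le_quo I l) 0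
    rw [hπ.hilb_zero hI, hπ.hilb_zero hJ] at h
    obtain ⟨u, hu, huI, huJ⟩ := exists_of_hilb_lt h
    have := mt (hs 0 le_rfl u hu) huJ
    push Not at this
    obtain ⟨i, hi⟩ := this
    have h4 := hilb_lt_of_mem (Ideal.map_mono hJI) (hu.mul (isHomogeneous_X K i))
      (Ideal.mul_mem_right _ _ huI) hi
    omega
  | succ d ih =>
    have h1 := hπ.hilb_succ hI (d + 1)
    have h2 := hπ.hilb_succ hJ (d + 1)
    rw [hn.quo_eq] at h2
    have h3 := hilb_mono (le_quo I l) (d + 1)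
    by_cases hd : hilb (J.map π) (d + 1) < hilb (I.map π) (d + 1)
    · obtain ⟨u, hu, huI, huJ⟩ := exists_of_hilb_lt hd
      have := mt (hs (d + 1) le_rfl u hu) huJ
      push Not at this
      obtain ⟨i, hi⟩ := this
      have h4 := hilb_lt_of_mem (Ideal.map_mono hJI) (hu.mul (isHomogeneous_X K i))
        (Ideal.mul_mem_right _ _ huI) hi
      omega
    · have h5 := hπ.hilb_succ hI d
      have h6 := hπ.hilb_succ hJ d
      rw [hn.quo_eq] at h6
      have h7 := hilb_mono (Ideal.map_mono (f := π) hJI) (d + 1)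
      have h8 := hilb_mono (Ideal.map_mono (f := π) hJI) (d + 1 + 1)
      have := ih (I := quo I l) (fun e he => hs e (by omega)) (hI.quo hπ.linear)
        (hJI.trans (le_quo I l)) (by omega)
      omega

end Socle

/-! ### Linkage -/

section Linkage

variable {K : Type*} [Field K] {n : ℕ}

/-- The ideal quotient of `J` by `I`. -/
def link {R : Type*} [CommRing R] (J I : Ideal R) : Ideal R := ⨅ f : I, quo J f

lemma mem_link {R : Type*} [CommRing R] {J I : Ideal R} {u : R} :
    u ∈ link J I ↔ ∀ f ∈ I, u * f ∈ J := by
  simp [link, mem_quo]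

lemma le_link {R : Type*} [CommRing R] (J I : Ideal R) : J ≤ link J I := fun _ hu =>
  mem_link.2 fun _ _ => J.mul_mem_right _ hu

lemma isHomog_link {J I : Ideal (MvPolynomial (Fin n) K)} (hJ : IsHomog J) (hI : IsHomog I) :
    IsHomog (link J I) := by
  intro u hu d
  rw [mem_link] at hu ⊢
  intro f hf
  rw [← sum_homogeneousComponent f, Finset.mul_sum]
  refine sum_mem fun i _ => ?_
  rw [← homogeneousComponent_mul_of_right (homogeneousComponent_isHomogeneous i f)]
  exact hJ _ (hu _ (hI f hf i)) _

/-- Artinian Gorenstein duality for complete intersections. -/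
lemma IsCI.hilb_link [Infinite K] {as : List ℕ} {J : Ideal (MvPolynomial (Fin n) K)}
    (hJ : IsCI as J) (hlen : as.length = n) {s : ℕ} (hs : s + n = as.sum)
    (hs1 : hilb J s + 1 = hilbTop K n s) (htop : ∀ t, s < t → hilb J t = hilbTop K n t)
    {I : Ideal (MvPolynomial (Fin n) K)} (hI : IsHomog I) (hJI : J ≤ I) {e e' : ℕ}
    (he : e + e' = s) :
    hilb (link J I) e' + hilb I e = hilb J e' + hilbTop K n e := by
  classical
  set R := MvPolynomial (Fin n) K
  have hext : ∀ (k t : ℕ) (u : R), t + k = s → u.IsHomogeneous t → u ∉ J →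
      ∃ y : R, y.IsHomogeneous k ∧ u * y ∉ J := by
    intro k
    induction k with
    | zero => intro t u _ _ hu; exact ⟨1, isHomogeneous_one _ _, by simpa using hu⟩
    | succ k ih =>
      intro t u ht hu huJ
      have := mt (hJ.noSocle_of_ne hlen.le (d := t) (by omega) u hu) huJ
      push Not at this
      obtain ⟨i, hi⟩ := this
      obtain ⟨y, hy, hyJ⟩ := ih (t + 1) _ (by omega) (hu.mul (isHomogeneous_X K i)) hi
      refine ⟨X i * y, ?_, by rwa [← mul_assoc]⟩
      rw [add_comm]
      exact (isHomogeneous_X K i).mul hy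
  obtain ⟨w, hw, -, hwJ⟩ := exists_of_hilb_lt (I := ⊤) (J := J) (d := s) (by
    have : hilb (⊤ : Ideal R) s = hilbTop K n s := rfl
    omega)
  have hwJ' : w ∉ component J s := fun h => hwJ (mem_component.1 h).1
  obtain ⟨τ, hτw, hτJ⟩ := Submodule.exists_le_ker_of_notMem hwJ'
  have hτ : ∀ x : R, x.IsHomogeneous s → τ x = 0 → x ∈ J := by
    have h1 : component J s ≤ homogeneousSubmodule (Fin n) K s ⊓ LinearMap.ker τ :=
      le_inf inf_le_right hτJ
    have : FiniteDimensional K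
        (homogeneousSubmodule (Fin n) K s ⊓ LinearMap.ker τ : Submodule K R) :=
      Submodule.finiteDimensional_of_le inf_le_left
    have h2 : homogeneousSubmodule (Fin n) K s ⊓ LinearMap.ker τ
        < homogeneousSubmodule (Fin n) K s :=
      lt_of_le_of_ne inf_le_left fun h => hτw (by
        have : w ∈ homogeneousSubmodule (Fin n) K s ⊓ LinearMap.ker τ := by rw [h]; exact hw
        exact this.2)
    have h3 := Submodule.finrank_lt_finrank_of_lt h2
    have h4 : hilbTop K n s = Module.finrank K (homogeneousSubmodule (Fin n) K s) := by
      rw [hilbTop, hilb, component_top]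
    have h5 := Submodule.eq_of_le_of_finrank_le h1 (by
      change _ ≤ hilb J s
      omega)
    intro x hx h0
    have : x ∈ component J s := by rw [h5]; exact ⟨hx, h0⟩
    exact (mem_component.1 this).1
  let β : R →ₗ[K] Module.Dual K (homogeneousSubmodule (Fin n) K e') :=
    { toFun := fun x => (τ.comp (LinearMap.mulLeft K x)).comp (Submodule.subtype _)
      map_add' := fun x y => by ext z; simp [add_mul]
      map_smul' := fun c x => by ext z; simp }
  have hβ : ∀ x y, β x y = τ (x * y) := fun x y => rfl
  have key : ∀ {I : Ideal R}, IsHomog I → J ≤ I →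
      hilb (link J I) e' + hilb I e = hilb J e + hilbTop K n e' := by
    intro I hI hJI
    have h1 := finrank_eq_finrank_map_add β (component I e)
    have h2 : component I e ⊓ LinearMap.ker β = component J e := by
      ext x
      rw [Submodule.mem_inf, mem_component, mem_component, LinearMap.mem_ker]
      constructor
      · rintro ⟨⟨-, hx⟩, hβx⟩
        refine ⟨?_, hx⟩
        by_contra hxJ
        obtain ⟨y, hy, hyJ⟩ := hext e' e x he hx hxJ
        apply hyJ
        refine hτ _ (he ▸ hx.mul hy) ?_
        have := LinearMap.congr_fun hβx ⟨y, hy⟩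
        rwa [hβ] at this
      · rintro ⟨hxJ, hx⟩
        refine ⟨⟨hJI hxJ, hx⟩, ?_⟩
        ext ⟨y, hy⟩
        exact hτJ (mem_component.2 ⟨J.mul_mem_right _ hxJ, he ▸ hx.mul hy⟩)
    have h3 := Subspace.finrank_add_finrank_dualCoannihilator_eq ((component I e).map β)
    have h4 : (((component I e).map β).dualCoannihilator).map (Submodule.subtype _)
        = component (link J I) e' := by
      ext y
      rw [Submodule.mem_map, mem_component, mem_link]
      constructor
      · rintro ⟨⟨y, hy⟩, hyI, rfl⟩
        refine ⟨fun f hf => ?_, hy⟩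
        rw [Submodule.mem_dualCoannihilator] at hyI
        change y * f ∈ J
        rw [← sum_homogeneousComponent f, Finset.mul_sum]
        refine sum_mem fun k _ => ?_
        have hfk := hI f hf k
        have hhk := homogeneousComponent_isHomogeneous k f
        generalize homogeneousComponent k f = fk at hfk hhk
        by_contra hJf
        have hdeg := (show y.IsHomogeneous e' from hy).mul hhk
        by_cases hk : e' + k ≤ s
        · obtain ⟨z, hz, hzJ⟩ := hext (s - (e' + k)) (e' + k) _ (by omega) hdeg hJf
          apply hzJ
          refine hτ _ ?_ ?_
          · have := hdeg.mul hz
            rwa [show e' + k + (s - (e' + k)) = s by omega] at this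
          · have := hyI (β (fk * z)) (Submodule.mem_map_of_mem (mem_component.2
              ⟨I.mul_mem_right _ hfk, by
                have := hhk.mul hz
                rwa [show k + (s - (e' + k)) = e by omega] at this⟩))
            rw [hβ] at this
            rw [← this]
            congr 1
            ring
        · have := hilb_lt_of_mem (I := ⊤) le_top hdeg trivial hJf
          have h5 := htop (e' + k) (by omega)
          have h6 : hilb (⊤ : Ideal R) (e' + k) = hilbTop K n (e' + k) := rfl
          omega
      · rintro ⟨h, hy⟩
        refine ⟨⟨y, hy⟩, ?_, rfl⟩
        rw [Submodule.mem_dualCoannihilator]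
        rintro _ ⟨x, hx, rfl⟩
        obtain ⟨hxI, hx⟩ := mem_component.1 hx
        rw [hβ]
        refine hτJ (mem_component.2 ⟨?_, he ▸ hx.mul hy⟩)
        have := h x hxI
        rwa [mul_comm] at this
    have h5 : Module.finrank K ((component I e).map β).dualCoannihilator
        = hilb (link J I) e' := by
      rw [hilb, ← h4]
      exact (Submodule.equivMapOfInjective _ (Submodule.injective_subtype _) _).finrank_eq
    have h6 : hilbTop K n e' = Module.finrank K (homogeneousSubmodule (Fin n) K e') := by
      rw [hilbTop, hilb, component_top]
    rw [h2] at h1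
    change hilb I e = _ + hilb J e at h1
    omega
  have h1 := key hI hJI
  have h2 := key isHomog_top le_top
  have h3 : link J ⊤ = J := le_antisymm
    (fun _ hu => by simpa using mem_link.1 hu 1 trivial) (le_link J ⊤)
  rw [h3] at h2
  have h4 : hilb (⊤ : Ideal R) e = hilbTop K n e := rfl
  omega

end Linkage

section LexSets

variable {n : ℕ} {c : ℕ → ℕ∞}

/-- Exponents whose `i`-th entry stays below the cap `c i`. -/
def Capped (c : ℕ → ℕ∞) (m : Fin n →₀ ℕ) : Prop := ∀ i : Fin n, (m i : ℕ∞) < c i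

lemma Capped.mono {m m' : Fin n →₀ ℕ} (h : Capped c m) (hm : m' ≤ m) : Capped c m' :=
  fun i => lt_of_le_of_lt (by exact_mod_cast hm i) (h i)

lemma Capped.sup {m m' : Fin n →₀ ℕ} (h : Capped c m) (h' : Capped c m') :
    Capped c (m ⊔ m') := by
  intro i
  rcases le_total (m i) (m' i) with hi | hi
  · simpa [hi] using h' i
  · simpa [hi] using h i

open Classical in
/-- Capped exponents of a given degree. -/
noncomputable def box (n : ℕ) (c : ℕ → ℕ∞) (d : ℕ) : Finset (Fin n →₀ ℕ) :=
  (Finset.univ.finsuppAntidiag d).filter (Capped c)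

lemma mem_box {d : ℕ} {m : Fin n →₀ ℕ} : m ∈ box n c d ↔ m.degree = d ∧ Capped c m := by
  simp [box, Finset.mem_finsuppAntidiag, Finsupp.degree_eq_sum]

/-- Subsets of `B` that are upward closed in `B` for the lexicographic order. -/
def IsUp (B U : Finset (Fin n →₀ ℕ)) : Prop :=
  U ⊆ B ∧ ∀ m ∈ U, ∀ m' ∈ B, toLex m ≤ toLex m' → m' ∈ U

lemma exists_isUp_card (B : Finset (Fin n →₀ ℕ)) {k : ℕ} (hk : k ≤ B.card) :
    ∃ U, IsUp B U ∧ U.card = k := by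
  classical
  induction k with
  | zero => exact ⟨∅, ⟨by simp, by simp⟩, rfl⟩
  | succ k ih =>
    obtain ⟨U, hU, rfl⟩ := ih (by omega)
    have hne : (B \ U).Nonempty := by
      rw [← Finset.card_pos, Finset.card_sdiff_of_subset hU.1]; omega
    obtain ⟨m, hm, hmax⟩ := Finset.exists_max_image (B \ U) toLex hne
    rw [Finset.mem_sdiff] at hm
    refine ⟨insert m U, ⟨Finset.insert_subset hm.1 hU.1, ?_⟩, Finset.card_insert_of_notMem hm.2⟩
    intro u hu m' hm' hle
    by_cases h : m' ∈ U
    · exact Finset.mem_insert_of_mem h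
    rcases Finset.mem_insert.1 hu with rfl | hu
    · have := le_antisymm hle (hmax m' (Finset.mem_sdiff.2 ⟨hm', h⟩))
      exact Finset.mem_insert.2 (Or.inl (toLex.injective this.symm))
    · exact absurd (hU.2 u hu m' hm' hle) h

lemma IsUp.total {B U V : Finset (Fin n →₀ ℕ)} (hU : IsUp B U) (hV : IsUp B V) :
    U ⊆ V ∨ V ⊆ U := by
  by_contra! h
  obtain ⟨u, hu, huV⟩ := Finset.not_subset.1 h.1
  obtain ⟨v, hv, hvU⟩ := Finset.not_subset.1 h.2
  rcases le_total (toLex u) (toLex v) with hl | hl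
  · exact hvU (hU.2 u hu v (hV.1 hv) hl)
  · exact huV (hV.2 v hv u (hU.1 hu) hl)

lemma IsUp.subset_of_card_le {B U V : Finset (Fin n →₀ ℕ)} (hU : IsUp B U) (hV : IsUp B V)
    (h : U.card ≤ V.card) : U ⊆ V := by
  rcases hU.total hV with h' | h'
  · exact h'
  · rw [Finset.eq_of_subset_of_card_le h' h]

open Classical in
/-- The shadow of a set of capped exponents of degree `d`. -/
noncomputable def sh (c : ℕ → ℕ∞) (d : ℕ) (U : Finset (Fin n →₀ ℕ)) : Finset (Fin n →₀ ℕ) :=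
  (box n c (d + 1)).filter fun m => ∃ u ∈ U, ∃ i, m = u + Finsupp.single i 1

lemma mem_sh {d : ℕ} {U : Finset (Fin n →₀ ℕ)} {m : Fin n →₀ ℕ} :
    m ∈ sh c d U ↔ m ∈ box n c (d + 1) ∧ ∃ u ∈ U, ∃ i, m = u + Finsupp.single i 1 := by
  simp [sh]

lemma sh_subset (d : ℕ) (U : Finset (Fin n →₀ ℕ)) : sh c d U ⊆ box n c (d + 1) :=
  fun _ h => (mem_sh.1 h).1

lemma sh_mono {d : ℕ} {U V : Finset (Fin n →₀ ℕ)} (h : U ⊆ V) : sh c d U ⊆ sh c d V := by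
  intro m hm
  obtain ⟨hb, u, hu, i, rfl⟩ := mem_sh.1 hm
  exact mem_sh.2 ⟨hb, u, h hu, i, rfl⟩

lemma exists_add_single_of_last {m : Fin n →₀ ℕ} {j : Fin n} (hj : 0 < m j) :
    ∃ u, m = u + Finsupp.single j 1 := by
  refine ⟨m - Finsupp.single j 1, (tsub_add_cancel_of_le ?_).symm⟩
  intro i
  by_cases h : j = i
  · subst h; rw [Finsupp.single_eq_same]; exact hj
  · simp [Finsupp.single_eq_of_ne' h]

lemma lex_le_of_add_single_le {u u' : Fin n →₀ ℕ} {i j : Fin n} (hd : u.degree = u'.degree)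
    (hle : toLex (u + Finsupp.single i 1) ≤ toLex (u' + Finsupp.single j 1))
    (hj : ∀ k, j < k → u' k = 0) : toLex u ≤ toLex u' := by
  by_contra! hlt
  obtain ⟨s, hs, hs'⟩ := Finsupp.Lex.lt_iff.1 hlt
  simp only [ofLex_toLex] at hs hs'
  have hsing : ∀ a b : Fin n, (Finsupp.single a 1 : Fin n →₀ ℕ) b = if a = b then 1 else 0 :=
    fun a b => Finsupp.single_apply
  rcases hle.eq_or_lt with heq | hlt'
  · have hm : ∀ k, u k + (if i = k then 1 else 0) = u' k + (if j = k then 1 else 0) := by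
      intro k
      have := DFunLike.congr_fun (toLex.injective heq) k
      simpa [hsing] using this
    have h1 := hm s
    have hjs : j = s := by by_contra h; rw [if_neg h] at h1; omega
    have h2 := hm i
    rw [if_pos rfl] at h2
    subst hjs
    rcases lt_trichotomy i j with h | h | h
    · rw [hs i h, if_neg h.ne'] at h2; omega
    · subst h; simp at h1; omega
    · rw [hj i h, if_neg h.ne] at h2; omega
  · obtain ⟨t, ht, ht'⟩ := Finsupp.Lex.lt_iff.1 hlt'
    simp only [ofLex_toLex, Finsupp.add_apply, hsing] at ht ht'
    rcases lt_trichotomy t j with htj | htj | htj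
    · rw [if_neg htj.ne'] at ht'
      have : ∀ r < t, u r ≤ u' r := by
        intro r hr
        have := ht r hr
        rw [if_neg (hr.trans htj).ne'] at this; omega
      rcases lt_trichotomy s t with h | h | h
      · have := this s h; omega
      · subst h; omega
      · have := hs t h; omega
    · subst htj
      have h1 : ∀ r ≤ t, u r ≤ u' r := by
        intro r hr
        rcases hr.eq_or_lt with rfl | hr
        · simp at ht'; omega
        · have := ht r hr
          rw [if_neg hr.ne'] at this; omega
      have hts : t < s := by
        by_contra! h
        have := h1 s h; omega
      have : u'.degree < u.degree := by
        rw [Finsupp.degree_eq_sum, Finsupp.degree_eq_sum]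
        refine Finset.sum_lt_sum (fun r _ => ?_) ⟨s, Finset.mem_univ s, hs'⟩
        rcases lt_or_ge r s with h | h
        · exact (hs r h).le
        · rw [hj r (hts.trans_le h)]; exact Nat.zero_le _
      omega
    · rw [hj t htj, if_neg htj.ne] at ht'
      omega

lemma IsUp.mem_of_add_single_mem_sh {d : ℕ} {U : Finset (Fin n →₀ ℕ)} (hU : IsUp (box n c d) U)
    {m u' : Fin n →₀ ℕ} {j : Fin n} (hm : m ∈ sh c d U)
    (hm' : u' + Finsupp.single j 1 ∈ box n c (d + 1))
    (hle : toLex m ≤ toLex (u' + Finsupp.single j 1)) (hj : ∀ k, j < k → u' k = 0) :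
    u' ∈ U := by
  obtain ⟨-, u, hu, i, rfl⟩ := mem_sh.1 hm
  have hb := mem_box.1 hm'
  have hud := (mem_box.1 (hU.1 hu)).1
  have hd : u'.degree = d := by
    have := hb.1
    rw [map_add, Finsupp.degree_single] at this; omega
  exact hU.2 u hu u' (mem_box.2 ⟨hd, hb.2.mono le_self_add⟩)
    (lex_le_of_add_single_le (hud.trans hd.symm) hle hj)

lemma exists_last {m : Fin n →₀ ℕ} (hm : m ≠ 0) : ∃ j, 0 < m j ∧ ∀ k, j < k → m k = 0 := by
  have hne := Finsupp.support_nonempty_iff.2 hm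
  refine ⟨m.support.max' hne, ?_, ?_⟩
  · have := m.support.max'_mem hne
    rw [Finsupp.mem_support_iff] at this; omega
  · intro k hk
    by_contra h
    exact absurd (m.support.le_max' k (Finsupp.mem_support_iff.2 h)) (not_le.2 hk)

lemma IsUp.isUp_sh {d : ℕ} {U : Finset (Fin n →₀ ℕ)} (hU : IsUp (box n c d) U) :
    IsUp (box n c (d + 1)) (sh c d U) := by
  refine ⟨sh_subset d U, ?_⟩
  intro m hm m' hm' hle
  obtain ⟨j, hj, hjk⟩ := exists_last (m := m') (by rintro rfl; simpa using (mem_box.1 hm').1)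
  obtain ⟨u, rfl⟩ := exists_add_single_of_last hj
  have h := hU.mem_of_add_single_mem_sh hm hm' hle (fun k hk => by
    have := hjk k hk
    rw [Finsupp.add_apply] at this; omega)
  exact mem_sh.2 ⟨hm', u, h, j, rfl⟩

/-- Append an entry at the end. -/
noncomputable def snc (m : Fin n →₀ ℕ) (j : ℕ) : Fin (n + 1) →₀ ℕ :=
  Finsupp.equivFunOnFinite.symm (Fin.snoc (α := fun _ => ℕ) m j)

/-- Remove the last entry. -/
noncomputable def ini (m : Fin (n + 1) →₀ ℕ) : Fin n →₀ ℕ :=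
  Finsupp.equivFunOnFinite.symm (fun i => m i.castSucc)

@[simp] lemma snc_castSucc (m : Fin n →₀ ℕ) (j : ℕ) (i : Fin n) : snc m j i.castSucc = m i := by
  simp [snc]

@[simp] lemma snc_last (m : Fin n →₀ ℕ) (j : ℕ) : snc m j (Fin.last n) = j := by
  simp [snc]

@[simp] lemma ini_apply (m : Fin (n + 1) →₀ ℕ) (i : Fin n) : ini m i = m i.castSucc := rfl

@[simp] lemma ini_snc (m : Fin n →₀ ℕ) (j : ℕ) : ini (snc m j) = m := by
  ext i; simp

@[simp] lemma snc_ini (m : Fin (n + 1) →₀ ℕ) : snc (ini m) (m (Fin.last n)) = m := by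
  ext i
  induction i using Fin.lastCases with
  | last => simp
  | cast i => simp

@[simp] lemma degree_snc (m : Fin n →₀ ℕ) (j : ℕ) : (snc m j).degree = m.degree + j := by
  simp [Finsupp.degree_eq_sum, Fin.sum_univ_castSucc]

lemma degree_ini (m : Fin (n + 1) →₀ ℕ) : (ini m).degree + m (Fin.last n) = m.degree := by
  rw [← degree_snc, snc_ini]

lemma capped_snc {m : Fin n →₀ ℕ} {j : ℕ} : Capped c (snc m j) ↔ Capped c m ∧ (j : ℕ∞) < c n := by
  constructor
  · intro h
    exact ⟨fun i => by simpa using h i.castSucc, by simpa using h (Fin.last n)⟩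
  · rintro ⟨h, hj⟩ i
    induction i using Fin.lastCases with
    | last => simpa using hj
    | cast i => simpa using h i

lemma snc_lex_lt {w m : Fin n →₀ ℕ} (j k : ℕ) (h : toLex w < toLex m) :
    toLex (snc w j) < toLex (snc m k) := by
  obtain ⟨t, ht, ht'⟩ := Finsupp.Lex.lt_iff.1 h
  refine Finsupp.Lex.lt_iff.2 ⟨t.castSucc, fun r hr => ?_, by simpa using ht'⟩
  obtain ⟨r, rfl⟩ := Fin.exists_castSucc_eq.2 (ne_of_lt (hr.trans (Fin.castSucc_lt_last t)))
  simpa using ht r (by simpa using hr)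

/-- The slice of exponents with last entry zero. -/
noncomputable def bottom (c : ℕ → ℕ∞) (d : ℕ) (U : Finset (Fin (n + 1) →₀ ℕ)) :
    Finset (Fin n →₀ ℕ) := by
  classical exact (box n c d).filter fun m => snc m 0 ∈ U

lemma mem_bottom {d : ℕ} {U : Finset (Fin (n + 1) →₀ ℕ)} {m : Fin n →₀ ℕ} :
    m ∈ bottom c d U ↔ m ∈ box n c d ∧ snc m 0 ∈ U := by
  simp [bottom]

lemma IsUp.isUp_bottom {d : ℕ} {U : Finset (Fin (n + 1) →₀ ℕ)} (hU : IsUp (box (n + 1) c d) U) :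
    IsUp (box n c d) (bottom c d U) := by
  refine ⟨fun m hm => (mem_bottom.1 hm).1, fun m hm m' hm' hle => ?_⟩
  rcases hle.eq_or_lt with h | h
  · rwa [← toLex.injective h]
  have hm := mem_bottom.1 hm
  have h0 := (capped_snc.1 (mem_box.1 (hU.1 hm.2)).2).2
  refine mem_bottom.2 ⟨hm', hU.2 _ hm.2 _ (mem_box.2 ⟨?_, ?_⟩) (snc_lex_lt 0 0 h).le⟩
  · simpa using (mem_box.1 hm').1
  · exact capped_snc.2 ⟨(mem_box.1 hm').2, h0⟩

lemma IsUp.card_sh_le_filter {d : ℕ} {U : Finset (Fin (n + 1) →₀ ℕ)}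
    (hU : IsUp (box (n + 1) c d) U) :
    (sh c d U).card ≤
      U.card + ((sh c d U).filter fun m => m (Fin.last n) = 0).card := by
  classical
  rw [← Finset.card_filter_add_card_filter_not (s := sh c d U)
    (fun m => m (Fin.last n) = 0), add_comm]
  refine Nat.add_le_add_right ?_ _
  rw [← Finset.card_image_of_injective U (add_left_injective (Finsupp.single (Fin.last n) 1))]
  refine Finset.card_le_card fun m hm => ?_
  obtain ⟨hm, h0⟩ := Finset.mem_filter.1 hm
  obtain ⟨u, rfl⟩ := exists_add_single_of_last (Nat.pos_of_ne_zero h0)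
  exact Finset.mem_image_of_mem _ (hU.mem_of_add_single_mem_sh hm (sh_subset _ _ hm) le_rfl
    fun k hk => absurd hk (not_lt.2 (Fin.le_last k)))

lemma IsUp.card_sh_le {d : ℕ} {U : Finset (Fin (n + 1) →₀ ℕ)}
    (hU : IsUp (box (n + 1) c d) U) :
    (sh c d U).card ≤ U.card + (sh c d (bottom c d U)).card := by
  classical
  refine hU.card_sh_le_filter.trans (Nat.add_le_add_left ?_ _)
  rw [← Finset.card_image_of_injective (sh c d (bottom c d U))
    (f := fun m => snc m 0) (fun m m' h => by simpa using congrArg ini h)]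
  refine Finset.card_le_card fun m hm => ?_
  obtain ⟨hm, h0⟩ := Finset.mem_filter.1 hm
  obtain ⟨hb, u, hu, i, rfl⟩ := mem_sh.1 hm
  have hu0 : u (Fin.last n) = 0 := by
    rw [Finsupp.add_apply] at h0; omega
  have hi : i ≠ Fin.last n := by
    rintro rfl
    simp at h0
  obtain ⟨i, rfl⟩ := Fin.exists_castSucc_eq.2 hi
  have hus : snc (ini u) 0 = u := by rw [← hu0, snc_ini]
  have key : u + Finsupp.single i.castSucc 1 = snc (ini u + Finsupp.single i 1) 0 := by
    ext k
    induction k using Fin.lastCases with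
    | last => simp [hu0]
    | cast k => simp [Finsupp.single_apply]
  rw [key] at hb ⊢
  refine Finset.mem_image_of_mem _ (mem_sh.2 ⟨?_, ini u, mem_bottom.2 ⟨?_, by rwa [hus]⟩, i, rfl⟩)
  · have := mem_box.1 hb
    exact mem_box.2 ⟨by simpa using this.1, (capped_snc.1 this.2).1⟩
  · have := mem_box.1 (hU.1 hu)
    rw [← hus] at this
    exact mem_box.2 ⟨by simpa using this.1, (capped_snc.1 this.2).1⟩

lemma exists_between_degree_eq {w z : Fin n →₀ ℕ} {d : ℕ} (hwz : w ≤ z) (hw : w.degree ≤ d)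
    (hz : d ≤ z.degree) : ∃ v, w + v ≤ z ∧ (w + v).degree = d := by
  obtain ⟨z, rfl⟩ := exists_add_of_le hwz
  obtain ⟨v, hv, hvd⟩ := Finsupp.exists_le_degree_eq z (d - w.degree) (by
    rw [map_add] at hz; omega)
  exact ⟨v, add_le_add_right hv w, by rw [map_add, hvd]; omega⟩

lemma snc_lex_lt_of_fill {d e j : ℕ} {w m : Fin n →₀ ℕ} (hed : e + j = d) (hw : w ∈ box n c e)
    (hm : m ∈ box n c d)
    (hfill : ∀ v : Fin n →₀ ℕ, v.degree = j → Capped c (w + v) → toLex m < toLex (w + v)) :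
    toLex (snc m 0) < toLex (snc w j) := by
  obtain ⟨hwd, hwc⟩ := mem_box.1 hw
  obtain ⟨hmd, hmc⟩ := mem_box.1 hm
  rcases lt_trichotomy (toLex w) (toLex m) with h | h | h
  · exfalso
    have hfill' : ∀ z, w ≤ z → z ≤ w ⊔ m → d ≤ z.degree →
        ∃ u, u ≤ z ∧ toLex m < toLex u := by
      intro z hwz hz hdz
      obtain ⟨v, hv, hvd⟩ := exists_between_degree_eq (d := d) hwz (by omega) hdz
      refine ⟨w + v, hv, hfill v ?_ ((hwc.sup hmc).mono (hv.trans hz))⟩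
      rw [map_add] at hvd; omega
    obtain ⟨t, ht, ht'⟩ := Finsupp.Lex.lt_iff.1 h
    simp only [ofLex_toLex] at ht ht'
    have hzt : ∀ r ≤ t, (w ⊔ m) r = m r := by
      intro r hr
      rcases hr.eq_or_lt with rfl | hr
      · simp [ht'.le]
      · simp [ht r hr]
    obtain ⟨z', hz'⟩ := exists_add_single_of_last (m := w ⊔ m) (j := t) (by
      rw [hzt t le_rfl]; omega)
    have hz't := congrArg (fun f => f t) hz'
    have hmz : m ≤ w ⊔ m := le_sup_right
    have hwz' : w ≤ z' := by
      intro r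
      have hr : (w ⊔ m) r = z' r + Finsupp.single t 1 r := by rw [hz', Finsupp.add_apply]
      have hwr : w r ≤ (w ⊔ m) r := (le_sup_left : w ≤ w ⊔ m) r
      by_cases hrt : t = r
      · subst hrt
        rw [hzt t le_rfl, Finsupp.single_eq_same] at hr; omega
      · rw [Finsupp.single_eq_of_ne' hrt] at hr; omega
    have hz'z : z' ≤ w ⊔ m := by rw [hz']; exact le_self_add
    by_cases hdz : d ≤ z'.degree
    · obtain ⟨u, hu, hlt⟩ := hfill' z' hwz' hz'z hdz
      refine absurd hlt (not_lt.2 (le_of_lt ?_))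
      have hut : u t < m t := by
        have h1 := hu t
        rw [← hzt t le_rfl, hz', Finsupp.add_apply, Finsupp.single_eq_same]; omega
      have hur : ∀ r < t, u r ≤ m r := fun r hr => by
        rw [← hzt r hr.le]; exact (hu.trans hz'z) r
      by_contra! hle
      rcases hle.eq_or_lt with heq | hlt
      · rw [toLex.injective heq] at hut; omega
      · obtain ⟨s, hs, hs'⟩ := Finsupp.Lex.lt_iff.1 hlt
        simp only [ofLex_toLex] at hs hs'
        rcases lt_trichotomy s t with hst | hst | hst
        · have := hur s hst; omega
        · subst hst; omega
        · have := hs t hst; omega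
    · have hzd : (w ⊔ m).degree = z'.degree + 1 := by rw [hz', map_add, Finsupp.degree_single]
      have hmle := Finsupp.degree_mono hmz
      have hzm : w ⊔ m = m := by
        obtain ⟨y, hy⟩ := exists_add_of_le hmz
        have : y.degree = 0 := by
          have := congrArg Finsupp.degree hy
          rw [map_add] at this; omega
        rw [Finsupp.degree_eq_zero_iff] at this
        rw [hy, this, add_zero]
      obtain ⟨v, rfl⟩ := exists_add_of_le (le_sup_left.trans hzm.le : w ≤ m)
      rw [map_add] at hmd
      exact lt_irrefl _ (hfill v (by omega) hmc)
  · exfalso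
    obtain rfl := toLex.injective h
    have := hfill 0 (by simp; omega) (by simpa using hwc)
    simp at this
  · exact snc_lex_lt 0 j h

end LexSets

section Families

variable {n : ℕ} {c : ℕ → ℕ∞}

/-- Families of lex-segments recording the slices of a monomial ideal in one more variable. -/
structure IsFamily (c : ℕ → ℕ∞) (F : ℕ → ℕ → Finset (Fin n →₀ ℕ)) : Prop where
  up : ∀ j e, IsUp (box n c e) (F j e)
  sh_sub : ∀ j e, sh c e (F j e) ⊆ F j (e + 1)
  mono : ∀ j e, F j e ⊆ F (j + 1) e

/-- The number of exponents of degree `e` in the union of the slices. -/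
def total (F : ℕ → ℕ → Finset (Fin n →₀ ℕ)) (e : ℕ) : ℕ :=
  ∑ p ∈ Finset.HasAntidiagonal.antidiagonal e, (F p.1 p.2).card

lemma IsFamily.total_succ {F : ℕ → ℕ → Finset (Fin n →₀ ℕ)} (hF : IsFamily c F) (e : ℕ) :
    total F e + (F 0 (e + 1)).card ≤ total F (e + 1) := by
  rw [total, total, Finset.Nat.sum_antidiagonal_succ, add_comm]
  exact Nat.add_le_add_left (Finset.sum_le_sum fun p _ => Finset.card_le_card (hF.mono _ _)) _

open Classical in
/-- The exponents of degree `e` in the union of the slices. -/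
noncomputable def slices (F : ℕ → ℕ → Finset (Fin n →₀ ℕ)) (e : ℕ) :
    Finset (Fin (n + 1) →₀ ℕ) :=
  (Finset.HasAntidiagonal.antidiagonal e).biUnion fun p => (F p.1 p.2).image fun m => snc m p.1

lemma mem_slices {F : ℕ → ℕ → Finset (Fin n →₀ ℕ)} (hF : ∀ j e, ∀ m ∈ F j e, m.degree = e)
    {e : ℕ} {m : Fin (n + 1) →₀ ℕ} :
    m ∈ slices F e ↔ m.degree = e ∧ ini m ∈ F (m (Fin.last n)) (ini m).degree := by
  simp only [slices, Finset.mem_biUnion, Finset.HasAntidiagonal.mem_antidiagonal, Finset.mem_image, Prod.exists]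
  constructor
  · rintro ⟨j, k, hjk, w, hw, rfl⟩
    have := hF _ _ _ hw
    exact ⟨by rw [degree_snc]; omega, by simpa [this] using hw⟩
  · rintro ⟨rfl, h⟩
    exact ⟨_, _, by rw [← degree_ini]; omega, _, h, snc_ini m⟩

lemma card_slices (F : ℕ → ℕ → Finset (Fin n →₀ ℕ)) (e : ℕ) : (slices F e).card = total F e := by
  classical
  rw [slices, total, Finset.card_biUnion]
  · refine Finset.sum_congr rfl fun p _ => Finset.card_image_of_injective _ ?_
    intro m m' h
    simpa using congrArg ini h
  · intro p hp q hq hpq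
    rw [Function.onFun, Finset.disjoint_left]
    intro m hm hm'
    obtain ⟨w, -, rfl⟩ := Finset.mem_image.1 hm
    obtain ⟨w', -, h⟩ := Finset.mem_image.1 hm'
    have h1 : q.1 = p.1 := by simpa using congrArg (fun f => f (Fin.last n)) h
    rw [Finset.mem_coe, Finset.HasAntidiagonal.mem_antidiagonal] at hp hq
    exact hpq (Prod.ext h1.symm (by omega))

lemma card_sh_le_of_families {d N N' : ℕ} (hc : c n = ⊤)
    (P : (ℕ → ℕ → Finset (Fin n →₀ ℕ)) → Prop) (hne : ∃ F, P F)
    (hfam : ∀ F, P F → IsFamily c F) (hN : ∀ F, P F → total F d = N)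
    (hN' : ∀ F, P F → total F (d + 1) = N')
    (himp : ∀ F, P F → ∀ j e (w v : Fin n →₀ ℕ), e + j = d → w ∈ F j e → v.degree = j →
      Capped c (w + v) → w + v ∉ F 0 d → ∃ F', P F' ∧ (F 0 d).card < (F' 0 d).card)
    {U : Finset (Fin (n + 1) →₀ ℕ)} (hU : IsUp (box (n + 1) c d) U) (hUN : U.card ≤ N) :
    (sh c d U).card ≤ N' := by
  classical
  obtain ⟨F, hPF, hmax⟩ : ∃ F, P F ∧ ∀ F', P F' → (F' 0 d).card ≤ (F 0 d).card := by
    have hbdd : ∀ F, P F → (F 0 d).card ≤ (box n c d).card := fun F hF =>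
      Finset.card_le_card ((hfam F hF).up 0 d).1
    let S : Set ℕ := {k | ∃ F, P F ∧ (F 0 d).card = k}
    have hS : S.Nonempty := by obtain ⟨F, hF⟩ := hne; exact ⟨_, F, hF, rfl⟩
    have hSb : BddAbove S := ⟨(box n c d).card, by rintro _ ⟨F, hF, rfl⟩; exact hbdd F hF⟩
    obtain ⟨F, hF, hk⟩ := Nat.sSup_mem hS hSb
    exact ⟨F, hF, fun F' hF' => by rw [hk]; exact le_csSup hSb ⟨F', hF', rfl⟩⟩
  have hF := hfam F hPF
  have hdeg : ∀ j e, ∀ m ∈ F j e, m.degree = e := fun j e m hm => (mem_box.1 ((hF.up j e).1 hm)).1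
  have hbot : bottom c d U ⊆ F 0 d := by
    by_contra hnot
    have hsub := (hU.isUp_bottom.total (hF.up 0 d)).resolve_left hnot
    obtain ⟨m, hm, hmF⟩ := Finset.not_subset.1 hnot
    obtain ⟨hmb, hmU⟩ := mem_bottom.1 hm
    have hlt : ∀ y ∈ F 0 d, toLex m < toLex y := by
      intro y hy
      by_contra! h
      exact hmF ((hF.up 0 d).2 y hy m hmb h)
    have hss : slices F d ⊂ U := by
      refine (Finset.ssubset_iff_of_subset ?_).2 ⟨snc m 0, hmU, ?_⟩
      · intro y hy
        obtain ⟨hyd, hy⟩ := (mem_slices hdeg).1 hy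
        set w := ini y with hw
        set j := y (Fin.last n) with hj
        have hwj : snc w j = y := snc_ini y
        have hwb := (hF.up _ _).1 hy
        have hed : w.degree + j = d := by rw [← hyd]; exact degree_ini y
        have := snc_lex_lt_of_fill hed hwb hmb fun v hv hcap => by
          by_contra! hle
          have hvF : w + v ∉ F 0 d := fun h => absurd (hlt _ h) (not_lt.2 hle)
          obtain ⟨F', hF', hcard⟩ := himp F hPF j _ w v hed hy hv hcap hvF
          exact absurd (hmax F' hF') (not_le.2 hcard)
        rw [← hwj]
        refine hU.2 _ hmU _ (mem_box.2 ⟨by rw [degree_snc, hed], capped_snc.2 ⟨?_, ?_⟩⟩) this.le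
        · exact (mem_box.1 hwb).2
        · rw [hc]; exact WithTop.coe_lt_top _
      · rw [mem_slices hdeg]
        rintro ⟨-, h⟩
        rw [ini_snc, snc_last, (mem_box.1 hmb).1] at h
        exact hmF h
    have := Finset.card_lt_card hss
    rw [card_slices, hN F hPF] at this
    omega
  calc (sh c d U).card ≤ U.card + (sh c d (bottom c d U)).card := hU.card_sh_le
    _ ≤ total F d + (F 0 (d + 1)).card := by
        rw [hN F hPF]
        exact Nat.add_le_add hUN (Finset.card_le_card ((sh_mono hbot).trans (hF.sh_sub 0 d)))
    _ ≤ total F (d + 1) := hF.total_succ d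
    _ = N' := hN' F hPF

end Families

section Monomial

variable {K : Type*} [Field K] {n : ℕ} {c : ℕ → ℕ∞}

/-- The ideal generated by the monomials whose exponents satisfy `P`. -/
noncomputable def monoIdeal (K : Type*) [Field K] {n : ℕ} (P : (Fin n →₀ ℕ) → Prop) :
    Ideal (MvPolynomial (Fin n) K) :=
  Ideal.span ((fun m => (monomial m (1 : K) : MvPolynomial (Fin n) K)) '' {m | P m})

lemma mem_monoIdeal {P : (Fin n →₀ ℕ) → Prop} (hP : Monotone P) {f : MvPolynomial (Fin n) K} :
    f ∈ monoIdeal K P ↔ ∀ m, coeff m f ≠ 0 → P m := by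
  rw [monoIdeal, mem_ideal_span_monomial_image]
  simp only [mem_support_iff]
  exact forall₂_congr fun m _ => ⟨fun ⟨s, hs, hsm⟩ => hP hsm hs, fun h => ⟨m, h, le_rfl⟩⟩

lemma monomial_mem_monoIdeal {P : (Fin n →₀ ℕ) → Prop} {m : Fin n →₀ ℕ} (h : P m) (r : K) :
    monomial m r ∈ monoIdeal K P := by
  rw [show monomial m r = C r * monomial m 1 by rw [C_mul_monomial, mul_one]]
  exact Ideal.mul_mem_left _ _ (Ideal.subset_span ⟨m, h, rfl⟩)

lemma isHomog_monoIdeal {P : (Fin n →₀ ℕ) → Prop} (hP : Monotone P) :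
    IsHomog (monoIdeal K P) := by
  intro f hf d
  rw [mem_monoIdeal hP] at hf ⊢
  intro m hm
  rw [coeff_homogeneousComponent] at hm
  exact hf m (by aesop)

lemma monoIdeal_mono {P Q : (Fin n →₀ ℕ) → Prop} (h : ∀ m, P m → Q m) :
    monoIdeal K P ≤ monoIdeal K Q :=
  Ideal.span_mono (Set.image_mono h)

lemma component_monoIdeal {P : (Fin n →₀ ℕ) → Prop} (hP : Monotone P) (d : ℕ) :
    component (monoIdeal K P) d = Submodule.span K
      ((fun m => (monomial m (1 : K) : MvPolynomial (Fin n) K)) '' {m | m.degree = d ∧ P m}) := by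
  apply le_antisymm
  · intro f hf
    rw [mem_component, mem_monoIdeal hP] at hf
    rw [f.as_sum]
    refine Submodule.sum_mem _ fun m hm => ?_
    rw [mem_support_iff] at hm
    rw [show monomial m (coeff m f) = coeff m f • monomial m (1 : K) by
      rw [smul_monomial, smul_eq_mul, mul_one]]
    refine Submodule.smul_mem _ _ (Submodule.subset_span ⟨m, ⟨?_, hf.1 m hm⟩, rfl⟩)
    rw [Finsupp.degree_eq_weight_one]
    exact hf.2 hm
  · rw [Submodule.span_le]
    rintro _ ⟨m, ⟨hmd, hm⟩, rfl⟩
    exact mem_component.2 ⟨monomial_mem_monoIdeal hm 1, isHomogeneous_monomial _ hmd⟩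

lemma finrank_span_monomial (S : Finset (Fin n →₀ ℕ)) :
    Module.finrank K (Submodule.span K
      ((fun m => (monomial m (1 : K) : MvPolynomial (Fin n) K)) '' (S : Set (Fin n →₀ ℕ)))) =
      S.card := by
  have h : LinearIndependent K
      fun m : S => (monomial (m : Fin n →₀ ℕ) (1 : K) : MvPolynomial (Fin n) K) :=
    (basisMonomials (Fin n) K).linearIndependent.comp _ Subtype.val_injective
  have h2 := finrank_span_eq_card h
  rw [Fintype.card_coe] at h2
  rw [← h2, Set.image_eq_range]
  rfl

lemma hilb_monoIdeal {P : (Fin n →₀ ℕ) → Prop} (hP : Monotone P) {d : ℕ}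
    {S : Finset (Fin n →₀ ℕ)} (hS : ∀ m, m ∈ S ↔ m.degree = d ∧ P m) :
    hilb (monoIdeal K P) d = S.card := by
  rw [hilb, component_monoIdeal hP, ← finrank_span_monomial (K := K) S]
  have : {m : Fin n →₀ ℕ | m.degree = d ∧ P m} = (S : Set (Fin n →₀ ℕ)) := by
    ext m; simp [hS]
  rw [this]

lemma monotone_not_capped : Monotone fun m : Fin n →₀ ℕ => ¬ Capped c m :=
  fun _ _ h h' h'' => h' (h''.mono h)

/-- The ideal generated by the powers prescribed by the caps. -/
noncomputable def capIdeal (K : Type*) [Field K] (n : ℕ) (c : ℕ → ℕ∞) :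
    Ideal (MvPolynomial (Fin n) K) :=
  monoIdeal K fun m => ¬ Capped c m

lemma hilbTop_eq_card (K : Type*) [Field K] (n d : ℕ) :
    hilbTop K n d = (box n (fun _ => ⊤) d).card := by
  have h : (⊤ : Ideal (MvPolynomial (Fin n) K)) = monoIdeal K fun _ => True := by
    ext f
    rw [mem_monoIdeal monotone_const]
    simp
  rw [hilbTop, h]
  refine hilb_monoIdeal monotone_const fun m => ?_
  rw [mem_box]
  simp only [and_congr_right_iff, iff_true]
  exact fun _ i => WithTop.coe_lt_top _

lemma hilb_capIdeal_add_card_box (c : ℕ → ℕ∞) (d : ℕ) :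
    hilb (capIdeal K n c) d + (box n c d).card = hilbTop K n d := by
  classical
  rw [hilbTop_eq_card, capIdeal, hilb_monoIdeal monotone_not_capped (S := box n (fun _ => ⊤) d \ box n c d),
    Finset.card_sdiff_add_card_eq_card]
  · intro m hm
    rw [mem_box] at *
    exact ⟨hm.1, fun i => WithTop.coe_lt_top _⟩
  · intro m
    simp only [Finset.mem_sdiff, mem_box]
    constructor
    · rintro ⟨⟨h, -⟩, h2⟩
      exact ⟨h, fun h3 => h2 ⟨h, h3⟩⟩
    · rintro ⟨h, h2⟩
      exact ⟨⟨h, fun i => WithTop.coe_lt_top _⟩, fun h3 => h2 h3.2⟩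

lemma IsCI.hilb_add_card_box {as : List ℕ} {J : Ideal (MvPolynomial (Fin n) K)} (hJ : IsCI as J)
    (hc : IsCI as (capIdeal K n c)) (d : ℕ) : hilb J d + (box n c d).card = hilbTop K n d := by
  rw [hJ.hilb_eq hc, hilb_capIdeal_add_card_box]

lemma capIdeal_top : capIdeal K n (fun _ => ⊤) = ⊥ := by
  rw [eq_bot_iff]
  intro f hf
  rw [capIdeal, mem_monoIdeal monotone_not_capped] at hf
  rw [Ideal.mem_bot]
  ext m
  by_contra h
  exact hf m h fun i => WithTop.coe_lt_top _

lemma isCI_update_capIdeal {as : List ℕ} (h : IsCI as (capIdeal K n c)) {k : ℕ} (hkn : k < n)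
    (hk : c k = ⊤) {a : ℕ} (ha : 0 < a) :
    IsCI (a :: as) (capIdeal K n (Function.update c k (a : ℕ∞))) := by
  classical
  have hcap : ∀ m : Fin n →₀ ℕ, Capped (Function.update c k (a : ℕ∞)) m ↔
      Capped c m ∧ m ⟨k, hkn⟩ < a := by
    intro m
    constructor
    · intro h
      refine ⟨fun i => ?_, by simpa using h ⟨k, hkn⟩⟩
      by_cases hi : (i : ℕ) = k
      · rw [hi, hk]; exact WithTop.coe_lt_top _
      · simpa [hi] using h i
    · rintro ⟨h, hlt⟩ i
      by_cases hi : (i : ℕ) = k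
      · have : i = ⟨k, hkn⟩ := Fin.ext hi
        subst this
        simpa using hlt
      · simpa [hi] using h i
  have hX : (X ⟨k, hkn⟩ : MvPolynomial (Fin n) K) ^ a =
      monomial (Finsupp.single ⟨k, hkn⟩ a) 1 := by rw [X_pow_eq_monomial]
  have heq : capIdeal K n (Function.update c k (a : ℕ∞)) =
      capIdeal K n c ⊔ Ideal.span {X ⟨k, hkn⟩ ^ a} := by
    apply le_antisymm
    · refine Ideal.span_le.2 ?_
      rintro _ ⟨m, hm, rfl⟩
      rw [Set.mem_ofPred_eq, hcap, not_and_or] at hm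
      rcases hm with hm | hm
      · exact Ideal.mem_sup_left (monomial_mem_monoIdeal hm 1)
      · refine Ideal.mem_sup_right (Ideal.mem_span_singleton.2 ?_)
        rw [hX]
        exact monomial_dvd_monomial.2 ⟨Or.inr (Finsupp.single_le_iff.2 (not_lt.1 hm)), one_dvd _⟩
    · refine sup_le (monoIdeal_mono fun m hm => by rw [hcap]; tauto) ?_
      rw [Ideal.span_singleton_le_iff_mem, hX]
      refine monomial_mem_monoIdeal ?_ 1
      rw [hcap]
      simp
  rw [heq]
  refine IsCI.cons _ h (isHomogeneous_X_pow _ _) ha ?_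
  intro u hu
  rw [capIdeal, mem_monoIdeal monotone_not_capped] at hu ⊢
  intro m hm hcm
  rw [hX] at hu
  refine hu (m + Finsupp.single ⟨k, hkn⟩ a) (by rwa [coeff_mul_monomial, mul_one]) fun i => ?_
  by_cases hi : (i : ℕ) = k
  · rw [hi, hk]; exact WithTop.coe_lt_top _
  · have hne : ⟨k, hkn⟩ ≠ i := fun h => hi (h ▸ rfl)
    simpa [Finsupp.single_eq_of_ne' hne] using hcm i

end Monomial

section Slicing

variable {K : Type*} [Field K] {n : ℕ} {c : ℕ → ℕ∞}

/-- The Hilbert function of an ideal containing a complete intersection of type `as` grows, beyond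
the one of the complete intersection, at least as fast as lex-segments among the exponents capped
by `c`. -/
def EGHCapped (K : Type*) [Field K] (n : ℕ) (c : ℕ → ℕ∞) (as : List ℕ) : Prop :=
  ∀ J I : Ideal (MvPolynomial (Fin n) K), IsCI as J → IsHomog I → J ≤ I →
    ∀ (d : ℕ) (U : Finset (Fin n →₀ ℕ)), IsUp (box n c d) U → U.card + hilb J d ≤ hilb I d →
      (sh c d U).card + hilb J (d + 1) ≤ hilb I (d + 1)

lemma quo_pow_zero {R : Type*} [CommRing R] (I : Ideal R) (g : R) : quo I (g ^ 0) = I := by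
  ext u; simp [mem_quo]

lemma quo_quo_pow {R : Type*} [CommRing R] (I : Ideal R) (g : R) (j : ℕ) :
    quo (quo I g) (g ^ j) = quo I (g ^ (j + 1)) := by
  ext u; simp [mem_quo, pow_succ, mul_assoc]

lemma IsProj.sum_hilb_add {π : MvPolynomial (Fin (n + 1)) K →ₐ[K] MvPolynomial (Fin n) K}
    {l : MvPolynomial (Fin (n + 1)) K} (h : IsProj π l)
    {J : Ideal (MvPolynomial (Fin (n + 1)) K)} (hJ : IsHomog J) (hl : Nzd J l) (e : ℕ) :
    ∀ I : Ideal (MvPolynomial (Fin (n + 1)) K), IsHomog I → J ≤ I →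
    ∑ p ∈ Finset.HasAntidiagonal.antidiagonal e,
      (hilb ((quo I (l ^ p.1)).map π) p.2 - hilb (J.map π) p.2) + hilb J e = hilb I e := by
  induction e with
  | zero =>
    intro I hI hJI
    rw [h.hilb_zero hI, h.hilb_zero hJ]
    have := hilb_mono (Ideal.map_mono hJI : J.map π ≤ I.map π) 0
    simp only [Finset.HasAntidiagonal.antidiagonal_zero, Finset.sum_singleton, quo_pow_zero]
    omega
  | succ e ih =>
    intro I hI hJI
    have hI' : IsHomog (quo I l) := hI.quo h.linear
    have := ih (quo I l) hI' (hJI.trans (le_quo I l))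
    rw [h.hilb_succ hI, h.hilb_succ hJ, hl.quo_eq, Finset.Nat.sum_antidiagonal_succ]
    simp only [quo_pow_zero, ← quo_quo_pow]
    have := hilb_mono (Ideal.map_mono hJI : J.map π ≤ I.map π) (e + 1)
    omega

lemma exists_family {as : List ℕ} (hS : EGHCapped K n c as) (hc : IsCI as (capIdeal K n c))
    {π : MvPolynomial (Fin (n + 1)) K →ₐ[K] MvPolynomial (Fin n) K}
    {l : MvPolynomial (Fin (n + 1)) K} (h : IsProj π l)
    {J I : Ideal (MvPolynomial (Fin (n + 1)) K)} (hJ : IsCI as J) (hl : Nzd J l)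
    (hI : IsHomog I) (hJI : J ≤ I) :
    ∃ F : ℕ → ℕ → Finset (Fin n →₀ ℕ), IsFamily c F ∧
      (∀ e, total F e + hilb J e = hilb I e) ∧
      ∀ e, (F 0 e).card + hilb (J.map π) e = hilb (I.map π) e := by
  have hJ' : IsCI as (J.map π) := hJ.map h hl
  have hle : ∀ j, J.map π ≤ (quo I (l ^ j)).map π := fun j =>
    Ideal.map_mono (hJI.trans (le_quo I _))
  have hex : ∀ j e, ∃ U, IsUp (box n c e) U ∧
      U.card = hilb ((quo I (l ^ j)).map π) e - hilb (J.map π) e := by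
    intro j e
    refine exists_isUp_card _ ?_
    have h1 := hJ'.hilb_add_card_box hc e
    have h2 : hilb ((quo I (l ^ j)).map π) e ≤ hilbTop K n e := hilb_mono le_top e
    omega
  choose F hF hFc using hex
  have hFc' : ∀ j e, (F j e).card + hilb (J.map π) e = hilb ((quo I (l ^ j)).map π) e := by
    intro j e
    have := hilb_mono (hle j) e
    have := hFc j e
    omega
  refine ⟨F, ⟨hF, fun j e => ?_, fun j e => ?_⟩, fun e => ?_, fun e => ?_⟩
  · refine (hF j e).isUp_sh.subset_of_card_le (hF j (e + 1)) ?_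
    have h1 := hS (J.map π) _ hJ' (h.isHomog_map (hI.quo (h.linear.pow j))) (hle j) e (F j e)
      (hF j e) (hFc' j e).le
    have h2 := hFc' j (e + 1)
    omega
  · refine (hF j e).subset_of_card_le (hF (j + 1) e) ?_
    rw [hFc, hFc]
    refine Nat.sub_le_sub_right (hilb_mono (Ideal.map_mono ?_) e) _
    intro u hu
    rw [mem_quo] at *
    rw [pow_succ, ← mul_assoc]
    exact I.mul_mem_right _ hu
  · rw [← h.sum_hilb_add hJ.isHomog hl e I hI hJI, total]
    simp only [hFc]
  · rw [hFc', quo_pow_zero]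

end Slicing

section Distraction

attribute [local instance] MvPolynomial.gradedAlgebra

variable {K : Type*} [Field K] {n : ℕ} {c : ℕ → ℕ∞}

/-- The distraction of a monomial: the powers of the last variable are replaced by products of
the linear forms `X_last + ℓ i`. -/
noncomputable def distr (l : ℕ → MvPolynomial (Fin n) K) (m : Fin (n + 1) →₀ ℕ) :
    MvPolynomial (Fin (n + 1)) K :=
  rename Fin.castSucc (monomial (ini m) 1) *
    ∏ i ∈ Finset.range (m (Fin.last n)), (X (Fin.last n) + rename Fin.castSucc (l i))

/-- Sequences whose members are variables or zero. -/
def IsVarSeq (l : ℕ → MvPolynomial (Fin n) K) : Prop := ∀ i, l i = 0 ∨ ∃ t, l i = X t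

lemma ini_add_single_castSucc (m : Fin (n + 1) →₀ ℕ) (k : Fin n) :
    ini (m + Finsupp.single k.castSucc 1) = ini m + Finsupp.single k 1 := by
  ext i; simp [Finsupp.single_apply]

lemma ini_add_single_last (m : Fin (n + 1) →₀ ℕ) (j : ℕ) :
    ini (m + Finsupp.single (Fin.last n) j) = ini m := by
  ext i; simp

lemma distr_mul_X_castSucc (l : ℕ → MvPolynomial (Fin n) K) (m : Fin (n + 1) →₀ ℕ) (k : Fin n) :
    distr l m * X k.castSucc = distr l (m + Finsupp.single k.castSucc 1) := by
  have h : (m + Finsupp.single k.castSucc 1 : Fin (n + 1) →₀ ℕ) (Fin.last n) = m (Fin.last n) := by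
    simp
  have h2 : (monomial (ini m + Finsupp.single k 1) 1 : MvPolynomial (Fin n) K) =
      monomial (ini m) 1 * X k := by
    rw [X, monomial_mul, mul_one]
  rw [distr, distr, h, ini_add_single_castSucc, h2, map_mul, rename_X]
  ring

lemma distr_mul_X_last (l : ℕ → MvPolynomial (Fin n) K) (m : Fin (n + 1) →₀ ℕ) :
    distr l m * X (Fin.last n) = distr l (m + Finsupp.single (Fin.last n) 1)
      - distr l m * rename Fin.castSucc (l (m (Fin.last n))) := by
  have h : (m + Finsupp.single (Fin.last n) 1 : Fin (n + 1) →₀ ℕ) (Fin.last n) = m (Fin.last n) + 1 := by simp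
  rw [distr, distr, h, ini_add_single_last, Finset.prod_range_succ]
  ring

lemma isHomogeneous_distr {l : ℕ → MvPolynomial (Fin n) K} (hl : IsVarSeq l)
    (m : Fin (n + 1) →₀ ℕ) : (distr l m).IsHomogeneous m.degree := by
  rw [← degree_ini]
  refine ((isHomogeneous_monomial _ rfl).rename_isHomogeneous).mul ?_
  have := IsHomogeneous.prod (Finset.range (m (Fin.last n)))
    (fun i => (X (Fin.last n) + rename Fin.castSucc (l i) : MvPolynomial (Fin (n + 1)) K))
    (fun _ => 1) fun i _ => by
      refine (isHomogeneous_X _ _).add ?_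
      rcases hl i with h | ⟨t, h⟩
      · rw [h, map_zero]; exact isHomogeneous_zero _ _ _
      · rw [h, rename_X]; exact isHomogeneous_X _ _
  simpa using this

/-- The span of the distractions of the monomials whose exponents satisfy `P`. -/
noncomputable def distSpan (l : ℕ → MvPolynomial (Fin n) K) (P : (Fin (n + 1) →₀ ℕ) → Prop) :
    Submodule K (MvPolynomial (Fin (n + 1)) K) :=
  Submodule.span K (distr l '' {m | P m})

lemma mul_mem_distSpan {l : ℕ → MvPolynomial (Fin n) K} (hl : IsVarSeq l)
    {P : (Fin (n + 1) →₀ ℕ) → Prop} (hP : Monotone P) {f : MvPolynomial (Fin (n + 1)) K}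
    (hf : f ∈ distSpan l P) (q : MvPolynomial (Fin (n + 1)) K) : q * f ∈ distSpan l P := by
  have hX : ∀ f ∈ distSpan l P, ∀ i, f * X i ∈ distSpan l P := by
    intro f hf i
    induction hf using Submodule.span_induction with
    | zero => rw [zero_mul]; exact Submodule.zero_mem _
    | add x y _ _ hx hy => rw [add_mul]; exact Submodule.add_mem _ hx hy
    | smul a x _ hx => rw [smul_mul_assoc]; exact Submodule.smul_mem _ _ hx
    | mem x hx =>
      obtain ⟨m, hm, rfl⟩ := hx
      have hmem : ∀ k, distr l (m + Finsupp.single k 1) ∈ distSpan l P := fun k =>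
        Submodule.subset_span ⟨_, hP le_self_add hm, rfl⟩
      induction i using Fin.lastCases with
      | cast k => rw [distr_mul_X_castSucc]; exact hmem _
      | last =>
        rw [distr_mul_X_last]
        refine Submodule.sub_mem _ (hmem _) ?_
        rcases hl (m (Fin.last n)) with h | ⟨t, h⟩
        · rw [h, map_zero, mul_zero]; exact Submodule.zero_mem _
        · rw [h, rename_X, distr_mul_X_castSucc]; exact hmem _
  induction q using MvPolynomial.induction_on generalizing f with
  | C a => rw [C_mul']; exact Submodule.smul_mem _ _ hf
  | add p q hp hq => rw [add_mul]; exact Submodule.add_mem _ (hp hf) (hq hf)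
  | mul_X p i hp => rw [mul_assoc, mul_comm (X i)]; exact hp (hX f hf i)

/-- The distraction of a monomial ideal. -/
noncomputable def distIdeal (l : ℕ → MvPolynomial (Fin n) K) (P : (Fin (n + 1) →₀ ℕ) → Prop) :
    Ideal (MvPolynomial (Fin (n + 1)) K) := Ideal.span (distr l '' {m | P m})

lemma mem_distIdeal {l : ℕ → MvPolynomial (Fin n) K} (hl : IsVarSeq l)
    {P : (Fin (n + 1) →₀ ℕ) → Prop} (hP : Monotone P) {f : MvPolynomial (Fin (n + 1)) K} :
    f ∈ distIdeal l P ↔ f ∈ distSpan l P := by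
  constructor
  · intro hf
    induction hf using Submodule.span_induction with
    | zero => exact Submodule.zero_mem _
    | add x y _ _ hx hy => exact Submodule.add_mem _ hx hy
    | smul a x _ hx => exact mul_mem_distSpan hl hP hx a
    | mem x hx => exact Submodule.subset_span hx
  · intro hf
    have : distSpan l P ≤ (distIdeal l P).restrictScalars K :=
      Submodule.span_le.2 fun x hx => Ideal.subset_span hx
    exact this hf

lemma component_distIdeal {l : ℕ → MvPolynomial (Fin n) K} (hl : IsVarSeq l)
    {P : (Fin (n + 1) →₀ ℕ) → Prop} (hP : Monotone P) (d : ℕ) :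
    component (distIdeal l P) d = Submodule.span K (distr l '' {m | m.degree = d ∧ P m}) := by
  apply le_antisymm
  · intro f hf
    rw [mem_component, mem_distIdeal hl hP] at hf
    have key : ∀ g ∈ distSpan l P, homogeneousComponent d g ∈
        Submodule.span K (distr l '' {m | m.degree = d ∧ P m}) := by
      intro g hg
      induction hg using Submodule.span_induction with
      | zero => rw [map_zero]; exact Submodule.zero_mem _
      | add x y _ _ hx hy => rw [map_add]; exact Submodule.add_mem _ hx hy
      | smul a x _ hx => rw [map_smul]; exact Submodule.smul_mem _ _ hx
      | mem x hx =>
        obtain ⟨m, hm, rfl⟩ := hx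
        rw [homogeneousComponent_of_mem (isHomogeneous_distr hl m)]
        split_ifs with h
        · exact Submodule.subset_span ⟨m, ⟨h.symm, hm⟩, rfl⟩
        · exact Submodule.zero_mem _
    have := key f hf.1
    rwa [homogeneousComponent_eq_self hf.2] at this
  · rw [Submodule.span_le]
    rintro _ ⟨m, ⟨rfl, hm⟩, rfl⟩
    exact mem_component.2 ⟨Ideal.subset_span ⟨m, hm, rfl⟩, isHomogeneous_distr hl m⟩

lemma isHomog_distIdeal {l : ℕ → MvPolynomial (Fin n) K} (hl : IsVarSeq l)
    {P : (Fin (n + 1) →₀ ℕ) → Prop} : IsHomog (distIdeal l P) := by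
  rw [isHomog_iff]
  refine Ideal.homogeneous_span _ _ ?_
  rintro _ ⟨m, -, rfl⟩
  exact ⟨_, isHomogeneous_distr hl m⟩

lemma linearIndependent_distr {l : ℕ → MvPolynomial (Fin n) K} (hl : IsVarSeq l) (d : ℕ) :
    LinearIndependent K fun m : box (n + 1) (fun _ => ⊤) d => distr l m.1 := by
  rw [linearIndependent_iff_card_eq_finrank_span, Fintype.card_coe, ← hilbTop_eq_card K]
  have h1 : distIdeal l (fun _ => True) = ⊤ := by
    rw [Ideal.eq_top_iff_one]
    refine Ideal.subset_span ⟨0, trivial, ?_⟩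
    have : ini (0 : Fin (n + 1) →₀ ℕ) = 0 := by ext; simp
    simp [distr, this]
  rw [hilbTop, hilb, ← h1, component_distIdeal hl monotone_const]
  rw [Set.finrank]
  have hset : distr l '' {m | m.degree = d ∧ True} =
      Set.range fun m : box (n + 1) (fun _ => ⊤) d => distr l m.1 := by
    ext f
    simp [mem_box, Capped]
  rw [hset]

lemma hilb_distIdeal {l : ℕ → MvPolynomial (Fin n) K} (hl : IsVarSeq l)
    {P : (Fin (n + 1) →₀ ℕ) → Prop} (hP : Monotone P) {d : ℕ} {S : Finset (Fin (n + 1) →₀ ℕ)}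
    (hS : ∀ m, m ∈ S ↔ m.degree = d ∧ P m) : hilb (distIdeal l P) d = S.card := by
  have hsub : ∀ m ∈ S, m ∈ box (n + 1) (fun _ => ⊤) d := fun m hm =>
    mem_box.2 ⟨((hS m).1 hm).1, fun i => WithTop.coe_lt_top _⟩
  have h : LinearIndependent K fun m : S => distr l m.1 :=
    (linearIndependent_distr hl d).comp (fun m : S => ⟨m.1, hsub m.1 m.2⟩) fun x y hxy => by
      rw [Subtype.ext_iff] at hxy ⊢
      exact hxy
  have h2 := finrank_span_eq_card h
  rw [Fintype.card_coe] at h2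
  rw [← h2, hilb, component_distIdeal hl hP]
  have hset : distr l '' {m | m.degree = d ∧ P m} = Set.range fun m : S => distr l m.1 := by
    ext f
    simp [hS]
  rw [hset]

end Distraction

section Step

variable {K : Type*} [Field K] {n : ℕ} {c : ℕ → ℕ∞}

lemma monotone_of_add_single {P : (Fin n →₀ ℕ) → Prop}
    (h : ∀ m i, P m → P (m + Finsupp.single i 1)) : Monotone P := by
  intro m m' hm hPm
  obtain ⟨v, rfl⟩ := exists_add_of_le hm
  clear hm
  induction v using Finsupp.induction_linear generalizing m with
  | zero => simpa using hPm
  | add f g hf hg => rw [← add_assoc]; exact hg (hf hPm)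
  | single i k =>
    induction k with
    | zero => simpa using hPm
    | succ k ih => rw [Finsupp.single_add, ← add_assoc]; exact h _ _ ih

/-- The exponents in the monomial ideal whose slices are prescribed by a family. -/
def FamPred (c : ℕ → ℕ∞) (F : ℕ → ℕ → Finset (Fin n →₀ ℕ)) (m : Fin (n + 1) →₀ ℕ) : Prop :=
  ¬ Capped c (ini m) ∨ ini m ∈ F (m (Fin.last n)) (ini m).degree

lemma IsFamily.monotone_famPred {F : ℕ → ℕ → Finset (Fin n →₀ ℕ)} (hF : IsFamily c F) :
    Monotone (FamPred c F) := by
  refine monotone_of_add_single fun m i h => ?_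
  induction i using Fin.lastCases with
  | last =>
    have h1 : (m + Finsupp.single (Fin.last n) 1 : Fin (n + 1) →₀ ℕ) (Fin.last n)
        = m (Fin.last n) + 1 := by simp
    rw [FamPred, ini_add_single_last, h1]
    exact h.imp_right fun h => hF.mono _ _ h
  | cast k =>
    have h1 : (m + Finsupp.single k.castSucc 1 : Fin (n + 1) →₀ ℕ) (Fin.last n)
        = m (Fin.last n) := by simp
    rw [FamPred, ini_add_single_castSucc, h1]
    by_cases hcap : Capped c (ini m + Finsupp.single k 1)
    · have hm : ini m ∈ F (m (Fin.last n)) (ini m).degree :=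
        h.resolve_left fun h' => h' (hcap.mono le_self_add)
      right
      have hd : (ini m + Finsupp.single k 1).degree = (ini m).degree + 1 := by
        rw [map_add, Finsupp.degree_single]
      rw [hd]
      exact hF.sh_sub _ _ (mem_sh.2 ⟨mem_box.2 ⟨hd, hcap⟩, _, hm, k, rfl⟩)
    · exact Or.inl hcap

lemma capped_iff_ini (hc : c n = ⊤) {m : Fin (n + 1) →₀ ℕ} : Capped c m ↔ Capped c (ini m) := by
  rw [← snc_ini m, capped_snc, ini_snc, hc]
  exact and_iff_left (WithTop.coe_lt_top _)

lemma IsFamily.hilb_distIdeal {F : ℕ → ℕ → Finset (Fin n →₀ ℕ)} (hF : IsFamily c F)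
    (hc : c n = ⊤) {l : ℕ → MvPolynomial (Fin n) K} (hl : IsVarSeq l) (d : ℕ) :
    hilb (distIdeal l (FamPred c F)) d = total F d + hilb (capIdeal K (n + 1) c) d := by
  classical
  have hdeg : ∀ j e, ∀ m ∈ F j e, m.degree = e := fun j e m hm => (mem_box.1 ((hF.up j e).1 hm)).1
  rw [capIdeal, hilb_monoIdeal monotone_not_capped
    (S := (box (n + 1) (fun _ => ⊤) d).filter fun m => ¬ Capped c m) (fun m => by
      simp [mem_box, Capped]), ← card_slices, ← Finset.card_union_of_disjoint]
  · refine _root_.hilb_distIdeal hl hF.monotone_famPred fun m => ?_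
    have h1 : m ∈ box (n + 1) (fun _ => ⊤) d ↔ m.degree = d := by simp [mem_box, Capped]
    rw [Finset.mem_union, mem_slices hdeg, Finset.mem_filter, h1, FamPred, capped_iff_ini hc]
    tauto
  · rw [Finset.disjoint_left]
    intro m hm hm'
    have h1 := ((mem_slices hdeg).1 hm).2
    have h2 := (Finset.mem_filter.1 hm').2
    rw [capped_iff_ini hc] at h2
    exact h2 (mem_box.1 ((hF.up _ _).1 h1)).2

lemma distr_snc_zero (l : ℕ → MvPolynomial (Fin n) K) (m : Fin n →₀ ℕ) :
    distr l (snc m 0) = rename Fin.castSucc (monomial m 1) := by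
  simp [distr]

lemma capIdeal_le_distIdeal (hc : c n = ⊤) (F : ℕ → ℕ → Finset (Fin n →₀ ℕ))
    (l : ℕ → MvPolynomial (Fin n) K) :
    capIdeal K (n + 1) c ≤ distIdeal l (FamPred c F) := by
  refine Ideal.span_le.2 ?_
  rintro _ ⟨m, hm, rfl⟩
  rw [Set.mem_ofPred_eq, capped_iff_ini hc] at hm
  have h1 : (monomial m 1 : MvPolynomial (Fin (n + 1)) K) =
      distr l (snc (ini m) 0) * monomial (Finsupp.single (Fin.last n) (m (Fin.last n))) 1 := by
    rw [distr_snc_zero, rename_monomial, monomial_mul, mul_one]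
    refine congrArg (fun s => monomial s (1 : K)) ?_
    ext i
    induction i using Fin.lastCases with
    | last =>
      rw [Finsupp.add_apply, Finsupp.mapDomain_of_notMem_range, Finsupp.single_eq_same, zero_add]
      rintro ⟨k, hk⟩
      exact (Fin.castSucc_lt_last k).ne hk
    | cast k =>
      rw [Finsupp.add_apply, Finsupp.mapDomain_apply (Fin.castSucc_injective n)]
      simp
  change monomial m 1 ∈ _
  rw [h1]
  exact Ideal.mul_mem_right _ _ (Ideal.subset_span ⟨_, Or.inl (by rwa [ini_snc]), rfl⟩)

lemma nzd_capIdeal_X_last (hc : c n = ⊤) :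
    Nzd (capIdeal K (n + 1) c) (X (Fin.last n)) := by
  intro u hu
  rw [capIdeal, mem_monoIdeal monotone_not_capped] at hu ⊢
  intro m hm
  have := hu (m + Finsupp.single (Fin.last n) 1) (by rwa [coeff_mul_X])
  rwa [capped_iff_ini hc, ini_add_single_last, ← capped_iff_ini hc] at this

lemma isProj_projHom_last :
    IsProj (projHom (Fin.last n) (0 : Fin n → K)) (X (Fin.last n)) := by
  simpa using isProj_projHom (Fin.last n) (0 : Fin n → K)

lemma projHom_last_rename (p : MvPolynomial (Fin n) K) :
    projHom (Fin.last n) (0 : Fin n → K) (rename Fin.castSucc p) = p := by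
  have : (projHom (Fin.last n) (0 : Fin n → K)).comp (rename Fin.castSucc) = AlgHom.id K _ := by
    ext i
    simp only [AlgHom.comp_apply, rename_X, AlgHom.id_apply]
    rw [← Fin.succAbove_last, projHom_X_succAbove]
  exact DFunLike.congr_fun this p

lemma projHom_last_distr (l : ℕ → MvPolynomial (Fin n) K) (m : Fin (n + 1) →₀ ℕ) :
    projHom (Fin.last n) (0 : Fin n → K) (distr l m) =
      monomial (ini m) 1 * ∏ i ∈ Finset.range (m (Fin.last n)), l i := by
  rw [distr, map_mul, projHom_last_rename, map_prod]
  simp [projHom_X_self, projHom_last_rename]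

lemma exists_isVarSeq_prod (v : Fin n →₀ ℕ) : ∃ l : ℕ → MvPolynomial (Fin n) K, IsVarSeq l ∧
    ∏ i ∈ Finset.range v.degree, l i = monomial v 1 := by
  induction hd : v.degree generalizing v with
  | zero =>
    rw [Finsupp.degree_eq_zero_iff] at hd
    exact ⟨0, fun _ => Or.inl rfl, by simp [hd]⟩
  | succ d ih =>
    obtain ⟨j, hj, -⟩ := exists_last (m := v) (by rintro rfl; simp at hd)
    obtain ⟨v, rfl⟩ := exists_add_single_of_last hj
    rw [map_add, Finsupp.degree_single] at hd
    obtain ⟨l, hl, hprod⟩ := ih v (by omega)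
    refine ⟨Function.update l d (X j), fun i => ?_, ?_⟩
    · by_cases hi : i = d
      · subst hi; exact Or.inr ⟨j, by simp⟩
      · simpa [hi] using hl i
    · rw [Finset.prod_range_succ, Function.update_self, Finset.prod_congr rfl fun i hi => by
        rw [Function.update_of_ne (Finset.mem_range.1 hi).ne], hprod, X, monomial_mul, mul_one]

lemma IsFamily.hilb_map_distIdeal {F : ℕ → ℕ → Finset (Fin n →₀ ℕ)} (hF : IsFamily c F)
    {e d : ℕ} {w v : Fin n →₀ ℕ} (hed : e + v.degree = d) (hw : w ∈ F v.degree e)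
    (hcap : Capped c (w + v)) (hwv : w + v ∉ F 0 d) {l : ℕ → MvPolynomial (Fin n) K}
    (hprod : ∏ i ∈ Finset.range v.degree, l i = monomial v 1) :
    (F 0 d).card + 1 + hilb (capIdeal K n c) d ≤
      hilb ((distIdeal l (FamPred c F)).map (projHom (Fin.last n) (0 : Fin n → K))) d := by
  classical
  set Z := (box n (fun _ => ⊤) d).filter fun m => ¬ Capped c m with hZ
  have hbox : ∀ m : Fin n →₀ ℕ, m ∈ box n (fun _ => ⊤) d ↔ m.degree = d := by
    simp [mem_box, Capped]
  have hwd : w.degree = e := (mem_box.1 ((hF.up _ _).1 hw)).1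
  have hFc : ∀ m ∈ F 0 d, m.degree = d ∧ Capped c m := fun m hm => mem_box.1 ((hF.up _ _).1 hm)
  have hcard : (insert (w + v) (F 0 d) ∪ Z).card =
      (F 0 d).card + 1 + hilb (capIdeal K n c) d := by
    rw [capIdeal, hilb_monoIdeal monotone_not_capped (S := Z) (fun m => by
      rw [hZ, Finset.mem_filter, hbox]), Finset.card_union_of_disjoint,
      Finset.card_insert_of_notMem hwv]
    rw [Finset.disjoint_left]
    intro m hm hm'
    have h2 := (Finset.mem_filter.1 hm').2
    rcases Finset.mem_insert.1 hm with rfl | hm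
    · exact h2 hcap
    · exact h2 (hFc m hm).2
  rw [← hcard, ← finrank_span_monomial (K := K), hilb]
  refine Submodule.finrank_mono (Submodule.span_le.2 ?_)
  rintro _ ⟨m, hm, rfl⟩
  have hmem : ∀ y, FamPred c F y → projHom (Fin.last n) (0 : Fin n → K) (distr l y) ∈
      (distIdeal l (FamPred c F)).map (projHom (Fin.last n) (0 : Fin n → K)) :=
    fun y hy => Ideal.mem_map_of_mem _ (Ideal.subset_span ⟨y, hy, rfl⟩)
  simp only [Finset.coe_union, Finset.coe_insert, Set.mem_union, Set.mem_insert_iff,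
    Finset.mem_coe] at hm
  have h0 : ∀ m : Fin n →₀ ℕ, projHom (Fin.last n) (0 : Fin n → K) (distr l (snc m 0)) =
      monomial m 1 := fun m => by rw [projHom_last_distr]; simp
  rw [SetLike.mem_coe, mem_component]
  rcases hm with (rfl | hm) | hm
  · refine ⟨?_, isHomogeneous_monomial _ (by rw [map_add]; omega)⟩
    have := hmem (snc w v.degree) (Or.inr (by rw [ini_snc, snc_last, hwd]; exact hw))
    rwa [projHom_last_distr, ini_snc, snc_last, hprod, monomial_mul, mul_one] at this
  · refine ⟨?_, isHomogeneous_monomial _ (hFc m hm).1⟩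
    change monomial m 1 ∈ _
    rw [← h0]
    exact hmem _ (Or.inr (by rw [ini_snc, snc_last, (hFc m hm).1]; exact hm))
  · rw [hZ, Finset.mem_filter, hbox] at hm
    refine ⟨?_, isHomogeneous_monomial _ hm.1⟩
    change monomial m 1 ∈ _
    rw [← h0]
    exact hmem _ (Or.inl (by rw [ini_snc]; exact hm.2))

theorem EGHCapped.succ [Infinite K] {as : List ℕ} (hS : EGHCapped K n c as) (hc : c n = ⊤)
    (hlen : as.length ≤ n) (hcap : IsCI as (capIdeal K n c))
    (hcap' : IsCI as (capIdeal K (n + 1) c)) : EGHCapped K (n + 1) c as := by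
  intro J I hJ hI hJI d U hU hUI
  have hJd := hilb_mono hJI d
  have hJd' := hilb_mono hJI (d + 1)
  have hnz := nzd_capIdeal_X_last (K := K) hc
  have hproj := isProj_projHom_last (K := K) (n := n)
  have key := card_sh_le_of_families (d := d) (N := hilb I d - hilb J d)
    (N' := hilb I (d + 1) - hilb J (d + 1)) hc
    (fun F => IsFamily c F ∧ total F d = hilb I d - hilb J d ∧
      total F (d + 1) = hilb I (d + 1) - hilb J (d + 1)) ?_ (fun F h => h.1) (fun F h => h.2.1)
    (fun F h => h.2.2) ?_ hU (by omega)
  · omega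
  · obtain ⟨l, hl, hln⟩ := hJ.exists_linear_nzd (Nat.lt_succ_of_le hlen)
    obtain ⟨π, hπ⟩ := exists_isProj hl (hln.ne_zero hJ.one_notMem)
    obtain ⟨F, hF, hFt, -⟩ := exists_family hS hcap hπ hJ hln hI hJI
    have h1 := hFt d
    have h2 := hFt (d + 1)
    exact ⟨F, hF, by omega, by omega⟩
  · rintro F ⟨hF, hFd, hFd'⟩ j e w v hed hw rfl hwv hnot
    obtain ⟨l, hl, hprod⟩ := exists_isVarSeq_prod (K := K) v
    obtain ⟨F', hF', hFt, hF0⟩ := exists_family hS hcap hproj hcap' hnz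
      (isHomog_distIdeal hl (P := FamPred c F)) (capIdeal_le_distIdeal hc F l)
    have h1 := hF.hilb_map_distIdeal hed hw hwv hnot hprod
    have h2 := hF0 d
    have h3 := (hcap'.map hproj hnz).hilb_eq hcap d
    have h4 := hFt d
    have h5 := hFt (d + 1)
    rw [hF.hilb_distIdeal hc hl] at h4 h5
    exact ⟨F', ⟨hF', by omega, by omega⟩, by omega⟩

end Step

section ThreeVariables

variable {K : Type*} [Field K]

lemma hilb_succ_eq_hilbTop {n : ℕ} {I : Ideal (MvPolynomial (Fin n) K)} {d : ℕ}
    (h : hilb I d = hilbTop K n d) : hilb I (d + 1) = hilbTop K n (d + 1) := by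
  have h1 : component I d = component ⊤ d :=
    component_eq_of_hilb_le (component_mono le_top d) h.ge
  have hmon : ∀ m : Fin n →₀ ℕ, m.degree = d → monomial m (1 : K) ∈ I := fun m hm =>
    (mem_component.1 (h1 ▸ mem_component.2 ⟨Submodule.mem_top, isHomogeneous_monomial 1 hm⟩)).1
  refine congrArg (fun S : Submodule K _ => Module.finrank K S)
    (le_antisymm (component_mono le_top _) fun f hf => ?_)
  have hfh := (mem_component.1 hf).2
  refine mem_component.2 ⟨?_, hfh⟩
  rw [f.as_sum]
  refine Ideal.sum_mem _ fun m hm => ?_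
  have hmd : m.degree = d + 1 := by
    rw [Finsupp.degree_eq_weight_one]; exact hfh (mem_support_iff.1 hm)
  obtain ⟨j, hj, -⟩ := exists_last (m := m) (by rintro rfl; simp at hmd)
  obtain ⟨u, rfl⟩ := exists_add_single_of_last hj
  rw [map_add, Finsupp.degree_single] at hmd
  have h2 : monomial (u + Finsupp.single j 1) (coeff (u + Finsupp.single j 1) f) =
      monomial (Finsupp.single j 1) (coeff (u + Finsupp.single j 1) f) * monomial u 1 := by
    rw [monomial_mul, mul_one, add_comm u]
  rw [h2]
  exact I.mul_mem_left _ (hmon u (by omega))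

/-- The caps `(3, ∞, ∞, …)`. -/
def capOne : ℕ → ℕ∞ := Function.update (fun _ => ⊤) 0 (3 : ℕ)

/-- The caps `(3, a, a, ∞, …)`. -/
def capThree (a : ℕ) : ℕ → ℕ∞ := Function.update (Function.update capOne 1 a) 2 a

lemma isCI_capOne {n : ℕ} (hn : 1 ≤ n) : IsCI [3] (capIdeal K n capOne) := by
  refine isCI_update_capIdeal (as := []) ?_ hn rfl (by norm_num)
  rw [capIdeal_top]
  exact IsCI.nil

lemma isCI_capThree {n a : ℕ} (hn : 3 ≤ n) (ha : 0 < a) :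
    IsCI [a, a, 3] (capIdeal K n (capThree a)) :=
  isCI_update_capIdeal (isCI_update_capIdeal (isCI_capOne (by omega)) (by omega) rfl ha)
    (by omega) rfl ha

lemma capped_capThree {a : ℕ} {m : Fin 3 →₀ ℕ} :
    Capped (capThree a) m ↔ m 0 < 3 ∧ m 1 < a ∧ m 2 < a := by
  simp only [Capped, Fin.forall_fin_succ, capThree, capOne]
  simp [Function.update]

lemma capped_capOne {m : Fin 3 →₀ ℕ} : Capped capOne m ↔ m 0 < 3 := by
  simp only [Capped, Fin.forall_fin_succ, capOne]
  simp [Function.update]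

lemma degree_fin_three (m : Fin 3 →₀ ℕ) : m.degree = m 0 + m 1 + m 2 := by
  rw [Finsupp.degree_eq_sum, Fin.sum_univ_three]

lemma mem_box_three {a d : ℕ} {m : Fin 3 →₀ ℕ} :
    m ∈ box 3 (capThree a) d ↔ m 0 + m 1 + m 2 = d ∧ m 0 < 3 ∧ m 1 < a ∧ m 2 < a := by
  rw [mem_box, capped_capThree, degree_fin_three]

/-- The exponent of the monomial of largest degree capped by `(3, a, a)`. -/
noncomputable def topThree (a : ℕ) : Fin 3 →₀ ℕ := Finsupp.equivFunOnFinite.symm ![2, a - 1, a - 1]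

lemma capped_capThree_iff_le {a : ℕ} (ha : 0 < a) (m : Fin 3 →₀ ℕ) :
    Capped (capThree a) m ↔ m ≤ topThree a := by
  rw [capped_capThree, Finsupp.le_def]
  simp only [Fin.forall_fin_succ, topThree]
  simp
  omega

lemma degree_topThree {a : ℕ} (ha : 0 < a) : (topThree a).degree = 2 * a := by
  rw [degree_fin_three]
  simp [topThree]
  omega

lemma IsCI.hilb_three_of_lt {a : ℕ} {J : Ideal (MvPolynomial (Fin 3) K)} (hJ : IsCI [a, a, 3] J)
    (ha : 0 < a) {t : ℕ} (ht : 2 * a < t) : hilb J t = hilbTop K 3 t := by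
  have h1 := hJ.hilb_add_card_box (isCI_capThree le_rfl ha) t
  have h2 : box 3 (capThree a) t = ∅ := by
    ext m
    simp only [mem_box_three, Finset.notMem_empty, iff_false]
    omega
  rwa [h2, Finset.card_empty] at h1

lemma IsCI.hilb_three_top {a : ℕ} {J : Ideal (MvPolynomial (Fin 3) K)} (hJ : IsCI [a, a, 3] J)
    (ha : 0 < a) : hilb J (2 * a) + 1 = hilbTop K 3 (2 * a) := by
  have h1 := hJ.hilb_add_card_box (isCI_capThree le_rfl ha) (2 * a)
  have h2 : box 3 (capThree a) (2 * a) = {topThree a} := by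
    ext m
    rw [mem_box, capped_capThree_iff_le ha, Finset.mem_singleton]
    constructor
    · rintro ⟨hm, hle⟩
      obtain ⟨v, hv⟩ := exists_add_of_le hle
      have h3 := congrArg Finsupp.degree hv
      rw [map_add, hm, degree_topThree ha] at h3
      rw [hv, (Finsupp.degree_eq_zero_iff v).1 (by omega), add_zero]
    · rintro rfl
      exact ⟨degree_topThree ha, le_rfl⟩
  rwa [h2, Finset.card_singleton] at h1

lemma IsCI.hilb_link_three [Infinite K] {a : ℕ} {J I : Ideal (MvPolynomial (Fin 3) K)}
    (hJ : IsCI [a, a, 3] J) (ha : 0 < a) (hI : IsHomog I) (hJI : J ≤ I) {e e' : ℕ}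
    (he : e + e' = 2 * a) :
    hilb (link J I) e' + hilb I e = hilb J e' + hilbTop K 3 e :=
  hJ.hilb_link rfl (by simp; omega) (hJ.hilb_three_top ha) (fun _ => hJ.hilb_three_of_lt ha)
    hI hJI he

lemma IsCI.hilb_one {P : Ideal (MvPolynomial (Fin 3) K)} (hP : IsCI [3] P) {d : ℕ} (hd : 1 ≤ d) :
    hilb P (d + 1) + hilbTop K 3 d + 3 = hilbTop K 3 (d + 1) + hilb P d := by
  have h0 : IsCI [] (⊥ : Ideal (MvPolynomial (Fin 3) K)) := IsCI.nil
  rcases hP with - | ⟨g, hB, hg, -, hn⟩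
  rcases hB with - | _
  have hlow : ∀ t, t < 3 → hilb (⊥ ⊔ Ideal.span {g}) t = 0 := fun t ht => by
    rw [hilb_sup_span_of_lt h0.isHomog hg ht, hilb_bot]
  have hhigh : ∀ t, hilb (⊥ ⊔ Ideal.span {g}) (t + 3) = hilbTop K 3 t := fun t => by
    have := hilb_sup_span_of_nzd h0 hg hn t
    simpa [hilb_bot] using this
  have hT := hilbTop_three K
  rcases lt_or_ge d 3 with h3 | h3
  · obtain rfl | rfl : d = 1 ∨ d = 2 := by omega
    · rw [hlow 2 (by omega), hlow 1 (by omega), hT 1]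
      omega
    · rw [hlow 2 (by omega), show 2 + 1 = 0 + 3 from rfl, hhigh 0, hT 2, hT 1, hT 0, hilbTop_zero]
  · obtain ⟨t, rfl⟩ := Nat.exists_eq_add_of_le' h3
    rw [hhigh t, show t + 3 + 1 = (t + 1) + 3 by omega, hhigh, hT t,
      show t + 1 + 3 = t + 3 + 1 by omega, hT (t + 3)]
    omega

lemma Nzd.of_sub_mem {R : Type*} [CommRing R] {J : Ideal R} {g h : R} (hg : Nzd J g)
    (hgh : h - g ∈ J) : Nzd J h := fun u hu => hg u (by
  have := J.sub_mem hu (J.mul_mem_left u hgh)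
  rwa [← mul_sub, sub_sub_cancel] at this)

lemma Nzd.C_mul {n : ℕ} {J : Ideal (MvPolynomial (Fin n) K)} {g : MvPolynomial (Fin n) K}
    (hg : Nzd J g) {r : K} (hr : r ≠ 0) : Nzd J (C r * g) := by
  intro u hu
  refine hg u ?_
  have := J.mul_mem_left (C r⁻¹) hu
  rwa [mul_left_comm u, ← mul_assoc, ← MvPolynomial.C_mul, inv_mul_cancel₀ hr, C_1, one_mul] at this

lemma exists_mem_nzd_of_span [Infinite K] {n d : ℕ} {J P I : Ideal (MvPolynomial (Fin n) K)}
    (hPJ : P ≤ J) {f : MvPolynomial (Fin n) K} (hf : Nzd J f)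
    (hfI : f ∈ Ideal.span (component I d : Set (MvPolynomial (Fin n) K)) ⊔ P) :
    ∃ u ∈ component I d, Nzd J u := by
  refine exists_nzd J (component I d) fun w hw => ?_
  by_contra! h
  refine hw (hf w ?_)
  have hle : Ideal.span (component I d : Set (MvPolynomial (Fin n) K)) ⊔ P ≤ quo J w := by
    refine sup_le (Ideal.span_le.2 fun v hv => ?_) (hPJ.trans (le_quo J w))
    rw [SetLike.mem_coe, mem_quo, mul_comm]
    exact h v hv
  have := hle hfI
  rwa [mem_quo, mul_comm] at this

/-- How an ideal containing a complete intersection of type `(a, a, 3)`, `a = b + 1`, passes from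
degree `b` to degree `b + 1`. -/
lemma IsCI.exists_of_three [Infinite K] {b : ℕ} (hb : 1 ≤ b) {J I : Ideal (MvPolynomial (Fin 3) K)}
    (hJ : IsCI [b + 1, b + 1, 3] J) (hJI : J ≤ I) :
    ∃ P I₁ : Ideal (MvPolynomial (Fin 3) K), IsCI [3] P ∧ IsHomog I₁ ∧ P ≤ I₁ ∧ I₁ ≤ I ∧
      hilb I₁ b = hilb I b ∧ hilb J b = hilb P b ∧ hilb J (b + 1) = hilb P (b + 1) + 2 ∧
      (hilb I₁ (b + 1) + 2 ≤ hilb I (b + 1) ∨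
      (hilb I₁ (b + 1) + 1 ≤ hilb I (b + 1) ∧
        (hilbTop K 3 (b + 1) + hilb I₁ b ≤ hilb I₁ (b + 1) + hilbTop K 3 b ∨
          (hilb I b = hilb P b + 1 ∧
            hilbTop K 3 (b + 1) + hilb I₁ b = hilb I₁ (b + 1) + hilbTop K 3 b + 1))) ∨
      (hilbTop K 3 (b + 1) + hilb I₁ b ≤ hilb I₁ (b + 1) + hilbTop K 3 b ∧
        ∃ J', IsCI [b, b, 3] J' ∧ J' ≤ I₁)) := by
  have hJtop : ∀ t, 2 * (b + 1) < t → hilb J t = hilbTop K 3 t := fun t ht =>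
    hJ.hilb_three_of_lt (by omega) ht
  rcases hJ with - | ⟨f₃, hJ₂, hf₃, -, hn₃⟩
  rcases hJ₂ with - | ⟨f₂, hP, hf₂, -, hn₂⟩
  rename_i P
  set J₂ := P ⊔ Ideal.span {f₂} with hJ₂def
  have hJ₂ : IsCI [b + 1, 3] J₂ := IsCI.cons f₂ hP hf₂ (by omega) hn₂
  set J := J₂ ⊔ Ideal.span {f₃} with hJdef
  have hJ : IsCI [b + 1, b + 1, 3] J := IsCI.cons f₃ hJ₂ hf₃ (by omega) hn₃
  have hPJ₂ : P ≤ J₂ := le_sup_left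
  have hJ₂J : J₂ ≤ J := le_sup_left
  set I₁ := Ideal.span (component I b : Set (MvPolynomial (Fin 3) K)) ⊔ P with hI₁def
  have hPI₁ : P ≤ I₁ := le_sup_right
  have hI₁ : IsHomog I₁ :=
    (isHomog_span (d := fun _ => b) fun f hf => (mem_component.1 hf).2).sup hP.isHomog
  have hI₁I : I₁ ≤ I := sup_le (Ideal.span_le.2 fun f hf => (mem_component.1 hf).1)
    (hPJ₂.trans (hJ₂J.trans hJI))
  have hcomp : component I b ≤ component I₁ b := fun f hf =>
    mem_component.2 ⟨Ideal.mem_sup_left (Ideal.subset_span hf), (mem_component.1 hf).2⟩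
  have hI₁b : hilb I₁ b = hilb I b :=
    le_antisymm (hilb_mono hI₁I b) (hilb_le_of_component_le hcomp)
  have hT0 := hilbTop_zero K 3
  have hT1 := hilbTop_three K 0
  have hJ₂b : hilb J₂ b = hilb P b := hilb_sup_span_of_lt hP.isHomog hf₂ (by omega)
  have hJb : hilb J b = hilb J₂ b := hilb_sup_span_of_lt hJ₂.isHomog hf₃ (by omega)
  have hP0 : hilb P 0 = 0 := by
    rcases hP with - | ⟨g, hB, hg, -, hn⟩
    rcases hB with - | _
    rw [hilb_sup_span_of_lt isHomog_bot hg (by omega), hilb_bot]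
  have hP1 : hilb P 1 = 0 := by
    rcases hP with - | ⟨g, hB, hg, -, hn⟩
    rcases hB with - | _
    rw [hilb_sup_span_of_lt isHomog_bot hg (by omega), hilb_bot]
  have hJ₂a : hilb J₂ (b + 1) = hilb P (b + 1) + 1 := by
    have := hilb_sup_span_of_nzd hP hf₂ hn₂ 0
    rw [hP0, hT0, zero_add, add_zero] at this
    exact this
  have hJ₂0 : hilb J₂ 0 = 0 := by
    rw [hJ₂def, hilb_sup_span_of_lt hP.isHomog hf₂ (by omega), hP0]
  have hJa : hilb J (b + 1) = hilb P (b + 1) + 2 := by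
    have := hilb_sup_span_of_nzd hJ₂ hf₃ hn₃ 0
    rw [hJ₂0, hT0, zero_add, add_zero, ← hJdef] at this
    omega
  have hPb := hP.hilb_one hb
  refine ⟨P, I₁, hP, hI₁, hPI₁, hI₁I, hI₁b, hJb.trans hJ₂b, hJa, ?_⟩
  have hsup := hilb_sup_add_hilb_inf hI₁ hJ.isHomog (b + 1)
  have hsupI := hilb_mono (sup_le hI₁I hJI) (b + 1)
  have hinf := hilb_mono (le_inf hPI₁ (hPJ₂.trans hJ₂J)) (b + 1)
  have hinfJ := hilb_mono (inf_le_right : I₁ ⊓ J ≤ J) (b + 1)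
  by_cases hA : hilb (I₁ ⊓ J) (b + 1) = hilb P (b + 1)
  · exact Or.inl (by omega)
  right
  obtain ⟨f, hfh, hfmem, hfP⟩ := exists_of_hilb_lt (lt_of_le_of_ne hinf (Ne.symm hA))
  have hconst : ∀ w : MvPolynomial (Fin 3) K, w.IsHomogeneous 0 → ∃ r, w = C r := fun w hw =>
    ⟨_, totalDegree_eq_zero_iff_eq_C.1 (Nat.le_zero.1 hw.totalDegree_le)⟩
  have hfn : Nzd P f := by
    obtain ⟨w, hw, hfw⟩ := exists_of_mem_sup_span (d := 0) hJ₂.isHomog hf₃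
      (f := f) (mem_component.2 ⟨hfmem.2, by rwa [zero_add]⟩)
    obtain ⟨w', hw', hfw'⟩ := exists_of_mem_sup_span (d := 0) hP.isHomog hf₂ hfw
    obtain ⟨β, rfl⟩ := hconst w hw
    obtain ⟨α, rfl⟩ := hconst w' hw'
    have hfw' := (mem_component.1 hfw').1
    by_cases hβ : β = 0
    · subst hβ
      rw [C_0, zero_mul, sub_zero] at hfw'
      have hα : α ≠ 0 := by
        rintro rfl
        rw [C_0, zero_mul, sub_zero] at hfw'
        exact hfP hfw'
      exact (hn₂.C_mul hα).of_sub_mem hfw'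
    · have h1 : Nzd J₂ f := by
        refine (hn₃.C_mul hβ).of_sub_mem ?_
        have := J₂.add_mem (hPJ₂ hfw') (Ideal.mem_sup_right
          (Ideal.mul_mem_left _ (C α) (Ideal.mem_span_singleton_self f₂)))
        rwa [sub_add_cancel] at this
      exact nzd_of_nzd_sup hP.isHomog hf₂ (by omega) hfh hn₂ h1
  obtain ⟨u, hu, hun⟩ := exists_mem_nzd_of_span le_rfl hfn hfmem.1
  obtain ⟨huI, huh⟩ := mem_component.1 hu
  set Q := P ⊔ Ideal.span {u} with hQdef
  have hQ : IsCI [b, 3] Q := IsCI.cons u hP huh (by omega) hun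
  have hQI₁ : Q ≤ I₁ := sup_le hPI₁ ((Ideal.span_singleton_le_iff_mem _).2
    (Ideal.mem_sup_left (Ideal.subset_span hu)))
  have hQb : hilb Q b = hilb P b + 1 := by
    have := hilb_sup_span_of_nzd hP huh hun 0
    rw [hP0, hT0, zero_add, add_zero] at this
    exact this
  have hQa : hilb Q (b + 1) = hilb P (b + 1) + 3 := by
    have := hilb_sup_span_of_nzd hP huh hun 1
    rw [hP1, add_comm 1 b, ← hQdef] at this
    rw [zero_add] at hT1
    omega
  have hgrow : hilb Q b < hilb I₁ b →
      hilbTop K 3 (b + 1) + hilb I₁ b ≤ hilb I₁ (b + 1) + hilbTop K 3 b := by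
    intro hlt
    obtain ⟨l, hl, hln⟩ := hQ.exists_linear_nzd (by simp)
    obtain ⟨π, hπ⟩ := exists_isProj hl (hln.ne_zero hQ.one_notMem)
    have := hilb_growth hπ hQ.isHomog hln (d := b)
      (fun e he => (hQ.map hπ hln).noSocle_of_ne (by simp) (by simp; omega)) hI₁ hQI₁ hlt
    omega
  have hQI₁' : hilb Q b = hilb I₁ b → I₁ = Q := fun h => by
    refine le_antisymm (sup_le (Ideal.span_le.2 fun v hv => ?_) le_sup_left) hQI₁
    have := component_eq_of_hilb_le (component_mono hQI₁ b) h.ge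
    exact (mem_component.1 (this ▸ hcomp hv)).1
  have hQle := hilb_mono hQI₁ b
  by_cases hB : hilb (I₁ ⊓ J) (b + 1) = hilb P (b + 1) + 1
  · refine Or.inl ⟨by omega, ?_⟩
    rcases hQle.lt_or_eq with h | h
    · exact Or.inl (hgrow h)
    · refine Or.inr ⟨by omega, ?_⟩
      rw [hQI₁' h]
      omega
  right
  have hJI₁ : J ≤ I₁ := by
    have hc := component_eq_of_hilb_le (component_mono (inf_le_right : I₁ ⊓ J ≤ J) (b + 1))
      (by omega)
    have hmem : ∀ g ∈ J, g.IsHomogeneous (b + 1) → g ∈ I₁ := fun g hg hgh =>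
      (mem_component.1 (hc.symm ▸ mem_component.2 ⟨hg, hgh⟩ : g ∈ component (I₁ ⊓ J) _)).1.1
    refine sup_le (sup_le hPI₁ ?_) ?_ <;> rw [Ideal.span_singleton_le_iff_mem]
    · exact hmem _ (hJ₂J (Ideal.mem_sup_right (Ideal.mem_span_singleton_self _))) hf₂
    · exact hmem _ (Ideal.mem_sup_right (Ideal.mem_span_singleton_self _)) hf₃
  obtain ⟨l, hl, hln⟩ := hQ.exists_linear_nzd (by simp)
  have hlJ : l ^ (2 * (b + 1) + 1) ∈ J := by
    have hc := component_eq_of_hilb_le (component_mono (le_top : J ≤ ⊤) (2 * (b + 1) + 1))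
      (hJtop _ (by omega)).ge
    have h1 : l ^ (2 * (b + 1) + 1) ∈ component ⊤ (2 * (b + 1) + 1) :=
      mem_component.2 ⟨Submodule.mem_top, by simpa using hl.pow (2 * (b + 1) + 1)⟩
    exact (mem_component.1 (hc ▸ h1)).1
  have hlN := hln.pow (2 * (b + 1) + 1)
  have hlt : hilb Q b < hilb I₁ b := by
    refine hQle.lt_of_ne fun h => hQ.one_notMem (hlN 1 ?_)
    rw [one_mul, ← hQI₁' h]
    exact hJI₁ hlJ
  obtain ⟨u', hu', hun'⟩ := exists_mem_nzd_of_span (P := P) le_sup_left hlN (hJI₁ hlJ)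
  refine ⟨hgrow hlt, Q ⊔ Ideal.span {u'},
    IsCI.cons u' hQ (mem_component.1 hu').2 (by omega) hun', sup_le hQI₁ ?_⟩
  rw [Ideal.span_singleton_le_iff_mem]
  exact Ideal.mem_sup_left (Ideal.subset_span hu')

lemma IsCI.hilb_growth_three [Infinite K] {b : ℕ} (hb : 1 ≤ b)
    {J I : Ideal (MvPolynomial (Fin 3) K)} (hJ : IsCI [b + 1, b + 1, 3] J) (hJI : J ≤ I)
    (h : hilb J b < hilb I b) :
    hilb J (b + 1) + hilb I b + 1 ≤ hilb I (b + 1) + hilb J b := by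
  obtain ⟨P, I₁, hP, hI₁, hPI₁, hI₁I, h1, h2, h3, h4⟩ := hJ.exists_of_three hb hJI
  have hPb := hP.hilb_one hb
  have := hilb_mono hI₁I (b + 1)
  rcases h4 with h4 | ⟨h4, h5 | h5⟩ | ⟨h4, -⟩
  · obtain ⟨l, hl, hln⟩ := hP.exists_linear_nzd (by simp)
    obtain ⟨π, hπ⟩ := exists_isProj hl (hln.ne_zero hP.one_notMem)
    have := hilb_growth hπ hP.isHomog hln (d := b)
      (fun e _ => (hP.map hπ hln).noSocle (by simp) e) hI₁ hPI₁ (by omega)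
    omega
  · omega
  · omega
  · omega

end ThreeVariables

section CriticalDegrees

variable {K : Type*} [Field K]

lemma lex_tsub_le_tsub_iff {n : ℕ} {k m m' : Fin n →₀ ℕ} (hm : m ≤ k) (hm' : m' ≤ k) :
    toLex (k - m) ≤ toLex (k - m') ↔ toLex m' ≤ toLex m := by
  obtain ⟨u, rfl⟩ := exists_add_of_le hm
  obtain ⟨v, hv⟩ := exists_add_of_le hm'
  rw [add_tsub_cancel_left, hv, add_tsub_cancel_left]
  have h : toLex m + toLex u = toLex m' + toLex v := congrArg toLex hv
  constructor
  · intro h1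
    by_contra! h2
    exact absurd h (add_lt_add_of_lt_of_le h2 h1).ne
  · intro h1
    by_contra! h2
    exact absurd h (add_lt_add_of_le_of_lt h1 h2).ne'

lemma exists_isUp_complement {n : ℕ} {c : ℕ → ℕ∞} {k : Fin n →₀ ℕ}
    (hk : ∀ m, Capped c m ↔ m ≤ k) {d e : ℕ} (hde : d + 1 + e = k.degree)
    {U : Finset (Fin n →₀ ℕ)} (hU : IsUp (box n c d) U) (hne : (sh c d U).Nonempty) :
    ∃ U', IsUp (box n c e) U' ∧ U'.card + (sh c d U).card = (box n c (d + 1)).card + 1 ∧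
      (box n c d).card + 1 ≤ (sh c e U').card + U.card := by
  classical
  have hdeg : ∀ m ≤ k, (k - m).degree + m.degree = k.degree := fun m hm => by
    rw [← map_add, tsub_add_cancel_of_le hm]
  have hmem : ∀ {m t t'}, t + t' = k.degree → m ∈ box n c t → m ≤ k ∧ k - m ∈ box n c t' := by
    intro m t t' ht hm
    obtain ⟨h1, h2⟩ := mem_box.1 hm
    rw [hk] at h2
    have := hdeg m h2
    exact ⟨h2, mem_box.2 ⟨by omega, (hk _).2 tsub_le_self⟩⟩
  have hinv : ∀ {m : Fin n →₀ ℕ}, m ≤ k → k - (k - m) = m := fun hm => tsub_tsub_cancel_of_le hm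
  obtain ⟨m₀, hm₀, hmin⟩ := (sh c d U).exists_min_image toLex hne
  have hshB := hU.isUp_sh
  have hm₀B := hshB.1 hm₀
  obtain ⟨hm₀k, hm₀c⟩ := hmem hde hm₀B
  set U' := (box n c e).filter fun m => toLex (k - m₀) ≤ toLex m with hU'
  have hU'up : IsUp (box n c e) U' :=
    ⟨Finset.filter_subset _ _, fun m hm m' hm' hle =>
      Finset.mem_filter.2 ⟨hm', (Finset.mem_filter.1 hm).2.trans hle⟩⟩
  have hcardU' : U'.card = (insert m₀ (box n c (d + 1) \ sh c d U)).card := by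
    refine Finset.card_bij' (fun m _ => k - m) (fun m _ => k - m) ?_ ?_ ?_ ?_
    · intro m hm
      obtain ⟨hm, hle⟩ := Finset.mem_filter.1 hm
      obtain ⟨hmk, hmc⟩ := hmem (t' := d + 1) (by omega) hm
      rw [Finset.mem_insert, Finset.mem_sdiff]
      by_contra! hcon
      have h1 := hmin _ (hcon.2 hmc)
      rw [← lex_tsub_le_tsub_iff tsub_le_self hm₀k, hinv hmk] at h1
      have := le_antisymm hle h1
      rw [toLex.injective.eq_iff] at this
      exact hcon.1 (by rw [← this, hinv hm₀k])
    · intro m hm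
      rcases Finset.mem_insert.1 hm with rfl | hm
      · exact Finset.mem_filter.2 ⟨hm₀c, le_rfl⟩
      · obtain ⟨hmB, hmS⟩ := Finset.mem_sdiff.1 hm
        obtain ⟨hmk, hmc⟩ := hmem hde hmB
        refine Finset.mem_filter.2 ⟨hmc, (lex_tsub_le_tsub_iff hm₀k hmk).2 ?_⟩
        by_contra! hlt
        exact hmS (hshB.2 _ hm₀ _ hmB hlt.le)
    · intro m hm
      exact hinv (hmem (t' := d + 1) (by omega) (Finset.mem_filter.1 hm).1).1
    · intro m hm
      rcases Finset.mem_insert.1 hm with rfl | hm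
      · exact hinv hm₀k
      · exact hinv (hmem hde (Finset.mem_sdiff.1 hm).1).1
  refine ⟨U', hU'up, ?_, ?_⟩
  · rw [hcardU', Finset.card_insert_of_notMem (by simp [hm₀]),
      Finset.card_sdiff_of_subset hshB.1]
    have := Finset.card_le_card hshB.1
    omega
  · obtain ⟨-, u, hu, i, rfl⟩ := mem_sh.1 hm₀
    have huB := hU.1 hu
    obtain ⟨huk, huc⟩ := hmem (t' := e + 1) (by omega) huB
    have husum : k - u = k - (u + Finsupp.single i 1) + Finsupp.single i 1 := by
      rw [← tsub_tsub, tsub_add_cancel_of_le]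
      exact le_tsub_of_add_le_left hm₀k
    have hush : k - u ∈ sh c e U' :=
      mem_sh.2 ⟨huc, _, Finset.mem_filter.2 ⟨hm₀c, le_rfl⟩, i, husum⟩
    have hsub : (insert u (box n c d \ U)).image (fun m => k - m) ⊆ sh c e U' := by
      intro m' hm'
      obtain ⟨m, hm, rfl⟩ := Finset.mem_image.1 hm'
      rcases Finset.mem_insert.1 hm with rfl | hm
      · exact hush
      · obtain ⟨hmB, hmU⟩ := Finset.mem_sdiff.1 hm
        obtain ⟨hmk, hmc⟩ := hmem (t' := e + 1) (by omega) hmB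
        refine hU'up.isUp_sh.2 _ hush _ hmc ((lex_tsub_le_tsub_iff huk hmk).2 ?_)
        by_contra! hlt
        exact hmU (hU.2 _ hu _ hmB hlt.le)
    have hcard := Finset.card_le_card hsub
    rw [Finset.card_image_of_injOn, Finset.card_insert_of_notMem (by simp [hu]),
      Finset.card_sdiff_of_subset hU.1] at hcard
    · have := Finset.card_le_card hU.1
      omega
    · have hle : ∀ m ∈ insert u (box n c d \ U), m ≤ k := by
        intro m hm
        rcases Finset.mem_insert.1 hm with rfl | hm
        · exact huk
        · exact (hmem (t' := e + 1) (by omega) (Finset.mem_sdiff.1 hm).1).1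
      intro m hm m' hm' h
      rw [← hinv (hle m hm), ← hinv (hle m' hm')]
      exact congrArg (k - ·) h

lemma ext_fin_three {m m' : Fin 3 →₀ ℕ} (h0 : m 0 = m' 0) (h1 : m 1 = m' 1) (h2 : m 2 = m' 2) :
    m = m' := by
  ext i
  fin_cases i
  exacts [h0, h1, h2]

lemma card_sh_capThree_le {b : ℕ} {U : Finset (Fin 3 →₀ ℕ)}
    (hU : IsUp (box 3 (capThree (b + 1)) b) U) :
    (sh (capThree (b + 1)) b U).card ≤ U.card + 2 := by
  refine hU.card_sh_le_filter.trans (Nat.add_le_add_left ?_ _)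
  rw [← Finset.card_image_of_injOn (f := fun m : Fin 3 →₀ ℕ => m 0)]
  · refine (Finset.card_le_card (t := {1, 2}) fun x hx => ?_).trans Finset.card_le_two
    obtain ⟨m, hm, rfl⟩ := Finset.mem_image.1 hx
    obtain ⟨hm, h2⟩ := Finset.mem_filter.1 hm
    change m 2 = 0 at h2
    have := mem_box_three.1 (sh_subset _ _ hm)
    rw [Finset.mem_insert, Finset.mem_singleton]
    omega
  · intro m hm m' hm' h
    obtain ⟨hm, h2⟩ := Finset.mem_filter.1 hm
    obtain ⟨hm', h2'⟩ := Finset.mem_filter.1 hm'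
    change m 2 = 0 at h2
    change m' 2 = 0 at h2'
    change m 0 = m' 0 at h
    have h3 := mem_box_three.1 (sh_subset _ _ hm)
    have h4 := mem_box_three.1 (sh_subset _ _ hm')
    exact ext_fin_three h (by omega) (by omega)

lemma card_sh_capThree_le_two {b : ℕ} (hb : 2 ≤ b) {U : Finset (Fin 3 →₀ ℕ)}
    (hU : IsUp (box 3 (capThree (b + 1)) b) U) (h1 : U.card ≤ 1) :
    (sh (capThree (b + 1)) b U).card ≤ 2 := by
  classical
  rcases Finset.eq_empty_or_nonempty U with rfl | ⟨u, hu⟩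
  · have : sh (capThree (b + 1)) b (∅ : Finset (Fin 3 →₀ ℕ)) = ∅ := by
      ext m; simp [mem_sh]
    simp [this]
  set t : Fin 3 →₀ ℕ := Finsupp.equivFunOnFinite.symm ![2, b - 2, 0] with ht
  have ht0 : t 0 = 2 := rfl
  have ht1 : t 1 = b - 2 := rfl
  have ht2 : t 2 = 0 := rfl
  have htB : t ∈ box 3 (capThree (b + 1)) b := mem_box_three.2 (by omega)
  have htU : t ∈ U := by
    refine hU.2 u hu t htB ?_
    by_contra! hlt
    obtain ⟨s, hs, hs'⟩ := Finsupp.Lex.lt_iff.1 hlt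
    simp only [ofLex_toLex] at hs hs'
    have hub := mem_box_three.1 (hU.1 hu)
    have hs0 : 0 < s → t 0 = u 0 := fun h => hs 0 h
    have hs1 : 1 < s → t 1 = u 1 := fun h => hs 1 h
    fin_cases s
    · change t 0 < u 0 at hs'; omega
    · have := hs0 (by decide)
      change t 1 < u 1 at hs'; omega
    · have := hs0 (by decide)
      have := hs1 (by decide)
      change t 2 < u 2 at hs'; omega
  have hUt : ∀ v ∈ U, v = t := fun v hv => Finset.card_le_one.1 h1 v hv t htU
  refine (Finset.card_le_card (t := {t + Finsupp.single 1 1, t + Finsupp.single 2 1})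
    fun m hm => ?_).trans Finset.card_le_two
  obtain ⟨hm, v, hv, i, rfl⟩ := mem_sh.1 hm
  obtain rfl := hUt v hv
  have h3 := (mem_box_three.1 hm).2.1
  rw [Finset.mem_insert, Finset.mem_singleton]
  fin_cases i
  · simp [ht0] at h3
  · exact Or.inl rfl
  · exact Or.inr rfl

lemma eghCapped_one : EGHCapped K 1 capOne [3] := by
  intro J I hJ hI hJI d U hU hUI
  have hbox := hJ.hilb_add_card_box (isCI_capOne le_rfl)
  have hmono := hilb_mono hJI (d + 1)
  rcases Finset.eq_empty_or_nonempty (sh capOne d U) with h | ⟨m, hm⟩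
  · simpa [h] using hmono
  · obtain ⟨-, u, hu, -⟩ := mem_sh.1 hm
    have hU1 : 0 < U.card := Finset.card_pos.2 ⟨u, hu⟩
    have h1 : hilb I d ≤ hilbTop K 1 d := hilb_mono le_top d
    have h2 := hilbTop_one K d
    have h3 := hilb_succ_eq_hilbTop (I := I) (d := d) (by omega)
    have h4 := Finset.card_le_card (sh_subset (c := capOne) (d := d) (U := U))
    have h5 := hbox (d + 1)
    omega

lemma eghCapped_capOne_three [Infinite K] : EGHCapped K 3 capOne [3] :=
  (eghCapped_one.succ rfl (by simp) (isCI_capOne le_rfl) (isCI_capOne (by omega))).succ rfl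
    (by simp) (isCI_capOne (by omega)) (isCI_capOne (by omega))

lemma box_capThree_eq {a d : ℕ} (hd : d < a) : box 3 (capThree a) d = box 3 capOne d := by
  ext m
  rw [mem_box_three, mem_box, capped_capOne, degree_fin_three]
  omega

lemma sh_capThree_subset {a d : ℕ} (U : Finset (Fin 3 →₀ ℕ)) :
    sh (capThree a) d U ⊆ sh capOne d U := by
  intro m hm
  obtain ⟨hm, h⟩ := mem_sh.1 hm
  obtain ⟨h1, h2⟩ := mem_box.1 hm
  exact mem_sh.2 ⟨mem_box.2 ⟨h1, capped_capOne.2 (capped_capThree.1 h2).1⟩, h⟩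

lemma eghCapped_three_of_lt [Infinite K] {a d : ℕ} (hd : d + 1 < a)
    {J I : Ideal (MvPolynomial (Fin 3) K)} (hJ : IsCI [a, a, 3] J) (hI : IsHomog I) (hJI : J ≤ I)
    {U : Finset (Fin 3 →₀ ℕ)} (hU : IsUp (box 3 (capThree a) d) U)
    (hUI : U.card + hilb J d ≤ hilb I d) :
    (sh (capThree a) d U).card + hilb J (d + 1) ≤ hilb I (d + 1) := by
  rcases hJ with - | ⟨f₃, hJ₂, hf₃, -, hn₃⟩
  have hJ₂' := hJ₂.isHomog
  rcases hJ₂ with - | ⟨f₂, hP, hf₂, -, hn₂⟩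
  rw [hilb_sup_span_of_lt hJ₂' hf₃ (by omega), hilb_sup_span_of_lt hP.isHomog hf₂ (by omega)]
    at hUI ⊢
  rw [box_capThree_eq (by omega)] at hU
  have h1 := eghCapped_capOne_three _ I hP hI (le_sup_left.trans (le_sup_left.trans hJI)) d U hU hUI
  have h2 := Finset.card_le_card (sh_capThree_subset (a := a) (d := d) U)
  omega

lemma eghCapped_three_critical [Infinite K] {b : ℕ} (hb : 2 ≤ b)
    {J I : Ideal (MvPolynomial (Fin 3) K)} (hJ : IsCI [b + 1, b + 1, 3] J) (hJI : J ≤ I)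
    {U : Finset (Fin 3 →₀ ℕ)} (hU : IsUp (box 3 (capThree (b + 1)) b) U)
    (hUI : U.card + hilb J b ≤ hilb I b) :
    (sh (capThree (b + 1)) b U).card + hilb J (b + 1) ≤ hilb I (b + 1) := by
  obtain ⟨P, I₁, hP, hI₁, hPI₁, hI₁I, h1, h2, h3, h4⟩ := hJ.exists_of_three (by omega) hJI
  have hPb := hP.hilb_one (d := b) (by omega)
  have hI₁a := hilb_mono hI₁I (b + 1)
  have hsh := card_sh_capThree_le hU
  rcases h4 with h4 | ⟨h4, h5 | h5⟩ | ⟨h4, J', hJ', hJ'I₁⟩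
  · have hU' := hU
    rw [box_capThree_eq (by omega)] at hU'
    have h5 := eghCapped_capOne_three P I₁ hP hI₁ hPI₁ b U hU' (by omega)
    have h6 := Finset.card_le_card (sh_capThree_subset (a := b + 1) (d := b) U)
    omega
  · omega
  · have := card_sh_capThree_le_two hb hU (by omega)
    omega
  · have hbox := hJ.hilb_add_card_box (isCI_capThree le_rfl (by omega)) (b + 1)
    have hshbox := Finset.card_le_card (sh_subset (c := capThree (b + 1)) (d := b) (U := U))
    have hle : hilb I₁ (b + 1) ≤ hilbTop K 3 (b + 1) := hilb_mono le_top _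
    rcases hle.lt_or_eq with hlt | heq
    · obtain ⟨b, rfl⟩ := Nat.exists_eq_add_of_le' (by omega : 1 ≤ b)
      have hl1 := hJ'.hilb_link_three (by omega) hI₁ hJ'I₁ (e := b + 1 + 1) (e' := b) (by omega)
      have hl2 := hJ'.hilb_link_three (by omega) hI₁ hJ'I₁ (e := b + 1) (e' := b + 1) (by omega)
      have := hJ'.hilb_growth_three (by omega) (le_link J' I₁) (by omega)
      omega
    · omega

lemma eghCapped_three_of_le [Infinite K] {a d : ℕ} (ha : 3 ≤ a) (hd : d + 1 ≤ a)
    {J I : Ideal (MvPolynomial (Fin 3) K)} (hJ : IsCI [a, a, 3] J) (hI : IsHomog I) (hJI : J ≤ I)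
    {U : Finset (Fin 3 →₀ ℕ)} (hU : IsUp (box 3 (capThree a) d) U)
    (hUI : U.card + hilb J d ≤ hilb I d) :
    (sh (capThree a) d U).card + hilb J (d + 1) ≤ hilb I (d + 1) := by
  rcases hd.lt_or_eq with h | rfl
  · exact eghCapped_three_of_lt h hJ hI hJI hU hUI
  · exact eghCapped_three_critical (by omega) hJ hJI hU hUI

lemma eghCapped_three [Infinite K] {a : ℕ} (ha : 3 ≤ a) :
    EGHCapped K 3 (capThree a) [a, a, 3] := by
  intro J I hJ hI hJI d U hU hUI
  have hmono := hilb_mono hJI (d + 1)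
  rcases le_or_gt (d + 1) a with hd | hd
  · exact eghCapped_three_of_le ha hd hJ hI hJI hU hUI
  rcases Finset.eq_empty_or_nonempty (sh (capThree a) d U) with h | hne
  · simpa [h] using hmono
  have hd2 : d + 1 ≤ 2 * a := by
    obtain ⟨m, hm⟩ := hne
    have := mem_box_three.1 (sh_subset _ _ hm)
    omega
  obtain ⟨e, he⟩ := Nat.exists_eq_add_of_le hd2
  obtain ⟨U', hU', h1, h2⟩ := exists_isUp_complement (capped_capThree_iff_le (by omega))
    (e := e) (by rw [degree_topThree (by omega)]; omega) hU hne
  have hb := hJ.hilb_add_card_box (isCI_capThree le_rfl (by omega))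
  have hb1 := hb d
  have hb2 := hb (d + 1)
  have hl1 := hJ.hilb_link_three (by omega) hI hJI (e := d + 1) (e' := e) (by omega)
  have hl2 := hJ.hilb_link_three (by omega) hI hJI (e := d) (e' := e + 1) (by omega)
  by_contra hcon
  have := eghCapped_three_of_le ha (by omega) hJ (isHomog_link hJ.isHomog hI) (le_link J I) hU'
    (by omega)
  omega

lemma eghCapped_capThree [Infinite K] {a n : ℕ} (ha : 3 ≤ a) (hn : 3 ≤ n) :
    EGHCapped K n (capThree a) [a, a, 3] := by
  induction n, hn using Nat.le_induction with
  | base => exact eghCapped_three ha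
  | succ n hn ih =>
    refine ih.succ ?_ (by simpa using hn) (isCI_capThree hn (by omega))
      (isCI_capThree (by omega) (by omega))
    simp [capThree, capOne, Function.update, show n ≠ 0 by omega, show n ≠ 1 by omega,
      show n ≠ 2 by omega]

end CriticalDegrees

section Extension

variable {K L : Type*} [Field K] [Field L] [Algebra K L] {n : ℕ}

/-- Apply a `K`-linear functional to all coefficients of a polynomial. -/
noncomputable def coeffMap (ψ : L →ₗ[K] K) (u : MvPolynomial (Fin n) L) :
    MvPolynomial (Fin n) K :=
  ∑ m ∈ u.support, monomial m (ψ (coeff m u))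

lemma coeff_coeffMap (ψ : L →ₗ[K] K) (u : MvPolynomial (Fin n) L) (m : Fin n →₀ ℕ) :
    coeff m (coeffMap ψ u) = ψ (coeff m u) := by
  classical
  simp only [coeffMap, coeff_sum, coeff_monomial, Finset.sum_ite_eq', mem_support_iff]
  split_ifs with h
  · rfl
  · rw [not_not.1 h, map_zero]

lemma coeffMap_add (ψ : L →ₗ[K] K) (u v : MvPolynomial (Fin n) L) :
    coeffMap ψ (u + v) = coeffMap ψ u + coeffMap ψ v := by
  ext m; simp [coeff_coeffMap]

lemma coeffMap_mul_map (ψ : L →ₗ[K] K) (u : MvPolynomial (Fin n) L) (g : MvPolynomial (Fin n) K) :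
    coeffMap ψ (u * MvPolynomial.map (algebraMap K L) g) = coeffMap ψ u * g := by
  classical
  ext m
  rw [coeff_coeffMap, coeff_mul, coeff_mul, map_sum]
  refine Finset.sum_congr rfl fun p _ => ?_
  rw [coeff_coeffMap, coeff_map, mul_comm, ← Algebra.smul_def, map_smul, smul_eq_mul, mul_comm]

lemma homogeneousComponent_coeffMap (ψ : L →ₗ[K] K) (u : MvPolynomial (Fin n) L) (d : ℕ) :
    coeffMap ψ (homogeneousComponent d u) = homogeneousComponent d (coeffMap ψ u) := by
  ext m
  simp only [coeff_coeffMap, coeff_homogeneousComponent]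
  split_ifs <;> simp

lemma isHomogeneous_coeffMap (ψ : L →ₗ[K] K) {u : MvPolynomial (Fin n) L} {d : ℕ}
    (hu : u.IsHomogeneous d) : (coeffMap ψ u).IsHomogeneous d := by
  intro m hm
  refine hu fun h => hm ?_
  rw [coeff_coeffMap, h, map_zero]

lemma exists_eq_sum_coeffMap {ι : Type*} (b : Module.Basis ι K L) (u : MvPolynomial (Fin n) L) :
    ∃ s : Finset ι,
      u = ∑ i ∈ s, C (b i) * MvPolynomial.map (algebraMap K L) (coeffMap (b.coord i) u) := by
  classical
  refine ⟨u.support.biUnion fun m => (b.repr (coeff m u)).support, ?_⟩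
  ext m
  rw [coeff_sum]
  simp only [coeff_C_mul, coeff_map, coeff_coeffMap, Module.Basis.coord_apply]
  by_cases hm : m ∈ u.support
  · conv_lhs => rw [← b.linearCombination_repr (coeff m u), Finsupp.linearCombination_apply]
    rw [Finsupp.sum_of_support_subset _ (Finset.subset_biUnion_of_mem
      (fun m => (b.repr (coeff m u)).support) hm) _ (by simp)]
    refine Finset.sum_congr rfl fun i _ => ?_
    rw [Algebra.smul_def, mul_comm]
  · rw [notMem_support_iff.1 hm]
    simp

lemma mem_map_iff_coeffMap (I : Ideal (MvPolynomial (Fin n) K)) (u : MvPolynomial (Fin n) L) :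
    u ∈ I.map (MvPolynomial.map (algebraMap K L)) ↔ ∀ ψ : L →ₗ[K] K, coeffMap ψ u ∈ I := by
  constructor
  · intro hu ψ
    suffices h : ∀ v, coeffMap ψ (v * u) ∈ I by simpa using h 1
    induction hu using Submodule.span_induction with
    | mem w hw =>
      obtain ⟨g, hg, rfl⟩ := hw
      intro v
      rw [coeffMap_mul_map]
      exact I.mul_mem_left _ hg
    | zero => simp [coeffMap]
    | add w w' _ _ h h' => intro v; rw [mul_add, coeffMap_add]; exact I.add_mem (h v) (h' v)
    | smul r w _ h => intro v; rw [smul_eq_mul, ← mul_assoc]; exact h _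
  · intro h
    obtain ⟨s, hs⟩ := exists_eq_sum_coeffMap (Module.Basis.ofVectorSpace K L) u
    rw [hs]
    exact Ideal.sum_mem _ fun i _ => Ideal.mul_mem_left _ _ (Ideal.mem_map_of_mem _ (h _))

lemma IsHomog.map_algebraMap {I : Ideal (MvPolynomial (Fin n) K)} (hI : IsHomog I) :
    IsHomog (I.map (MvPolynomial.map (algebraMap K L))) := by
  intro f hf d
  rw [mem_map_iff_coeffMap] at hf ⊢
  intro ψ
  rw [homogeneousComponent_coeffMap]
  exact hI _ (hf ψ) d

lemma Nzd.map_algebraMap {J : Ideal (MvPolynomial (Fin n) K)} {g : MvPolynomial (Fin n) K}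
    (h : Nzd J g) : Nzd (J.map (MvPolynomial.map (algebraMap K L)))
      (MvPolynomial.map (algebraMap K L) g) := by
  intro u hu
  rw [mem_map_iff_coeffMap] at hu ⊢
  intro ψ
  have := hu ψ
  rw [coeffMap_mul_map] at this
  exact h _ this

lemma IsCI.map_algebraMap {as : List ℕ} {J : Ideal (MvPolynomial (Fin n) K)} (hJ : IsCI as J) :
    IsCI as (J.map (MvPolynomial.map (algebraMap K L))) := by
  induction hJ with
  | nil => rw [Ideal.map_bot]; exact IsCI.nil
  | cons g _ hg he hn ih =>
    rw [Ideal.map_sup, Ideal.map_span, Set.image_singleton]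
    exact IsCI.cons _ ih (hg.map _) he hn.map_algebraMap

variable (L) in
lemma hilb_map_algebraMap (I : Ideal (MvPolynomial (Fin n) K)) (d : ℕ) :
    hilb (I.map (MvPolynomial.map (algebraMap K L))) d = hilb I d := by
  let B := Module.finBasis K (component I d)
  let v : Fin (hilb I d) → MvPolynomial (Fin n) L := fun i =>
    MvPolynomial.map (algebraMap K L) (B i : MvPolynomial (Fin n) K)
  have hli : LinearIndependent L v := by
    rw [Fintype.linearIndependent_iff]
    intro r hr i
    have hψ : ∀ ψ : L →ₗ[K] K, ψ (r i) = 0 := by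
      intro ψ
      have h0 : ∑ i, ψ (r i) • B i = 0 := by
        apply Subtype.ext
        ext m
        have := congrArg (fun u => ψ (coeff m u)) hr
        simp only [v, coeff_sum, coeff_smul, coeff_map, map_sum, coeff_zero, map_zero,
          smul_eq_mul, mul_comm (r _), ← Algebra.smul_def, map_smul] at this
        simp only [Submodule.coe_sum, Submodule.coe_smul, Submodule.coe_zero, coeff_sum,
          coeff_smul, coeff_zero, smul_eq_mul]
        simpa [mul_comm] using this
      exact Fintype.linearIndependent_iff.1 B.linearIndependent _ h0 i
    have b := Module.Basis.ofVectorSpace K L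
    exact b.repr.map_eq_zero_iff.1 (Finsupp.ext fun j => hψ (b.coord j))
  have hspan : component (I.map (MvPolynomial.map (algebraMap K L))) d =
      Submodule.span L (Set.range v) := by
    apply le_antisymm
    · intro u hu
      obtain ⟨huI, hud⟩ := mem_component.1 hu
      rw [mem_map_iff_coeffMap] at huI
      obtain ⟨s, hs⟩ := exists_eq_sum_coeffMap (Module.Basis.ofVectorSpace K L) u
      rw [hs]
      refine Submodule.sum_mem _ fun i _ => ?_
      set ψ := (Module.Basis.ofVectorSpace K L).coord i
      have hw : coeffMap ψ u ∈ component I d :=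
        mem_component.2 ⟨huI ψ, isHomogeneous_coeffMap ψ hud⟩
      have h1 : coeffMap ψ u = ∑ j, B.repr ⟨_, hw⟩ j • (B j : MvPolynomial (Fin n) K) := by
        have := congrArg Subtype.val (B.sum_repr ⟨_, hw⟩)
        rw [Submodule.coe_sum] at this
        exact this.symm
      rw [h1, map_sum, Finset.mul_sum]
      refine Submodule.sum_mem _ fun j _ => ?_
      rw [smul_eq_C_mul, map_mul, map_C, ← mul_assoc, ← MvPolynomial.C_mul, ← smul_eq_C_mul]
      exact Submodule.smul_mem _ _ (Submodule.subset_span ⟨j, rfl⟩)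
    · rw [Submodule.span_le]
      rintro _ ⟨i, rfl⟩
      obtain ⟨h1, h2⟩ := mem_component.1 (B i).2
      exact mem_component.2 ⟨Ideal.mem_map_of_mem _ h1, h2.map _⟩
  rw [hilb, hspan, finrank_span_eq_card hli, Fintype.card_fin]

lemma EGHCapped.of_algebraMap {c : ℕ → ℕ∞} {as : List ℕ} (h : EGHCapped L n c as) :
    EGHCapped K n c as := by
  intro J I hJ hI hJI d U hU hUI
  have := h _ _ (hJ.map_algebraMap (L := L)) (hI.map_algebraMap (L := L)) (Ideal.map_mono hJI) d U
    hU (by rwa [hilb_map_algebraMap, hilb_map_algebraMap])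
  rwa [hilb_map_algebraMap, hilb_map_algebraMap] at this

end Extension

section LexPlusPowers

variable {K : Type*} [Field K] {n : ℕ} {c : ℕ → ℕ∞}

lemma lexLe_iff {m m' : Fin n →₀ ℕ} : lexLe m m' ↔ toLex m ≤ toLex m' := by
  rw [le_iff_eq_or_lt, Finsupp.Lex.lt_iff, toLex.injective.eq_iff]
  rfl

lemma expDeg_eq_degree (m : Fin n →₀ ℕ) : expDeg m = m.degree :=
  (Finsupp.degree_eq_sum m).symm

/-- The exponents of the lex-plus-powers ideal with prescribed lex-segments. -/
def LexPred (c : ℕ → ℕ∞) (V : ℕ → Finset (Fin n →₀ ℕ)) (m : Fin n →₀ ℕ) : Prop :=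
  ¬ Capped c m ∨ m ∈ V m.degree

lemma monotone_lexPred {V : ℕ → Finset (Fin n →₀ ℕ)} (hV : ∀ e, sh c e (V e) ⊆ V (e + 1)) :
    Monotone (LexPred c V) := by
  refine monotone_of_add_single fun m i h => ?_
  by_cases hcap : Capped c (m + Finsupp.single i 1)
  · have hm := h.resolve_left fun h' => h' (hcap.mono le_self_add)
    have hd : (m + Finsupp.single i 1).degree = m.degree + 1 := by
      rw [map_add, Finsupp.degree_single]
    refine Or.inr ?_
    rw [hd]
    exact hV _ (mem_sh.2 ⟨mem_box.2 ⟨hd, hcap⟩, m, hm, i, rfl⟩)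
  · exact Or.inl hcap

lemma hilb_lexPred {V : ℕ → Finset (Fin n →₀ ℕ)} (hV : ∀ e, sh c e (V e) ⊆ V (e + 1)) {e : ℕ}
    (hVe : V e ⊆ box n c e) :
    hilb (monoIdeal K (LexPred c V)) e = (V e).card + hilb (capIdeal K n c) e := by
  classical
  rw [capIdeal, hilb_monoIdeal monotone_not_capped
    (S := (box n (fun _ => ⊤) e).filter fun m => ¬ Capped c m) (fun m => by
      simp [mem_box, Capped]), ← Finset.card_union_of_disjoint]
  · refine hilb_monoIdeal (monotone_lexPred hV) fun m => ?_
    have h1 : m ∈ box n (fun _ => ⊤) e ↔ m.degree = e := by simp [mem_box, Capped]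
    rw [Finset.mem_union, Finset.mem_filter, h1, LexPred]
    constructor
    · rintro (h | h)
      · obtain ⟨rfl, -⟩ := mem_box.1 (hVe h)
        exact ⟨rfl, Or.inr h⟩
      · exact ⟨h.1, Or.inl h.2⟩
    · rintro ⟨rfl, h | h⟩
      · exact Or.inr ⟨rfl, h⟩
      · exact Or.inl h
  · rw [Finset.disjoint_left]
    intro m hm hm'
    exact (Finset.mem_filter.1 hm').2 (mem_box.1 (hVe hm)).2

lemma isLPP_lexPred {r : ℕ} {hrn : r ≤ n} {a : Fin r → ℕ}
    (hc : purePowers K hrn a = capIdeal K n c) {V : ℕ → Finset (Fin n →₀ ℕ)}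
    (hV : ∀ e, sh c e (V e) ⊆ V (e + 1)) (hVup : ∀ e, IsUp (box n c e) (V e)) :
    IsLPP hrn a (monoIdeal K (LexPred c V)) := by
  refine ⟨isHomog_monoIdeal (monotone_lexPred hV), fun e =>
    ⟨{m | m.degree = e ∧ ∃ u ∈ V e, toLex u ≤ toLex m}, ⟨fun m hm => ?_, ?_⟩, ?_⟩⟩
  · rw [expDeg_eq_degree]
    exact hm.1
  · rintro m ⟨-, u, hu, hum⟩ m' hm' hmm'
    rw [expDeg_eq_degree] at hm'
    exact ⟨hm', u, hu, hum.trans (lexLe_iff.1 hmm')⟩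
  · rw [hc, capIdeal, component_monoIdeal (monotone_lexPred hV),
      component_monoIdeal monotone_not_capped, ← Submodule.span_union, ← Set.image_union]
    congr 2
    ext m
    simp only [Set.mem_union, Set.mem_ofPred_eq, LexPred]
    constructor
    · rintro ⟨rfl, h | h⟩
      · exact Or.inr ⟨rfl, h⟩
      · exact Or.inl ⟨rfl, m, h, le_rfl⟩
    · rintro (⟨rfl, u, hu, hum⟩ | ⟨rfl, h⟩)
      · by_cases hcap : Capped c m
        · exact ⟨rfl, Or.inr ((hVup _).2 u hu m (mem_box.2 ⟨rfl, hcap⟩) hum)⟩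
        · exact ⟨rfl, Or.inl hcap⟩
      · exact ⟨rfl, Or.inl h⟩

lemma EGHCapped.eghd {r : ℕ} {hrn : r ≤ n} {a : Fin r → ℕ} {as : List ℕ}
    (h : EGHCapped K n c as) (hcap : IsCI as (capIdeal K n c))
    (hc : purePowers K hrn a = capIdeal K n c) {J I : Ideal (MvPolynomial (Fin n) K)}
    (hJ : IsCI as J) (hI : IsHomog I) (hJI : J ≤ I) : EGH hrn a I := by
  intro d
  have hJd := hilb_mono hJI d
  have hbox := hJ.hilb_add_card_box hcap d
  have hle : hilb I d ≤ hilbTop K n d := hilb_mono le_top d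
  obtain ⟨U, hU, hUc⟩ := exists_isUp_card (box n c d)
    (by omega : hilb I d - hilb J d ≤ (box n c d).card)
  have hgrow := h J I hJ hI hJI d U hU (by omega)
  let V : ℕ → Finset (Fin n →₀ ℕ) := fun e =>
    if e < d then ∅ else if e = d then U else if e = d + 1 then sh c d U else box n c e
  have hVd : V d = U := by simp [V]
  have hVd' : V (d + 1) = sh c d U := by simp [V]
  have hVup : ∀ e, IsUp (box n c e) (V e) := by
    intro e
    simp only [V]
    split_ifs with h1 h2 h3
    · exact ⟨Finset.empty_subset _, by simp⟩
    · rwa [h2]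
    · rw [h3]; exact hU.isUp_sh
    · exact ⟨subset_rfl, fun _ _ m' hm' _ => hm'⟩
  have hV : ∀ e, sh c e (V e) ⊆ V (e + 1) := by
    intro e
    rcases lt_trichotomy e d with h1 | rfl | h1
    · have : V e = ∅ := by simp [V, h1]
      rw [this]
      intro m hm
      simp [mem_sh] at hm
    · rw [hVd, hVd']
    · have : V (e + 1) = box n c (e + 1) := by
        simp [V, show ¬ e + 1 < d by omega, show e + 1 ≠ d by omega, show e ≠ d by omega]
      rw [this]
      exact sh_subset _ _
  have h1 := hJ.hilb_eq hcap d
  have h2 := hJ.hilb_eq hcap (d + 1)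
  refine ⟨_, isLPP_lexPred hc hV hVup, ?_, ?_⟩
  · rw [hilb_lexPred hV (hVup _).1, hVd]
    omega
  · rw [hilb_lexPred hV (hVup _).1, hVd']
    omega

lemma purePowers_three_eq_capIdeal (h3n : 3 ≤ n) (a : ℕ) :
    purePowers K h3n ![3, a, a] = capIdeal K n (capThree a) := by
  have hcap : ∀ i : Fin 3, capThree a (Fin.castLE h3n i : Fin n) = (![3, a, a] i : ℕ) := by
    intro i
    fin_cases i <;> rfl
  apply le_antisymm
  · refine Ideal.span_le.2 ?_
    rintro _ ⟨i, rfl⟩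
    change X (Fin.castLE h3n i) ^ ![3, a, a] i ∈ _
    rw [X_pow_eq_monomial]
    refine monomial_mem_monoIdeal (fun h => ?_) _
    have := h (Fin.castLE h3n i)
    rw [hcap, Finsupp.single_eq_same] at this
    exact lt_irrefl _ this
  · refine Ideal.span_le.2 ?_
    rintro _ ⟨m, hm, rfl⟩
    have hm : ∃ i : Fin n, capThree a i ≤ m i := by
      simpa [Capped] using hm
    obtain ⟨i, hi⟩ := hm
    have hi3 : (i : ℕ) < 3 := by
      by_contra! h
      have : capThree a i = ⊤ := by
        simp [capThree, capOne, Function.update, show (i : ℕ) ≠ 0 by omega,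
          show (i : ℕ) ≠ 1 by omega, show (i : ℕ) ≠ 2 by omega]
      rw [this] at hi
      exact absurd hi (by simp)
    obtain ⟨j, rfl⟩ : ∃ j : Fin 3, i = Fin.castLE h3n j := ⟨⟨i, hi3⟩, rfl⟩
    rw [hcap, Nat.cast_le] at hi
    have hle : Finsupp.single (Fin.castLE h3n j) (![3, a, a] j) ≤ m := by simpa using hi
    obtain ⟨v, rfl⟩ := exists_add_of_le hle
    change monomial _ (1 : K) ∈ _
    rw [show (1 : K) = 1 * 1 by simp, ← monomial_mul, ← X_pow_eq_monomial]
    exact Ideal.mul_mem_right _ _ (Ideal.subset_span ⟨j, rfl⟩)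

lemma IsRegSeq.exists_isCI {f : Fin 3 → MvPolynomial (Fin n) K} {e : Fin 3 → ℕ} (hf : IsRegSeq f)
    (hh : ∀ i, (f i).IsHomogeneous (e i)) (he : ∀ i, 0 < e i) :
    ∃ J, IsCI [e 2, e 1, e 0] J ∧ ∀ I, (∀ i, f i ∈ I) → J ≤ I := by
  have h0 : Ideal.span {p | ∃ j : Fin 3, j < 0 ∧ p = f j} = ⊥ := by
    simp
  have h1 : Ideal.span {p | ∃ j : Fin 3, j < 1 ∧ p = f j} = ⊥ ⊔ Ideal.span {f 0} := by
    rw [bot_sup_eq]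
    congr 1
    ext p
    simp
  have h2 : Ideal.span {p | ∃ j : Fin 3, j < 2 ∧ p = f j} =
      ⊥ ⊔ Ideal.span {f 0} ⊔ Ideal.span {f 1} := by
    rw [bot_sup_eq, ← Ideal.span_union]
    congr 1
    ext p
    simp [Fin.exists_fin_succ]
    exact or_comm
  have hc0 : IsCI [e 0] (⊥ ⊔ Ideal.span {f 0}) :=
    IsCI.cons _ IsCI.nil (hh 0) (he 0) (h0 ▸ hf 0)
  have hc1 := IsCI.cons _ hc0 (hh 1) (he 1) (h1 ▸ hf 1)
  have hc2 := IsCI.cons _ hc1 (hh 2) (he 2) (h2 ▸ hf 2)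
  refine ⟨_, hc2, fun I hI => ?_⟩
  simp only [sup_le_iff, bot_le, true_and, Ideal.span_singleton_le_iff_mem]
  exact ⟨⟨hI 0, hI 1⟩, hI 2⟩

end LexPlusPowers

/-- **Cooper.** For `a ≥ 3`, a homogeneous ideal `I ⊆ K[x_1,…,x_n]` containing a homogeneous
regular sequence of degree `(3,a,a)` satisfies `EGH_{(3,a,a)}`. -/
theorem cooper_three_a_a {K : Type*} [Field K] {n : ℕ} (h3n : 3 ≤ n)
    (a : ℕ) (ha : 3 ≤ a)
    (I : Ideal (MvPolynomial (Fin n) K)) (hI : IsHomog I)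
    (hreg : ContainsRegSeq ![3, a, a] I) :
    EGH h3n ![3, a, a] I := by
  obtain ⟨f, hfI, hf, hfh⟩ := hreg
  obtain ⟨J, hJ, hJI⟩ := hf.exists_isCI hfh (by
    intro i; fin_cases i <;> simp <;> omega)
  exact (eghCapped_capThree (K := AlgebraicClosure K) ha h3n).of_algebraMap.eghd
    (isCI_capThree h3n (by omega)) (purePowers_three_eq_capIdeal h3n a) hJ hI (hJI I hfI)
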